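/- arXiv:2305.20008 — 4 statements merged into one kernel-verified Lean document; each statement's English description precedes it below -/
import Mathlib

section
/- For every prime power q, the number of equivalence classes of rational functions of degree 3 in F_q(X) is: 𝔑(q,3) = 2(q+1) if q ≡ 1 or 4 (mod 6); 𝔑(q,3) = 2q if q ≡ 2 or 5 (mod 6); and 𝔑(q,3) = 2q+1 if q ≡ 3 (mod 6). -/
open Polynomial

/-- The degree of a rational function `f = P/Q` (with `P, Q` coprime) is
`max (deg P) (deg Q)`. -/
noncomputable def ratDeg {F : Type*} [Field F] (f : RatFunc F) : ℕ :=
  max f.num.natDegree f.denom.natDegree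

/-- Composition (substitution) of rational functions: `(rcomp f g)(X) = f(g(X))`. -/
noncomputable def rcomp {F : Type*} [Field F] (f g : RatFunc F) : RatFunc F :=
  Polynomial.aeval g f.num / Polynomial.aeval g f.denom

/-- The number of equivalence classes of rational functions of degree `n` over `F`,
where `f ~ g` iff `g = φ ∘ f ∘ ψ` for degree-one rational functions `φ, ψ`. -/
noncomputable def ratEquivCount (F : Type*) [Field F] (n : ℕ) : ℕ :=
  Nat.card (Quot (fun f g : {f : RatFunc F // ratDeg f = n} =>
    ∃ φ ψ : RatFunc F, ratDeg φ = 1 ∧ ratDeg ψ = 1 ∧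
      (g : RatFunc F) = rcomp φ (rcomp (f : RatFunc F) ψ)))

/-- The value at `(u, v)` of the binary cubic form `∑ w i * x ^ i * y ^ (3 - i)`. -/
def cubicEval {F K : Type*} [Field F] [Field K] [Algebra F K] (w : Fin 4 → F) (u v : K) : K :=
  algebraMap F K (w 3) * u ^ 3 + algebraMap F K (w 2) * u ^ 2 * v +
    algebraMap F K (w 1) * u * v ^ 2 + algebraMap F K (w 0) * v ^ 3

/-- The substitution `(x, y) ↦ (x, y) g` on binary cubic forms. -/
def cubicAct {F : Type*} [Field F] (g : Matrix (Fin 2) (Fin 2) F) :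
    (Fin 4 → F) →ₗ[F] (Fin 4 → F) where
  toFun w := ![
    w 3 * g 1 0 ^ 3 + w 2 * (g 1 0 ^ 2 * g 1 1) + w 1 * (g 1 0 * g 1 1 ^ 2) + w 0 * g 1 1 ^ 3,
    w 3 * (3 * g 0 0 * g 1 0 ^ 2) + w 2 * (2 * g 0 0 * g 1 0 * g 1 1 + g 0 1 * g 1 0 ^ 2) +
      w 1 * (g 0 0 * g 1 1 ^ 2 + 2 * g 0 1 * g 1 0 * g 1 1) + w 0 * (3 * g 0 1 * g 1 1 ^ 2),
    w 3 * (3 * g 0 0 ^ 2 * g 1 0) + w 2 * (g 0 0 ^ 2 * g 1 1 + 2 * g 0 0 * g 0 1 * g 1 0) +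
      w 1 * (2 * g 0 0 * g 0 1 * g 1 1 + g 0 1 ^ 2 * g 1 0) + w 0 * (3 * g 0 1 ^ 2 * g 1 1),
    w 3 * g 0 0 ^ 3 + w 2 * (g 0 0 ^ 2 * g 0 1) + w 1 * (g 0 0 * g 0 1 ^ 2) + w 0 * g 0 1 ^ 3]
  map_add' v w := by ext i; fin_cases i <;> simp <;> ring
  map_smul' c w := by ext i; fin_cases i <;> simp <;> ring

section Cubic

variable {F : Type*} [Field F]

lemma cubicAct_mul (g h : Matrix (Fin 2) (Fin 2) F) (w : Fin 4 → F) :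
    cubicAct (g * h) w = cubicAct g (cubicAct h w) := by
  ext i
  fin_cases i <;> simp [cubicAct, Matrix.mul_apply, Fin.sum_univ_two] <;> ring

lemma cubicAct_one (w : Fin 4 → F) : cubicAct (1 : Matrix (Fin 2) (Fin 2) F) w = w := by
  ext i
  fin_cases i <;> simp [cubicAct]

lemma cubicEval_act {K : Type*} [Field K] [Algebra F K] (g : Matrix (Fin 2) (Fin 2) F)
    (w : Fin 4 → F) (u v : K) :
    cubicEval (cubicAct g w) u v =
      cubicEval w (algebraMap F K (g 0 0) * u + algebraMap F K (g 1 0) * v)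
        (algebraMap F K (g 0 1) * u + algebraMap F K (g 1 1) * v) := by
  simp only [cubicEval, cubicAct, LinearMap.coe_mk, AddHom.coe_mk, Matrix.cons_val, map_add, map_mul,
    map_pow, map_ofNat]
  ring

lemma cubicEval_smul_add {K : Type*} [Field K] [Algebra F K] (s r : F) (P Q : Fin 4 → F)
    (u v : K) : cubicEval (s • P + r • Q) u v =
      algebraMap F K s * cubicEval P u v + algebraMap F K r * cubicEval Q u v := by
  simp [cubicEval]
  ring

lemma exists_cubicEval_eq_zero {K : Type*} [Field K] [IsAlgClosed K] [Algebra F K]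
    (w : Fin 4 → F) : ∃ u v : K, ¬(u = 0 ∧ v = 0) ∧ cubicEval w u v = 0 := by
  by_cases h : w 3 = 0
  · exact ⟨1, 0, by simp, by simp [cubicEval, h]⟩
  · have h' : algebraMap F K (w 3) ≠ 0 := by simpa using h
    obtain ⟨x, hx⟩ := IsAlgClosed.exists_root
      (C (algebraMap F K (w 3)) * X ^ 3 + C (algebraMap F K (w 2)) * X ^ 2 +
        C (algebraMap F K (w 1)) * X + C (algebraMap F K (w 0))) (by
        rw [degree_cubic h']; decide)
    refine ⟨x, 1, by simp, ?_⟩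
    simpa [IsRoot, cubicEval] using hx

/-- A space of binary cubic forms without common zero over the algebraic closure. -/
def BasePointFree (W : Submodule F (Fin 4 → F)) : Prop :=
  ∀ u v : AlgebraicClosure F, (∀ w ∈ W, cubicEval w u v = 0) → u = 0 ∧ v = 0

lemma basePointFree_span_pair {P Q : Fin 4 → F} :
    BasePointFree (Submodule.span F {P, Q}) ↔ ∀ u v : AlgebraicClosure F,
      cubicEval P u v = 0 → cubicEval Q u v = 0 → u = 0 ∧ v = 0 := by
  refine forall₂_congr fun u v => ⟨fun h hP hQ => h ?_, fun h hw => h ?_ ?_⟩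
  · intro w hw
    obtain ⟨s, r, rfl⟩ := Submodule.mem_span_pair.1 hw
    rw [cubicEval_smul_add, hP, hQ]
    simp
  · exact hw _ (Submodule.subset_span (by simp))
  · exact hw _ (Submodule.subset_span (by simp))

lemma BasePointFree.pair_independent {P Q : Fin 4 → F}
    (h : BasePointFree (Submodule.span F {P, Q})) : LinearIndependent F ![P, Q] := by
  rw [LinearIndependent.pair_iff]
  rw [basePointFree_span_pair] at h
  have key : ∀ P Q : Fin 4 → F, (∀ u v : AlgebraicClosure F,
      cubicEval P u v = 0 → cubicEval Q u v = 0 → u = 0 ∧ v = 0) →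
      ∀ s r : F, s • P + r • Q = 0 → s = 0 := by
    intro P Q h s r hsr
    by_contra hs
    obtain ⟨u, v, huv, hQ⟩ := exists_cubicEval_eq_zero (K := AlgebraicClosure F) Q
    refine huv (h u v ?_ hQ)
    have := cubicEval_smul_add s r P Q u v
    rw [hsr, hQ] at this
    simpa [cubicEval, hs] using this
  intro s r hsr
  exact ⟨key P Q h s r hsr, key Q P (fun u v a b => h u v b a) r s (by rw [add_comm, hsr])⟩

variable (F) in
/-- Base point free pencils of binary cubic forms. -/
abbrev CubicPencil : Type _ :=
  {W : Submodule F (Fin 4 → F) // (∃ P Q, W = Submodule.span F {P, Q}) ∧ BasePointFree W}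

lemma finrank_span_pair {P Q : Fin 4 → F} (h : LinearIndependent F ![P, Q]) :
    Module.finrank F (Submodule.span F {P, Q}) = 2 := by
  have := finrank_span_eq_card h
  rwa [Matrix.range_cons_cons_empty, Fintype.card_fin] at this

lemma CubicPencil.finrank_eq (W : CubicPencil F) : Module.finrank F W.1 = 2 := by
  obtain ⟨W, ⟨P, Q, rfl⟩, h⟩ := W
  exact finrank_span_pair h.pair_independent

lemma CubicPencil.eq_span (W : CubicPencil F) {P Q : Fin 4 → F} (hP : P ∈ W.1) (hQ : Q ∈ W.1)
    (h : ∀ s r : F, s • P + r • Q = 0 → s = 0 ∧ r = 0) : W.1 = Submodule.span F {P, Q} := by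
  have hli : LinearIndependent F ![P, Q] := LinearIndependent.pair_iff.2 h
  refine (Submodule.eq_of_le_of_finrank_eq ?_ ?_).symm
  · rw [Submodule.span_le]
    rintro x (rfl | rfl) <;> assumption
  · rw [finrank_span_pair hli, W.finrank_eq]

lemma basePointFree_map {W : Submodule F (Fin 4 → F)} (h : BasePointFree W)
    (g : GL (Fin 2) F) : BasePointFree (W.map (cubicAct g.1)) := by
  intro u v huv
  have h1 := h _ _ fun w hw => by
    have := huv _ (Submodule.mem_map_of_mem hw)
    rwa [cubicEval_act] at this
  set K := AlgebraicClosure F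
  have hdet : algebraMap F K (g.1 0 0) * algebraMap F K (g.1 1 1) -
      algebraMap F K (g.1 0 1) * algebraMap F K (g.1 1 0) ≠ 0 := by
    have := g.det.ne_zero
    rw [Matrix.GeneralLinearGroup.val_det_apply, Matrix.det_fin_two] at this
    rw [← map_mul, ← map_mul, ← map_sub]
    rwa [Ne, map_eq_zero]
  constructor
  · refine (mul_eq_zero.1 ?_).resolve_left hdet
    linear_combination algebraMap F K (g.1 1 1) * h1.1 - algebraMap F K (g.1 1 0) * h1.2
  · refine (mul_eq_zero.1 ?_).resolve_left hdet
    linear_combination - algebraMap F K (g.1 0 1) * h1.1 + algebraMap F K (g.1 0 0) * h1.2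

lemma map_cubicAct_span_pair (g : Matrix (Fin 2) (Fin 2) F) (P Q : Fin 4 → F) :
    (Submodule.span F {P, Q}).map (cubicAct g) =
      Submodule.span F {cubicAct g P, cubicAct g Q} := by
  rw [Submodule.map_span, Set.image_pair]

instance : MulAction (GL (Fin 2) F) (CubicPencil F) where
  smul g W := ⟨W.1.map (cubicAct g.1), by
    obtain ⟨P, Q, h⟩ := W.2.1
    exact ⟨_, _, by rw [h, map_cubicAct_span_pair]⟩, basePointFree_map W.2.2 g⟩
  one_smul W := Subtype.ext <| by
    change W.1.map (cubicAct 1) = W.1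
    rw [show cubicAct (1 : Matrix (Fin 2) (Fin 2) F) = LinearMap.id from
      LinearMap.ext cubicAct_one, Submodule.map_id]
  mul_smul g h W := Subtype.ext <| by
    change W.1.map (cubicAct (g.1 * h.1)) = (W.1.map (cubicAct h.1)).map (cubicAct g.1)
    rw [← Submodule.map_comp]
    exact congrArg (W.1.map ·) (LinearMap.ext (cubicAct_mul _ _))

lemma CubicPencil.coe_smul (g : GL (Fin 2) F) (W : CubicPencil F) :
    (g • W).1 = W.1.map (cubicAct g.1) := rfl

lemma mem_fixedBy_of_forall_mem {g : GL (Fin 2) F} {W : CubicPencil F}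
    (h : ∀ w ∈ W.1, cubicAct g.1 w ∈ W.1) : W ∈ MulAction.fixedBy (CubicPencil F) g := by
  rw [MulAction.mem_fixedBy]
  refine Subtype.ext ?_
  rw [CubicPencil.coe_smul]
  exact Submodule.eq_of_le_of_finrank_eq (Submodule.map_le_iff_le_comap.2 h)
    ((g • W).finrank_eq.trans W.finrank_eq.symm)

lemma act_mem_of_mem_fixedBy {g : GL (Fin 2) F} {W : CubicPencil F}
    (h : W ∈ MulAction.fixedBy (CubicPencil F) g) {w : Fin 4 → F} (hw : w ∈ W.1) :
    cubicAct g.1 w ∈ W.1 := by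
  rw [MulAction.mem_fixedBy] at h
  have := congrArg Subtype.val h
  rw [CubicPencil.coe_smul] at this
  rw [← this]
  exact Submodule.mem_map_of_mem hw

end Cubic

section RationalFunctions

variable {F : Type*} [Field F]

/-- The dehomogenization of a binary cubic form, as a polynomial. -/
noncomputable def cubicPoly (w : Fin 4 → F) : F[X] :=
  C (w 3) * X ^ 3 + C (w 2) * X ^ 2 + C (w 1) * X + C (w 0)

/-- The coefficients of a polynomial in degrees below four. -/
def cubicCoeff (P : F[X]) : Fin 4 → F := fun i => P.coeff i

lemma cubicCoeff_poly (w : Fin 4 → F) : cubicCoeff (cubicPoly w) = w := by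
  ext i
  fin_cases i <;> simp [cubicCoeff, cubicPoly, coeff_X, coeff_C]

lemma cubicPoly_coeff {P : F[X]} (h : P.natDegree ≤ 3) : cubicPoly (cubicCoeff P) = P := by
  conv_rhs => rw [P.as_sum_range_C_mul_X_pow' (n := 4) (by omega)]
  simp only [cubicPoly, cubicCoeff, Finset.sum_range_succ, Finset.sum_range_zero]
  simp
  ring

lemma natDegree_cubicPoly_le (w : Fin 4 → F) : (cubicPoly w).natDegree ≤ 3 := natDegree_cubic_le

lemma cubicCoeff_C_mul (c : F) (P : F[X]) : cubicCoeff (C c * P) = c • cubicCoeff P := by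
  ext i
  simp [cubicCoeff]

lemma cubicEval_one {K : Type*} [Field K] [Algebra F K] (w : Fin 4 → F) (u : K) :
    cubicEval w u 1 = aeval u (cubicPoly w) := by
  simp [cubicEval, cubicPoly]

lemma cubicEval_smul {K : Type*} [Field K] [Algebra F K] (w : Fin 4 → F) (c u v : K) :
    cubicEval w (c * u) (c * v) = c ^ 3 * cubicEval w u v := by
  simp only [cubicEval]
  ring

lemma basePointFree_span_pair_iff {P Q : Fin 4 → F} :
    BasePointFree (Submodule.span F {P, Q}) ↔
      IsCoprime (cubicPoly P) (cubicPoly Q) ∧ (P 3 ≠ 0 ∨ Q 3 ≠ 0) := by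
  rw [basePointFree_span_pair,
    isCoprime_iff_aeval_ne_zero_of_isAlgClosed F (AlgebraicClosure F)]
  constructor
  · intro h
    refine ⟨fun a => ?_, ?_⟩
    · by_contra! ha
      rw [← cubicEval_one, ← cubicEval_one] at ha
      exact one_ne_zero (h a 1 ha.1 ha.2).2
    · by_contra! ha
      exact one_ne_zero (h 1 0 (by simp [cubicEval, ha.1]) (by simp [cubicEval, ha.2])).1
  · rintro ⟨h1, h2⟩ u v hP hQ
    by_cases hv : v = 0
    · subst hv
      refine ⟨?_, rfl⟩
      by_contra hu
      simp_all [cubicEval]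
    · have h3 : ∀ w : Fin 4 → F, cubicEval w u v = v ^ 3 * aeval (u / v) (cubicPoly w) := by
        intro w
        rw [← cubicEval_one, ← cubicEval_smul, mul_one, mul_div_cancel₀ _ hv]
      rw [h3] at hP hQ
      have := h1 (u / v)
      simp_all

lemma exists_num_denom_div {A B : F[X]} (h : IsCoprime A B) (hB : B ≠ 0) :
    ∃ c : F, c ≠ 0 ∧ (algebraMap F[X] (RatFunc F) A / algebraMap F[X] (RatFunc F) B).num = C c * A ∧
      (algebraMap F[X] (RatFunc F) A / algebraMap F[X] (RatFunc F) B).denom = C c * B := by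
  set f := algebraMap F[X] (RatFunc F) A / algebraMap F[X] (RatFunc F) B with hf
  have h1 : f.num * B = A * f.denom := by
    rw [RatFunc.num_mul_eq_mul_denom_iff hB]
  have h2 : B ∣ f.denom := h.symm.dvd_of_dvd_mul_left ⟨f.num, by rw [← h1, mul_comm]⟩
  have h3 : f.denom ∣ B :=
    (RatFunc.isCoprime_num_denom f).symm.dvd_of_dvd_mul_left ⟨A, by rw [h1, mul_comm]⟩
  obtain ⟨u, hu⟩ := associated_of_dvd_dvd h2 h3
  obtain ⟨c, hc, hcu⟩ := Polynomial.isUnit_iff.1 u.isUnit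
  refine ⟨c, hc.ne_zero, ?_, ?_⟩
  · refine mul_right_cancel₀ hB ?_
    rw [h1, ← hu, ← hcu]
    ring
  · rw [← hu, ← hcu, mul_comm]

lemma cubicEval_X (w : Fin 4 → F) :
    cubicEval w (RatFunc.X : RatFunc F) 1 = algebraMap F[X] (RatFunc F) (cubicPoly w) := by
  rw [cubicEval_one]
  simp [cubicPoly]

lemma cubicPoly_ne_zero {w : Fin 4 → F} (h : w ≠ 0) : cubicPoly w ≠ 0 := by
  rintro h0
  apply h
  rw [← cubicCoeff_poly w, h0]
  ext i
  simp [cubicCoeff]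

lemma BasePointFree.right_ne_zero {P Q : Fin 4 → F}
    (h : BasePointFree (Submodule.span F {P, Q})) : Q ≠ 0 := by
  simpa using h.pair_independent.ne_zero 1

lemma ratDeg_cubic_div {P Q : Fin 4 → F} (h : BasePointFree (Submodule.span F {P, Q}))
    {f : RatFunc F} (hf : f = cubicEval P RatFunc.X 1 / cubicEval Q RatFunc.X 1) :
    ratDeg f = 3 ∧ Submodule.span F {cubicCoeff f.num, cubicCoeff f.denom} =
      Submodule.span F {P, Q} := by
  have hQ := cubicPoly_ne_zero h.right_ne_zero
  obtain ⟨hc, h3⟩ := basePointFree_span_pair_iff.1 h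
  obtain ⟨c, hc0, hn, hd⟩ := exists_num_denom_div hc hQ
  rw [cubicEval_X, cubicEval_X] at hf
  rw [← hf] at hn hd
  constructor
  · rw [ratDeg, hn, hd, natDegree_C_mul hc0, natDegree_C_mul hc0]
    have h1 := natDegree_cubicPoly_le P
    have h2 := natDegree_cubicPoly_le Q
    have key : ∀ w : Fin 4 → F, w 3 ≠ 0 → 3 ≤ (cubicPoly w).natDegree := by
      intro w hw
      apply le_natDegree_of_ne_zero
      have := congrFun (cubicCoeff_poly w) 3
      change (cubicPoly w).coeff 3 = _ at this
      rwa [this]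
    rcases h3 with h3 | h3
    · have := key _ h3
      omega
    · have := key _ h3
      omega
  · rw [hn, hd, cubicCoeff_C_mul, cubicCoeff_C_mul, cubicCoeff_poly, cubicCoeff_poly,
      ← Submodule.span_smul_eq_of_isUnit {P, Q} c hc0.isUnit, ← Set.image_smul, Set.image_pair]

lemma basePointFree_of_ratDeg {f : RatFunc F} (hf : ratDeg f = 3) :
    BasePointFree (Submodule.span F {cubicCoeff f.num, cubicCoeff f.denom}) := by
  rw [ratDeg] at hf
  rw [basePointFree_span_pair_iff, cubicPoly_coeff (by omega), cubicPoly_coeff (by omega)]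
  refine ⟨f.isCoprime_num_denom, ?_⟩
  rcases max_choice f.num.natDegree f.denom.natDegree with h | h
  · left
    change f.num.coeff 3 ≠ 0
    rw [← hf, h]
    apply leadingCoeff_ne_zero.2
    rintro h0
    simp_all
  · right
    change f.denom.coeff 3 ≠ 0
    rw [← hf, h]
    exact leadingCoeff_ne_zero.2 f.denom_ne_zero

/-- The pencil spanned by the numerator and denominator of a cubic rational function. -/
noncomputable def ratPencil (f : {f : RatFunc F // ratDeg f = 3}) : CubicPencil F :=
  ⟨Submodule.span F {cubicCoeff f.1.num, cubicCoeff f.1.denom}, ⟨_, _, rfl⟩,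
    basePointFree_of_ratDeg f.2⟩

lemma eq_cubicEval_div {f : RatFunc F} (hf : ratDeg f = 3) :
    f = cubicEval (cubicCoeff f.num) RatFunc.X 1 / cubicEval (cubicCoeff f.denom) RatFunc.X 1 := by
  rw [ratDeg] at hf
  rw [cubicEval_X, cubicEval_X, cubicPoly_coeff (by omega), cubicPoly_coeff (by omega),
    RatFunc.num_div_denom]

lemma rcomp_cubic {f ψ : RatFunc F} (hf : ratDeg f = 3) {g : Matrix (Fin 2) (Fin 2) F}
    (hψ : ψ = (RatFunc.C (g 0 0) * RatFunc.X + RatFunc.C (g 1 0)) /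
      (RatFunc.C (g 0 1) * RatFunc.X + RatFunc.C (g 1 1)))
    (h0 : RatFunc.C (g 0 1) * RatFunc.X + RatFunc.C (g 1 1) ≠ 0) :
    rcomp f ψ = cubicEval (cubicAct g (cubicCoeff f.num)) RatFunc.X 1 /
      cubicEval (cubicAct g (cubicCoeff f.denom)) RatFunc.X 1 := by
  have key : ∀ P : F[X], P.natDegree ≤ 3 → cubicEval (cubicAct g (cubicCoeff P)) RatFunc.X 1 =
      (RatFunc.C (g 0 1) * RatFunc.X + RatFunc.C (g 1 1)) ^ 3 * aeval ψ P := by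
    intro P hP
    conv_rhs => rw [← cubicPoly_coeff hP]
    rw [← cubicEval_one, ← cubicEval_smul, mul_one, hψ, mul_div_cancel₀ _ h0, cubicEval_act]
    simp [RatFunc.algebraMap_eq_C]
  rw [ratDeg] at hf
  rw [rcomp, key _ (by omega), key _ (by omega), mul_div_mul_left _ _ (pow_ne_zero _ h0)]

lemma rcomp_linear {φ N D : RatFunc F} (hD : D ≠ 0) {a b c d : F}
    (hn : φ.num = C a * X + C b) (hd : φ.denom = C c * X + C d) :
    rcomp φ (N / D) = (RatFunc.C a * N + RatFunc.C b * D) / (RatFunc.C c * N + RatFunc.C d * D) := by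
  rw [rcomp, hn, hd, ← mul_div_mul_right _ _ hD]
  simp only [map_add, map_mul, aeval_C, aeval_X, RatFunc.algebraMap_eq_C]
  congr 1 <;> field_simp

lemma exists_of_ratDeg_one {φ : RatFunc F} (h : ratDeg φ = 1) :
    ∃ a b c d : F, a * d - b * c ≠ 0 ∧ φ.num = C a * X + C b ∧ φ.denom = C c * X + C d := by
  rw [ratDeg] at h
  have h1 := eq_X_add_C_of_natDegree_le_one (p := φ.num) (by omega)
  have h2 := eq_X_add_C_of_natDegree_le_one (p := φ.denom) (by omega)
  refine ⟨_, _, _, _, ?_, h1, h2⟩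
  intro h0
  set a := φ.num.coeff 1
  set b := φ.num.coeff 0
  set c := φ.denom.coeff 1
  set d := φ.denom.coeff 0
  obtain ⟨u, v, huv⟩ := φ.isCoprime_num_denom
  have h0' : C a * C d - C b * C c = 0 := by rw [← C_mul, ← C_mul, ← C_sub, h0, C_0]
  have hb : φ.num * (u * C b + v * C d) = C b := by
    rw [h1, h2] at huv
    rw [h1]
    linear_combination C b * huv + v * X * h0'
  have hd : φ.denom * (u * C b + v * C d) = C d := by
    rw [h1, h2] at huv
    rw [h2]
    linear_combination C d * huv - u * X * h0'
  have ha : φ.num * (u * C a + v * C c) = C a := by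
    rw [h1, h2] at huv
    rw [h1]
    linear_combination C a * huv - v * h0'
  have hc : φ.denom * (u * C a + v * C c) = C c := by
    rw [h1, h2] at huv
    rw [h2]
    linear_combination C c * huv + u * h0'
  have key : ∀ n e : F[X], ∀ t : F, n.natDegree = 1 → n * e = C t → e = 0 := by
    intro n e t hn hne
    by_contra he
    have := natDegree_mul (p := n) (q := e) (by rintro rfl; simp at hn) he
    rw [hne, natDegree_C] at this
    omega
  have hcases : φ.num.natDegree = 1 ∨ φ.denom.natDegree = 1 := by omega
  have hz : u * C b + v * C d = 0 ∧ u * C a + v * C c = 0 := by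
    rcases hcases with h | h
    · exact ⟨key _ _ _ h hb, key _ _ _ h ha⟩
    · exact ⟨key _ _ _ h hd, key _ _ _ h hc⟩
  rw [hz.1, mul_zero] at hb hd
  rw [hz.2, mul_zero] at ha hc
  rw [h1, h2, ← ha, ← hb, ← hc, ← hd] at huv
  simp at huv

lemma exists_ratDeg_one {a b c d : F} (h : a * d - b * c ≠ 0) :
    ∃ φ : RatFunc F, ratDeg φ = 1 ∧ φ = (RatFunc.C a * RatFunc.X + RatFunc.C b) /
      (RatFunc.C c * RatFunc.X + RatFunc.C d) ∧ ∃ k, k ≠ 0 ∧ φ.num = C (k * a) * X + C (k * b) ∧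
      φ.denom = C (k * c) * X + C (k * d) := by
  have hcop : IsCoprime (C a * X + C b) (C c * X + C d) := by
    refine ⟨C (-(a * d - b * c)⁻¹ * c), C ((a * d - b * c)⁻¹ * a), ?_⟩
    calc _ = C ((a * d - b * c)⁻¹) * C (a * d - b * c) := by
          simp only [C_mul, C_neg, C_sub]
          ring
      _ = 1 := by rw [← C_mul, inv_mul_cancel₀ h, C_1]
  have hB : C c * X + C d ≠ 0 := by
    intro h0
    have hc : c = 0 := by simpa [coeff_X, coeff_C] using congrArg (coeff · 1) h0
    have hd : d = 0 := by simpa [coeff_X, coeff_C] using congrArg (coeff · 0) h0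
    exact h (by rw [hc, hd]; ring)
  obtain ⟨k, hk, hn, hd⟩ := exists_num_denom_div hcop hB
  refine ⟨_, ?_, ?_, k, hk, by rw [hn]; simp; ring, by rw [hd]; simp; ring⟩
  · rw [ratDeg, hn, hd, natDegree_C_mul hk, natDegree_C_mul hk]
    have h1 := natDegree_linear_le (a := a) (b := b)
    have h2 := natDegree_linear_le (a := c) (b := d)
    by_cases ha : a = 0
    · have hc : c ≠ 0 := by
        rintro rfl
        exact h (by rw [ha]; ring)
      rw [natDegree_linear hc]
      omega
    · rw [natDegree_linear ha]
      omega
  · simp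

lemma linear_ne_zero {c d : F} (h : c ≠ 0 ∨ d ≠ 0) :
    RatFunc.C c * RatFunc.X + RatFunc.C d ≠ 0 := by
  intro h0
  have : algebraMap F[X] (RatFunc F) (C c * X + C d) = 0 := by simpa using h0
  rw [map_eq_zero_iff _ (RatFunc.algebraMap_injective F)] at this
  have hc : c = 0 := by simpa [coeff_X, coeff_C] using congrArg (coeff · 1) this
  have hd : d = 0 := by simpa [coeff_X, coeff_C] using congrArg (coeff · 0) this
  simp_all

lemma cubicEval_X_ne_zero {w : Fin 4 → F} (h : w ≠ 0) :
    cubicEval w (RatFunc.X : RatFunc F) 1 ≠ 0 := by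
  rw [cubicEval_X]
  exact RatFunc.algebraMap_ne_zero (cubicPoly_ne_zero h)

lemma CubicPencil.span_combination {W : CubicPencil F} {P Q : Fin 4 → F}
    (hW : W.1 = Submodule.span F {P, Q}) {a b c d : F} (h : a * d - b * c ≠ 0) :
    W.1 = Submodule.span F {a • P + b • Q, c • P + d • Q} := by
  have hbp := W.2.2
  rw [hW] at hbp
  refine W.eq_span ?_ ?_ fun s r hsr => ?_
  · rw [hW]
    exact Submodule.mem_span_pair.2 ⟨a, b, rfl⟩
  · rw [hW]
    exact Submodule.mem_span_pair.2 ⟨c, d, rfl⟩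
  · have := LinearIndependent.pair_iff.1 hbp.pair_independent (s * a + r * c) (s * b + r * d)
      (by rw [← hsr]; module)
    constructor
    · refine (mul_eq_zero.1 ?_).resolve_left h
      linear_combination d * this.1 - c * this.2
    · refine (mul_eq_zero.1 ?_).resolve_left h
      linear_combination a * this.2 - b * this.1

lemma ratPencil_smul_of_rcomp {f g : {f : RatFunc F // ratDeg f = 3}} {φ ψ : RatFunc F}
    (hφ : ratDeg φ = 1) (hψ : ratDeg ψ = 1) (h : (g : RatFunc F) = rcomp φ (rcomp f ψ)) :
    ∃ k : GL (Fin 2) F, k • ratPencil f = ratPencil g := by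
  obtain ⟨α, β, γ, δ, hdet, hn, hd⟩ := exists_of_ratDeg_one hφ
  obtain ⟨a, b, c, d, hdet', hn', hd'⟩ := exists_of_ratDeg_one hψ
  have hk : (!![a, c; b, d] : Matrix (Fin 2) (Fin 2) F).det ≠ 0 := by
    rw [Matrix.det_fin_two_of]
    rwa [mul_comm c b]
  set k := Matrix.GeneralLinearGroup.mkOfDetNeZero !![a, c; b, d] hk with hkdef
  have hk1 : k.1 = !![a, c; b, d] := rfl
  refine ⟨k, ?_⟩
  have hcd : c ≠ 0 ∨ d ≠ 0 := by
    by_contra! h0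
    exact hdet' (by rw [h0.1, h0.2]; ring)
  have h1 : rcomp f ψ = cubicEval (cubicAct k.1 (cubicCoeff f.1.num)) RatFunc.X 1 /
      cubicEval (cubicAct k.1 (cubicCoeff f.1.denom)) RatFunc.X 1 := by
    refine rcomp_cubic f.2 ?_ ?_
    · rw [← RatFunc.num_div_denom ψ, hn', hd', hk1]
      simp
    · rw [hk1]
      exact linear_ne_zero hcd
  have hspan : (k • ratPencil f).1 = Submodule.span F
      {cubicAct k.1 (cubicCoeff f.1.num), cubicAct k.1 (cubicCoeff f.1.denom)} :=
    map_cubicAct_span_pair _ _ _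
  have hbp := (k • ratPencil f).2.2
  rw [hspan] at hbp
  rw [h1, rcomp_linear (cubicEval_X_ne_zero hbp.right_ne_zero) hn hd] at h
  have hspan' := CubicPencil.span_combination hspan hdet
  have hbp' := (k • ratPencil f).2.2
  rw [hspan'] at hbp'
  refine Subtype.ext ?_
  rw [hspan']
  refine (ratDeg_cubic_div hbp' ?_).2.symm
  rw [h, cubicEval_smul_add, cubicEval_smul_add]
  rfl

lemma rcomp_of_ratPencil_smul {f g : {f : RatFunc F // ratDeg f = 3}} {k : GL (Fin 2) F}
    (h : k • ratPencil f = ratPencil g) : ∃ φ ψ : RatFunc F, ratDeg φ = 1 ∧ ratDeg ψ = 1 ∧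
      (g : RatFunc F) = rcomp φ (rcomp f ψ) := by
  have hspan : (k • ratPencil f).1 = Submodule.span F
      {cubicAct k.1 (cubicCoeff f.1.num), cubicAct k.1 (cubicCoeff f.1.denom)} :=
    map_cubicAct_span_pair _ _ _
  have hbp := (k • ratPencil f).2.2
  rw [hspan] at hbp
  rw [h] at hspan
  have hnum : cubicCoeff g.1.num ∈ (ratPencil g).1 := Submodule.subset_span (by simp)
  have hden : cubicCoeff g.1.denom ∈ (ratPencil g).1 := Submodule.subset_span (by simp)
  rw [hspan, Submodule.mem_span_pair] at hnum hden
  obtain ⟨α, β, hn⟩ := hnum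
  obtain ⟨γ, δ, hd⟩ := hden
  have hind := LinearIndependent.pair_iff.1 (ratPencil g).2.2.pair_independent
  have hdet : α * δ - β * γ ≠ 0 := by
    intro h0
    have h1 := hind δ (-β) (by
      calc _ = (α * δ - β * γ) • cubicAct k.1 (cubicCoeff f.1.num) := by
            rw [← hn, ← hd]
            module
        _ = 0 := by rw [h0, zero_smul])
    have h2 := hind (-γ) α (by
      calc _ = (α * δ - β * γ) • cubicAct k.1 (cubicCoeff f.1.denom) := by
            rw [← hn, ← hd]
            module
        _ = 0 := by rw [h0, zero_smul])
    have h3 := hind 1 0 (by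
      rw [← hn, h2.2, neg_eq_zero.1 h1.2]
      simp)
    exact one_ne_zero h3.1
  obtain ⟨φ, hφ, -, e, he, hφn, hφd⟩ := exists_ratDeg_one hdet
  have hkdet : k.1 0 0 * k.1 1 1 - k.1 1 0 * k.1 0 1 ≠ 0 := by
    have := k.det.ne_zero
    rw [Matrix.GeneralLinearGroup.val_det_apply, Matrix.det_fin_two] at this
    rwa [mul_comm (k.1 1 0)]
  obtain ⟨ψ, hψ, hψ', -⟩ := exists_ratDeg_one hkdet
  refine ⟨φ, ψ, hφ, hψ, ?_⟩
  have hcd : k.1 0 1 ≠ 0 ∨ k.1 1 1 ≠ 0 := by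
    by_contra! h0
    exact hkdet (by rw [h0.1, h0.2]; ring)
  rw [rcomp_cubic f.2 hψ' (linear_ne_zero hcd),
    rcomp_linear (cubicEval_X_ne_zero hbp.right_ne_zero) hφn hφd, eq_cubicEval_div g.2,
    ← hn, ← hd, cubicEval_smul_add, cubicEval_smul_add]
  simp only [map_mul, mul_assoc, ← mul_add]
  rw [mul_div_mul_left _ _ (by simpa using he)]
  rfl

lemma ratPencil_surjective : Function.Surjective (ratPencil (F := F)) := by
  rintro ⟨W, ⟨P, Q, rfl⟩, hbp⟩
  obtain ⟨h1, h2⟩ := ratDeg_cubic_div hbp rfl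
  exact ⟨⟨_, h1⟩, Subtype.ext h2⟩

lemma ratEquivCount_three :
    ratEquivCount F 3 = Nat.card (Quotient (MulAction.orbitRel (GL (Fin 2) F) (CubicPencil F))) := by
  refine Nat.card_congr (Equiv.ofBijective (Quot.lift (fun f => ⟦ratPencil f⟧) ?_) ⟨?_, ?_⟩)
  · rintro f g ⟨φ, ψ, hφ, hψ, h⟩
    obtain ⟨k, hk⟩ := ratPencil_smul_of_rcomp hφ hψ h
    exact (Quotient.sound (s := MulAction.orbitRel _ _) ⟨k, hk⟩).symm
  · rintro ⟨f⟩ ⟨g⟩ h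
    obtain ⟨k, hk⟩ := Quotient.exact (s := MulAction.orbitRel _ _) h.symm
    exact Quot.sound (rcomp_of_ratPencil_smul hk)
  · rintro ⟨W⟩
    obtain ⟨f, rfl⟩ := ratPencil_surjective W
    exact ⟨Quot.mk _ f, rfl⟩

end RationalFunctions

section FixedPoints

variable {F : Type*} [Field F]

/-- The pencil spanned by `x³ + a x + b` and `x² + c x + d`, with `p = (a, b, c, d)`. -/
def quadraticPencil (p : F × F × F × F) : Submodule F (Fin 4 → F) :=
  Submodule.span F {![p.2.1, p.1, 0, 1], ![p.2.2.2, p.2.2.1, 1, 0]}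

/-- The pencil spanned by `x³ + a x² + b` and `x + c`, with `p = (a, b, c)`. -/
def linearPencil (p : F × F × F) : Submodule F (Fin 4 → F) :=
  Submodule.span F {![p.2.1, 0, p.1, 1], ![p.2.2, 1, 0, 0]}

/-- The pencil spanned by `x³ + a x² + b x` and `1`, with `p = (a, b)`. -/
def constantPencil (p : F × F) : Submodule F (Fin 4 → F) :=
  Submodule.span F {![0, p.2, p.1, 1], ![1, 0, 0, 0]}

lemma mem_quadraticPencil {p : F × F × F × F} {w : Fin 4 → F} : w ∈ quadraticPencil p ↔
    w 1 = p.1 * w 3 + p.2.2.1 * w 2 ∧ w 0 = p.2.1 * w 3 + p.2.2.2 * w 2 := by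
  rw [quadraticPencil, Submodule.mem_span_pair]
  constructor
  · rintro ⟨s, r, rfl⟩
    simp
    constructor <;> ring
  · rintro ⟨h1, h0⟩
    refine ⟨w 3, w 2, ?_⟩
    ext i
    fin_cases i <;> simp [h1, h0] <;> ring

lemma mem_linearPencil {p : F × F × F} {w : Fin 4 → F} : w ∈ linearPencil p ↔
    w 2 = p.1 * w 3 ∧ w 0 = p.2.1 * w 3 + p.2.2 * w 1 := by
  rw [linearPencil, Submodule.mem_span_pair]
  constructor
  · rintro ⟨s, r, rfl⟩
    simp
    constructor <;> ring
  · rintro ⟨h1, h0⟩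
    refine ⟨w 3, w 1, ?_⟩
    ext i
    fin_cases i <;> simp [h1, h0] <;> ring

lemma mem_constantPencil {p : F × F} {w : Fin 4 → F} : w ∈ constantPencil p ↔
    w 2 = p.1 * w 3 ∧ w 1 = p.2 * w 3 := by
  rw [constantPencil, Submodule.mem_span_pair]
  constructor
  · rintro ⟨s, r, rfl⟩
    simp
    constructor <;> ring
  · rintro ⟨h1, h0⟩
    refine ⟨w 3, w 0, ?_⟩
    ext i
    fin_cases i <;> simp [h1, h0] <;> ring

lemma basePointFree_span_pair_of_monic {P Q : Fin 4 → F} (h : P 3 = 1) :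
    BasePointFree (Submodule.span F {P, Q}) ↔ ∀ x : AlgebraicClosure F,
      cubicEval P x 1 = 0 → cubicEval Q x 1 ≠ 0 := by
  rw [basePointFree_span_pair_iff, isCoprime_iff_aeval_ne_zero_of_isAlgClosed F (AlgebraicClosure F)]
  simp only [cubicEval_one, h, ne_eq, one_ne_zero, not_false_eq_true, true_or, and_true]
  exact forall_congr' fun x => or_iff_not_imp_left.trans (by rw [not_not])

lemma exists_quadratic_root {K : Type*} [Field K] [IsAlgClosed K] (c d : K) :
    ∃ x : K, x ^ 2 + c * x + d = 0 := by
  obtain ⟨x, hx⟩ := IsAlgClosed.exists_root (C 1 * X ^ 2 + C c * X + C d) (by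
    rw [degree_quadratic one_ne_zero]; decide)
  exact ⟨x, by simpa [IsRoot] using hx⟩

/-- The resultant of `x² + c x + d` and `x³ + a x + b`, with `p = (a, b, c, d)`. -/
def quadraticRes (p : F × F × F × F) : F :=
  (p.2.1 + p.2.2.1 * p.2.2.2) ^ 2 -
    p.2.2.1 * (p.2.1 + p.2.2.1 * p.2.2.2) * (p.1 + p.2.2.1 ^ 2 - p.2.2.2) +
    p.2.2.2 * (p.1 + p.2.2.1 ^ 2 - p.2.2.2) ^ 2

lemma basePointFree_quadraticPencil {p : F × F × F × F} :
    BasePointFree (quadraticPencil p) ↔ quadraticRes p ≠ 0 := by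
  obtain ⟨a, b, c, d⟩ := p
  rw [quadraticPencil, basePointFree_span_pair_of_monic (by simp)]
  rw [← (algebraMap F (AlgebraicClosure F)).injective.ne_iff, map_zero]
  simp only [cubicEval, quadraticRes, map_add, map_sub, map_mul, map_pow, Matrix.cons_val, map_zero,
    map_one, one_mul, mul_one, zero_mul, zero_add, add_zero, one_pow]
  generalize algebraMap F (AlgebraicClosure F) a = a
  generalize algebraMap F (AlgebraicClosure F) b = b
  generalize algebraMap F (AlgebraicClosure F) c = c
  generalize algebraMap F (AlgebraicClosure F) d = d
  constructor
  · intro h hR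
    by_cases hr : a + c ^ 2 - d = 0
    · have h0 : b + c * d = 0 := by
        rw [hr] at hR
        simpa using hR
      obtain ⟨x, hx⟩ := exists_quadratic_root c d
      refine h x ?_ hx
      linear_combination (x - c) * hx + hr * x + h0
    · set r := a + c ^ 2 - d with hrdef
      set x := -(b + c * d) / r with hxdef
      have hxr : x * r = -(b + c * d) := div_mul_cancel₀ _ hr
      have hx : x ^ 2 + c * x + d = 0 := by
        refine (mul_eq_zero.1 ?_).resolve_right (pow_ne_zero 2 hr)
        linear_combination (x * r - (b + c * d) + c * r) * hxr + hR
      refine h x ?_ hx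
      linear_combination (x - c) * hx + hxr - x * hrdef
  · intro hR x hP hQ
    apply hR
    have hxr : x * (a + c ^ 2 - d) = -(b + c * d) := by
      linear_combination hP - (x - c) * hQ
    linear_combination (a + c ^ 2 - d) ^ 2 * hQ -
      (x * (a + c ^ 2 - d) - (b + c * d) + c * (a + c ^ 2 - d)) * hxr

lemma basePointFree_linearPencil {p : F × F × F} :
    BasePointFree (linearPencil p) ↔ p.2.1 + p.1 * p.2.2 ^ 2 - p.2.2 ^ 3 ≠ 0 := by
  obtain ⟨a, b, c⟩ := p
  rw [linearPencil, basePointFree_span_pair_of_monic (by simp)]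
  rw [← (algebraMap F (AlgebraicClosure F)).injective.ne_iff, map_zero]
  simp only [cubicEval, map_add, map_sub, map_mul, map_pow, Matrix.cons_val, map_zero,
    map_one, one_mul, mul_one, zero_mul, zero_add, add_zero, one_pow]
  generalize algebraMap F (AlgebraicClosure F) a = a
  generalize algebraMap F (AlgebraicClosure F) b = b
  generalize algebraMap F (AlgebraicClosure F) c = c
  constructor
  · intro h hR
    exact h (-c) (by linear_combination hR) (by ring)
  · intro hR x hP hQ
    obtain rfl : x = -c := by linear_combination hQ
    exact hR (by linear_combination hP)

lemma basePointFree_constantPencil (p : F × F) : BasePointFree (constantPencil p) := by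
  rw [constantPencil, basePointFree_span_pair_of_monic (by simp)]
  simp [cubicEval]

lemma exists_normal_form (W : CubicPencil F) :
    (∃ p, W.1 = quadraticPencil p) ∨ (∃ p, W.1 = linearPencil p) ∨ ∃ p, W.1 = constantPencil p := by
  obtain ⟨P, hP, hP3⟩ : ∃ P ∈ W.1, P 3 = 1 := by
    by_contra! h
    have h0 : ∀ w ∈ W.1, w 3 = 0 := by
      intro w hw
      by_contra hw3
      exact h ((w 3)⁻¹ • w) (W.1.smul_mem _ hw) (by simp [hw3])
    exact one_ne_zero (W.2.2 1 0 fun w hw => by simp [cubicEval, h0 w hw]).1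
  obtain ⟨Q, hQ, hQ3, hQ0⟩ : ∃ Q ∈ W.1, Q 3 = 0 ∧ Q ≠ 0 := by
    obtain ⟨A, B, hAB⟩ := W.2.1
    have hA : A ∈ W.1 := hAB ▸ Submodule.subset_span (by simp)
    have hB : B ∈ W.1 := hAB ▸ Submodule.subset_span (by simp)
    have hbp := W.2.2
    rw [hAB] at hbp
    by_cases hA3 : A 3 = 0
    · exact ⟨A, hA, hA3, hbp.pair_independent.ne_zero 0⟩
    · refine ⟨A 3 • B - B 3 • A, sub_mem (W.1.smul_mem _ hB) (W.1.smul_mem _ hA), ?_, ?_⟩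
      · simp [mul_comm]
      · intro h
        exact hA3 (LinearIndependent.pair_iff.1 hbp.pair_independent (-B 3) (A 3)
          (by rw [← h]; module)).2
  have hspan : ∀ A B : Fin 4 → F, A ∈ W.1 → B ∈ W.1 → A 3 = 1 → B 3 = 0 → B ≠ 0 →
      W.1 = Submodule.span F {A, B} := by
    intro A B hA hB hA3 hB3 hB0
    refine W.eq_span hA hB fun s r h => ?_
    have hs : s = 0 := by simpa [hA3, hB3] using congrFun h 3
    subst hs
    simpa [hB0] using h
  by_cases h2 : Q 2 = 0
  · by_cases h1 : Q 1 = 0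
    · have h0 : Q 0 ≠ 0 := by
        intro h0
        apply hQ0
        ext i
        fin_cases i <;> assumption
      right; right
      refine ⟨(P 2, P 1), ?_⟩
      rw [constantPencil]
      have h4 : ![1, 0, 0, 0] = (Q 0)⁻¹ • Q := by
        ext i
        fin_cases i <;> simp [h0, h1, h2, hQ3]
      have h5 : ![0, P 1, P 2, 1] = P - (P 0 * (Q 0)⁻¹) • Q := by
        ext i
        fin_cases i <;> simp [h0, h1, h2, hQ3, hP3]
      refine hspan _ _ ?_ ?_ (by simp) (by simp) (by simp)
      · exact h5 ▸ sub_mem hP (W.1.smul_mem _ hQ)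
      · exact h4 ▸ W.1.smul_mem _ hQ
    · right; left
      refine ⟨(P 2, P 0 - P 1 * (Q 1)⁻¹ * Q 0, (Q 1)⁻¹ * Q 0), ?_⟩
      rw [linearPencil]
      refine hspan _ _ ?_ ?_ (by simp) (by simp) (by simp)
      · convert sub_mem hP (W.1.smul_mem (P 1 * (Q 1)⁻¹) hQ) using 1
        ext i
        fin_cases i <;> simp [h1, h2, hQ3, hP3]
      · convert W.1.smul_mem (Q 1)⁻¹ hQ using 1
        ext i
        fin_cases i <;> simp [h1, h2, hQ3]
  · left
    refine ⟨(P 1 - P 2 * (Q 2)⁻¹ * Q 1, P 0 - P 2 * (Q 2)⁻¹ * Q 0, (Q 2)⁻¹ * Q 1,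
      (Q 2)⁻¹ * Q 0), ?_⟩
    rw [quadraticPencil]
    refine hspan _ _ ?_ ?_ (by simp) (by simp) (by simp)
    · convert sub_mem hP (W.1.smul_mem (P 2 * (Q 2)⁻¹) hQ) using 1
      ext i
      fin_cases i <;> simp [h2, hQ3, hP3]
    · convert W.1.smul_mem (Q 2)⁻¹ hQ using 1
      ext i
      fin_cases i <;> simp [h2, hQ3]

lemma quadraticPencil_injective : Function.Injective (quadraticPencil (F := F)) := by
  rintro ⟨a, b, c, d⟩ p h
  have h1 : ![b, a, 0, 1] ∈ quadraticPencil p := h ▸ Submodule.subset_span (by simp)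
  have h2 : ![d, c, 1, 0] ∈ quadraticPencil p := h ▸ Submodule.subset_span (by simp)
  rw [mem_quadraticPencil] at h1 h2
  simp at h1 h2
  ext <;> simp [h1, h2]

lemma linearPencil_injective : Function.Injective (linearPencil (F := F)) := by
  rintro ⟨a, b, c⟩ p h
  have h1 : ![b, 0, a, 1] ∈ linearPencil p := h ▸ Submodule.subset_span (by simp)
  have h2 : ![c, 1, 0, 0] ∈ linearPencil p := h ▸ Submodule.subset_span (by simp)
  rw [mem_linearPencil] at h1 h2
  simp at h1 h2
  ext <;> simp [h1, h2]

lemma constantPencil_injective : Function.Injective (constantPencil (F := F)) := by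
  rintro ⟨a, b⟩ p h
  have h1 : ![0, b, a, 1] ∈ constantPencil p := h ▸ Submodule.subset_span (by simp)
  rw [mem_constantPencil] at h1
  simp at h1
  ext <;> simp [h1]

lemma quadraticPencil_ne_linearPencil (p : F × F × F × F) (r : F × F × F) :
    quadraticPencil p ≠ linearPencil r := by
  intro h
  have h1 : ![r.2.2, 1, 0, 0] ∈ quadraticPencil p := h ▸ Submodule.subset_span (by simp)
  rw [mem_quadraticPencil] at h1
  simp at h1

lemma quadraticPencil_ne_constantPencil (p : F × F × F × F) (r : F × F) :
    quadraticPencil p ≠ constantPencil r := by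
  intro h
  have h1 : ![1, 0, 0, 0] ∈ quadraticPencil p := h ▸ Submodule.subset_span (by simp)
  rw [mem_quadraticPencil] at h1
  simp at h1

lemma linearPencil_ne_constantPencil (p : F × F × F) (r : F × F) :
    linearPencil p ≠ constantPencil r := by
  intro h
  have h1 : ![1, 0, 0, 0] ∈ linearPencil p := h ▸ Submodule.subset_span (by simp)
  rw [mem_linearPencil] at h1
  simp at h1

lemma card_cubicPencil_subtype [Finite F] (S : Submodule F (Fin 4 → F) → Prop) :
    Nat.card {W : CubicPencil F // S W.1} =
      Nat.card {p : F × F × F × F // quadraticRes p ≠ 0 ∧ S (quadraticPencil p)} +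
      Nat.card {p : F × F × F // p.2.1 + p.1 * p.2.2 ^ 2 - p.2.2 ^ 3 ≠ 0 ∧ S (linearPencil p)} +
      Nat.card {p : F × F // S (constantPencil p)} := by
  rw [← Nat.card_sum, ← Nat.card_sum]
  refine (Nat.card_congr (Equiv.ofBijective (Sum.elim (Sum.elim
    (fun p => ⟨⟨quadraticPencil p.1, ⟨_, _, rfl⟩, basePointFree_quadraticPencil.2 p.2.1⟩, p.2.2⟩)
    (fun p => ⟨⟨linearPencil p.1, ⟨_, _, rfl⟩, basePointFree_linearPencil.2 p.2.1⟩, p.2.2⟩))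
    (fun p => ⟨⟨constantPencil p.1, ⟨_, _, rfl⟩, basePointFree_constantPencil _⟩, p.2⟩))
    ⟨?_, ?_⟩)).symm
  · rintro ((p | p) | p) ((r | r) | r) h <;>
      simp only [Sum.elim_inl, Sum.elim_inr, Subtype.mk.injEq] at h
    · rw [Subtype.ext (quadraticPencil_injective h)]
    · exact absurd h (quadraticPencil_ne_linearPencil _ _)
    · exact absurd h (quadraticPencil_ne_constantPencil _ _)
    · exact absurd h.symm (quadraticPencil_ne_linearPencil _ _)
    · rw [Subtype.ext (linearPencil_injective h)]
    · exact absurd h (linearPencil_ne_constantPencil _ _)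
    · exact absurd h.symm (quadraticPencil_ne_constantPencil _ _)
    · exact absurd h.symm (linearPencil_ne_constantPencil _ _)
    · rw [Subtype.ext (constantPencil_injective h)]
  · rintro ⟨⟨W, hW⟩, hS⟩
    rcases exists_normal_form ⟨W, hW⟩ with ⟨p, rfl⟩ | ⟨p, rfl⟩ | ⟨p, rfl⟩
    · exact ⟨.inl (.inl ⟨p, basePointFree_quadraticPencil.1 hW.2, hS⟩), rfl⟩
    · exact ⟨.inl (.inr ⟨p, basePointFree_linearPencil.1 hW.2, hS⟩), rfl⟩
    · exact ⟨.inr ⟨p, hS⟩, rfl⟩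

end FixedPoints

lemma card_subtype_add_card_not {α : Type*} [Finite α] (p : α → Prop) :
    Nat.card {x // p x} + Nat.card {x // ¬ p x} = Nat.card α := by
  classical
  rw [← Nat.card_sum, Nat.card_congr (Equiv.sumCompl p)]

lemma card_ne {α : Type*} [Finite α] (a : α) : Nat.card {x : α // x ≠ a} = Nat.card α - 1 := by
  have := card_subtype_add_card_not fun x : α => x = a
  rw [Nat.card_unique] at this
  simp only [ne_eq]
  omega

section FixedPointCounts

variable {F : Type*} [Field F]

lemma card_quadraticRes_eq_zero [Finite F] :
    Nat.card {p : F × F × F × F // ¬ quadraticRes p ≠ 0} = Nat.card F ^ 3 := by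
  classical
  have : Nat.card (F × F × F) = Nat.card F ^ 3 := by
    simp only [Nat.card_prod]
    ring
  rw [← this]
  refine Nat.card_congr
    { toFun := fun p => (p.1.1 + p.1.2.2.1 ^ 2 - p.1.2.2.2,
        if p.1.1 + p.1.2.2.1 ^ 2 - p.1.2.2.2 = 0 then p.1.2.2.2
        else p.1.2.1 + p.1.2.2.1 * p.1.2.2.2, p.1.2.2.1)
      invFun := fun t =>
        ⟨if t.1 = 0 then (t.2.1 - t.2.2 ^ 2, - t.2.2 * t.2.1, t.2.2, t.2.1)
          else (t.1 - t.2.2 ^ 2 + (t.2.2 * t.1 * t.2.1 - t.2.1 ^ 2) / t.1 ^ 2,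
            t.2.1 - t.2.2 * ((t.2.2 * t.1 * t.2.1 - t.2.1 ^ 2) / t.1 ^ 2), t.2.2,
            (t.2.2 * t.1 * t.2.1 - t.2.1 ^ 2) / t.1 ^ 2), ?_⟩
      left_inv := ?_
      right_inv := ?_ }
  · rw [not_ne_iff]
    split_ifs with h
    · simp only [quadraticRes]
      ring
    · simp only [quadraticRes]
      field_simp
      ring
  · rintro ⟨⟨a, b, c, d⟩, h⟩
    rw [not_ne_iff] at h
    simp only [quadraticRes] at h
    refine Subtype.ext ?_
    by_cases hr : a + c ^ 2 - d = 0
    · have hb : b + c * d = 0 := by simpa [hr] using h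
      simp only [hr, if_true]
      ext
      · linear_combination - hr
      · linear_combination - hb
      · rfl
      · rfl
    · simp only [hr, if_false]
      have hd : (c * (a + c ^ 2 - d) * (b + c * d) - (b + c * d) ^ 2) / (a + c ^ 2 - d) ^ 2 = d := by
        rw [div_eq_iff (pow_ne_zero 2 hr)]
        linear_combination -h
      rw [hd]
      ext
      · ring
      · ring
      · rfl
      · rfl
  · rintro ⟨r, s, c⟩
    have h (e : F) : r - c ^ 2 + e + c ^ 2 - e = r := by ring
    by_cases hr : r = 0
    · simp [hr]
    · simp [hr, h]

lemma card_linear_eq_zero [Finite F] :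
    Nat.card {p : F × F × F // ¬ p.2.1 + p.1 * p.2.2 ^ 2 - p.2.2 ^ 3 ≠ 0} = Nat.card F ^ 2 := by
  have : Nat.card (F × F) = Nat.card F ^ 2 := by
    simp only [Nat.card_prod]
    ring
  rw [← this]
  refine Nat.card_congr
    { toFun := fun p => (p.1.1, p.1.2.2)
      invFun := fun t => ⟨(t.1, t.2 ^ 3 - t.1 * t.2 ^ 2, t.2), by rw [not_ne_iff]; ring⟩
      left_inv := ?_
      right_inv := fun _ => rfl }
  rintro ⟨⟨a, b, c⟩, h⟩
  rw [not_ne_iff] at h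
  simp only [Subtype.mk.injEq, Prod.mk.injEq, true_and, and_true]
  simp only at h
  linear_combination -h

lemma card_cubicPencil [Finite F] : Nat.card (CubicPencil F) = Nat.card F ^ 4 := by
  have h := card_cubicPencil_subtype (F := F) fun _ => True
  simp only [and_true] at h
  rw [Nat.card_congr (Equiv.subtypeUnivEquiv fun _ => trivial),
    Nat.card_congr (Equiv.subtypeUnivEquiv fun _ => trivial)] at h
  have h1 := card_subtype_add_card_not fun p : F × F × F × F => quadraticRes p ≠ 0
  have h2 := card_subtype_add_card_not
    fun p : F × F × F => p.2.1 + p.1 * p.2.2 ^ 2 - p.2.2 ^ 3 ≠ 0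
  rw [card_quadraticRes_eq_zero] at h1
  rw [card_linear_eq_zero] at h2
  simp only [Nat.card_prod] at h1 h2 h
  rw [show Nat.card F * (Nat.card F * (Nat.card F * Nat.card F)) = Nat.card F ^ 4 by ring] at h1
  rw [show Nat.card F * (Nat.card F * Nat.card F) = Nat.card F ^ 3 by ring] at h2
  rw [show Nat.card F * Nat.card F = Nat.card F ^ 2 by ring] at h
  omega

/-- Stability of a space of binary cubic forms under a substitution. -/
def CubicStable (g : Matrix (Fin 2) (Fin 2) F) (W : Submodule F (Fin 4 → F)) : Prop :=
  ∀ w ∈ W, cubicAct g w ∈ W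

/-- The number of base-point-free pencils of binary cubics stable under a substitution. -/
noncomputable def stableCard (g : Matrix (Fin 2) (Fin 2) F) : ℕ :=
  Nat.card {W : CubicPencil F // CubicStable g W.1}

lemma card_fixedBy (g : GL (Fin 2) F) :
    Nat.card (MulAction.fixedBy (CubicPencil F) g) = stableCard g.1 :=
  Nat.card_congr (Equiv.subtypeEquivRight fun _ =>
    ⟨fun h _ hw => act_mem_of_mem_fixedBy h hw, fun h => mem_fixedBy_of_forall_mem h⟩)

lemma cubicStable_span_pair {g : Matrix (Fin 2) (Fin 2) F} {P Q : Fin 4 → F} :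
    CubicStable g (Submodule.span F {P, Q}) ↔ cubicAct g P ∈ Submodule.span F {P, Q} ∧
      cubicAct g Q ∈ Submodule.span F {P, Q} := by
  constructor
  · intro h
    exact ⟨h _ (Submodule.subset_span (by simp)), h _ (Submodule.subset_span (by simp))⟩
  · rintro ⟨hP, hQ⟩ w hw
    obtain ⟨s, r, rfl⟩ := Submodule.mem_span_pair.1 hw
    rw [map_add, map_smul, map_smul]
    exact add_mem (Submodule.smul_mem _ _ hP) (Submodule.smul_mem _ _ hQ)

end FixedPointCounts

section StableCount

variable {F : Type*} [Field F]

lemma cubicStable_diagonal_quadratic {α β : F} (hα : α ≠ 0) (hβ : β ≠ 0) (hαβ : α - β ≠ 0)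
    (p : F × F × F × F) : CubicStable !![α, 0; 0, β] (quadraticPencil p) ↔
      p.1 * (α + β) = 0 ∧ p.2.1 * (α ^ 2 + α * β + β ^ 2) = 0 ∧ p.2.2.1 = 0 ∧
        p.2.2.2 * (α + β) = 0 := by
  obtain ⟨a, b, c, d⟩ := p
  have h : CubicStable !![α, 0; 0, β] (quadraticPencil (a, b, c, d)) ↔ _ := cubicStable_span_pair
  rw [h, ← quadraticPencil, mem_quadraticPencil, mem_quadraticPencil]
  simp only [cubicAct, LinearMap.coe_mk, AddHom.coe_mk, Matrix.of_apply, Matrix.cons_val]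
  constructor
  · rintro ⟨⟨h1, h2⟩, h3, h4⟩
    refine ⟨mul_left_cancel₀ (mul_ne_zero hα hαβ) ?_, mul_left_cancel₀ hαβ ?_,
      mul_left_cancel₀ (mul_ne_zero (mul_ne_zero hα hβ) hαβ) ?_,
      mul_left_cancel₀ (mul_ne_zero hβ hαβ) ?_⟩
    · linear_combination -h1
    · linear_combination -h2
    · linear_combination -h3
    · linear_combination -h4
  · rintro ⟨h1, h2, h3, h4⟩
    subst h3
    refine ⟨⟨?_, ?_⟩, ?_, ?_⟩
    · linear_combination (- α * (α - β)) * h1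
    · linear_combination (- (α - β)) * h2
    · ring
    · linear_combination (- β * (α - β)) * h4

lemma cubicStable_diagonal_linear {α β : F} (hα : α ≠ 0) (hβ : β ≠ 0) (hαβ : α - β ≠ 0)
    (p : F × F × F) : CubicStable !![α, 0; 0, β] (linearPencil p) ↔
      p.1 = 0 ∧ p.2.1 * (α ^ 2 + α * β + β ^ 2) = 0 ∧ p.2.2 = 0 := by
  obtain ⟨a, b, c⟩ := p
  have h : CubicStable !![α, 0; 0, β] (linearPencil (a, b, c)) ↔ _ := cubicStable_span_pair
  rw [h, ← linearPencil, mem_linearPencil, mem_linearPencil]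
  simp only [cubicAct, LinearMap.coe_mk, AddHom.coe_mk, Matrix.of_apply, Matrix.cons_val]
  constructor
  · rintro ⟨⟨h1, h2⟩, h3, h4⟩
    refine ⟨mul_left_cancel₀ (mul_ne_zero (pow_ne_zero 2 hα) hαβ) ?_, mul_left_cancel₀ hαβ ?_,
      mul_left_cancel₀ (mul_ne_zero (pow_ne_zero 2 hβ) hαβ) ?_⟩
    · linear_combination -h1
    · linear_combination -h2
    · linear_combination -h4
  · rintro ⟨h1, h2, h3⟩
    subst h1 h3
    refine ⟨⟨?_, ?_⟩, ?_, ?_⟩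
    · ring
    · linear_combination (- (α - β)) * h2
    · ring
    · ring

lemma cubicStable_diagonal_constant {α β : F} (hα : α ≠ 0) (hαβ : α - β ≠ 0)
    (p : F × F) : CubicStable !![α, 0; 0, β] (constantPencil p) ↔
      p.1 = 0 ∧ p.2 * (α + β) = 0 := by
  obtain ⟨a, b⟩ := p
  have h : CubicStable !![α, 0; 0, β] (constantPencil (a, b)) ↔ _ := cubicStable_span_pair
  rw [h, ← constantPencil, mem_constantPencil, mem_constantPencil]
  simp only [cubicAct, LinearMap.coe_mk, AddHom.coe_mk, Matrix.of_apply, Matrix.cons_val]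
  constructor
  · rintro ⟨⟨h1, h2⟩, h3, h4⟩
    refine ⟨mul_left_cancel₀ (mul_ne_zero (pow_ne_zero 2 hα) hαβ) ?_,
      mul_left_cancel₀ (mul_ne_zero hα hαβ) ?_⟩
    · linear_combination -h1
    · linear_combination -h2
  · rintro ⟨h1, h2⟩
    subst h1
    refine ⟨⟨?_, ?_⟩, ?_, ?_⟩
    · ring
    · linear_combination (- α * (α - β)) * h2
    · ring
    · ring

/-- A diagonal matrix whose eigenvalue ratio is neither `1`, `-1` nor a cube root of unity stabilizes
exactly one pencil. -/
lemma stableCard_diagonal_of_ne [Finite F] {α β : F} (hα : α ≠ 0) (hβ : β ≠ 0) (hαβ : α - β ≠ 0)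
    (h2 : α + β ≠ 0) (h3 : α ^ 2 + α * β + β ^ 2 ≠ 0) :
    stableCard !![α, 0; 0, β] = 1 := by
  rw [stableCard, card_cubicPencil_subtype]
  simp only [cubicStable_diagonal_quadratic hα hβ hαβ, cubicStable_diagonal_linear hα hβ hαβ,
    cubicStable_diagonal_constant hα hαβ, mul_eq_zero, h2, h3, or_false]
  have e1 : IsEmpty {p : F × F × F × F //
      quadraticRes p ≠ 0 ∧ p.1 = 0 ∧ p.2.1 = 0 ∧ p.2.2.1 = 0 ∧ p.2.2.2 = 0} :=
    ⟨fun p => p.2.1 (by simp [quadraticRes, p.2.2])⟩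
  have e2 : IsEmpty {p : F × F × F // p.2.1 + p.1 * p.2.2 ^ 2 - p.2.2 ^ 3 ≠ 0 ∧
      p.1 = 0 ∧ p.2.1 = 0 ∧ p.2.2 = 0} :=
    ⟨fun p => p.2.1 (by simp [p.2.2])⟩
  have e3 : Unique {p : F × F // p.1 = 0 ∧ p.2 = 0} :=
    ⟨⟨⟨(0, 0), rfl, rfl⟩⟩, fun p => Subtype.ext (Prod.ext p.2.1 p.2.2)⟩
  rw [Nat.card_of_isEmpty, Nat.card_of_isEmpty, Nat.card_unique]

lemma stableCard_diagonal_of_sq_add_mul_add_sq_eq_zero [Finite F] {α β : F} (hα : α ≠ 0)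
    (hβ : β ≠ 0) (hαβ : α - β ≠ 0) (h3 : α ^ 2 + α * β + β ^ 2 = 0) :
    stableCard !![α, 0; 0, β] = 2 * (Nat.card F - 1) + 1 := by
  have h2 : α + β ≠ 0 := fun h => hα (pow_eq_zero_iff two_ne_zero |>.1
    (by linear_combination h3 - β * h))
  rw [stableCard, card_cubicPencil_subtype]
  simp only [cubicStable_diagonal_quadratic hα hβ hαβ, cubicStable_diagonal_linear hα hβ hαβ,
    cubicStable_diagonal_constant hα hαβ, mul_eq_zero, h2, h3, or_false, or_true, true_and]
  have e3 : Unique {p : F × F // p.1 = 0 ∧ p.2 = 0} :=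
    ⟨⟨⟨(0, 0), rfl, rfl⟩⟩, fun p => Subtype.ext (Prod.ext p.2.1 p.2.2)⟩
  rw [Nat.card_unique (α := {p : F × F // p.1 = 0 ∧ p.2 = 0}), two_mul, ← card_ne (0 : F)]
  congr 2
  · refine Eq.symm (Nat.card_congr
      { toFun := fun b => ⟨(0, b, 0, 0), by simpa [quadraticRes] using b.2, rfl, rfl, rfl⟩
        invFun := fun p => ⟨p.1.2.1, by simpa [quadraticRes, p.2.2] using p.2.1⟩
        left_inv := fun _ => rfl
        right_inv := fun p => Subtype.ext (by ext <;> simp [p.2.2]) })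
  · refine Eq.symm (Nat.card_congr
      { toFun := fun b => ⟨(0, b, 0), by simpa using b.2, rfl, rfl⟩
        invFun := fun p => ⟨p.1.2.1, by simpa [p.2.2] using p.2.1⟩
        left_inv := fun _ => rfl
        right_inv := fun p => Subtype.ext (by ext <;> simp [p.2.2]) })

lemma stableCard_diagonal_of_add_eq_zero [Finite F] {α β : F} (hα : α ≠ 0)
    (hβ : β ≠ 0) (hαβ : α - β ≠ 0) (h2 : α + β = 0) :
    stableCard !![α, 0; 0, β] = (Nat.card F - 1) * (Nat.card F - 1) + Nat.card F := by
  have h3 : α ^ 2 + α * β + β ^ 2 ≠ 0 := fun h => hβ (pow_eq_zero_iff two_ne_zero |>.1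
    (by linear_combination h - α * h2))
  rw [stableCard, card_cubicPencil_subtype]
  simp only [cubicStable_diagonal_quadratic hα hβ hαβ, cubicStable_diagonal_linear hα hβ hαβ,
    cubicStable_diagonal_constant hα hαβ, mul_eq_zero, h2, h3, or_false, or_true, true_and,
    and_true]
  have e2 : IsEmpty {p : F × F × F // p.2.1 + p.1 * p.2.2 ^ 2 - p.2.2 ^ 3 ≠ 0 ∧
      p.1 = 0 ∧ p.2.1 = 0 ∧ p.2.2 = 0} :=
    ⟨fun p => p.2.1 (by simp [p.2.2])⟩
  rw [Nat.card_of_isEmpty (α := {p : F × F × F // _}), add_zero]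
  congr 1
  · rw [← card_ne (0 : F), ← Nat.card_prod]
    have h (p : {p : F × F × F × F // quadraticRes p ≠ 0 ∧ p.2.1 = 0 ∧ p.2.2.1 = 0}) :
        p.1.2.2.2 ≠ 0 ∧ p.1.1 - p.1.2.2.2 ≠ 0 := by
      simpa [quadraticRes, p.2.2] using p.2.1
    refine Eq.symm (Nat.card_congr
      { toFun := fun x => ⟨(x.1 + x.2, 0, 0, x.2),
          by simpa [quadraticRes] using And.intro x.2.2 x.1.2, rfl, rfl⟩
        invFun := fun p => (⟨p.1.1 - p.1.2.2.2, (h p).2⟩, ⟨p.1.2.2.2, (h p).1⟩)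
        left_inv := fun x => by simp
        right_inv := fun p => Subtype.ext (by ext <;> simp [p.2.2]) })
  · refine Eq.symm (Nat.card_congr
      { toFun := fun b => ⟨(0, b), rfl⟩
        invFun := fun p => p.1.2
        left_inv := fun _ => rfl
        right_inv := fun p => Subtype.ext (by ext <;> simp [p.2]) })

end StableCount

section StableCountJordan

variable {F : Type*} [Field F]

lemma cubicStable_jordan_quadratic {α : F} (hα : α ≠ 0) (p : F × F × F × F) :
    CubicStable !![α, 0; α, α] (quadraticPencil p) ↔
      (2 : F) = 0 ∧ p.2.2.1 = 1 ∧ p.2.2.2 = p.1 + 1 := by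
  obtain ⟨a, b, c, d⟩ := p
  have h : CubicStable !![α, 0; α, α] (quadraticPencil (a, b, c, d)) ↔ _ := cubicStable_span_pair
  rw [h, ← quadraticPencil, mem_quadraticPencil, mem_quadraticPencil]
  simp only [cubicAct, LinearMap.coe_mk, AddHom.coe_mk, Matrix.of_apply, Matrix.cons_val]
  have hα3 : α ^ 3 ≠ 0 := pow_ne_zero 3 hα
  constructor
  · rintro ⟨⟨h1, h2⟩, h3, h4⟩
    have e1 : (2 : F) = 0 := mul_left_cancel₀ hα3 (by linear_combination h3)
    have e2 : c + 1 = 0 := mul_left_cancel₀ hα3 (by linear_combination h4)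
    refine ⟨e1, by linear_combination e2 - e1, mul_left_cancel₀ hα3 ?_⟩
    linear_combination -h2 - (α ^ 3 * d) * e1
  · rintro ⟨h1, rfl, rfl⟩
    refine ⟨⟨?_, ?_⟩, ?_, ?_⟩
    · ring
    · linear_combination (- α ^ 3 * (a + 1)) * h1
    · linear_combination (α ^ 3) * h1
    · linear_combination (α ^ 3) * h1

lemma not_cubicStable_jordan_linear {α : F} (hα : α ≠ 0) (p : F × F × F) :
    ¬ CubicStable !![α, 0; α, α] (linearPencil p) := by
  obtain ⟨a, b, c⟩ := p
  have h : CubicStable !![α, 0; α, α] (linearPencil (a, b, c)) ↔ _ := cubicStable_span_pair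
  rw [h, ← linearPencil, mem_linearPencil, mem_linearPencil]
  simp only [cubicAct, LinearMap.coe_mk, AddHom.coe_mk, Matrix.of_apply, Matrix.cons_val]
  rintro ⟨-, -, h4⟩
  exact pow_ne_zero 3 hα (by linear_combination h4)

lemma cubicStable_jordan_constant {α : F} (hα : α ≠ 0) (p : F × F) :
    CubicStable !![α, 0; α, α] (constantPencil p) ↔ (3 : F) = 0 ∧ p.1 = 0 := by
  obtain ⟨a, b⟩ := p
  have h : CubicStable !![α, 0; α, α] (constantPencil (a, b)) ↔ _ := cubicStable_span_pair
  rw [h, ← constantPencil, mem_constantPencil, mem_constantPencil]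
  simp only [cubicAct, LinearMap.coe_mk, AddHom.coe_mk, Matrix.of_apply, Matrix.cons_val]
  have hα3 : α ^ 3 ≠ 0 := pow_ne_zero 3 hα
  constructor
  · rintro ⟨⟨h1, h2⟩, -, -⟩
    have e1 : (3 : F) = 0 := mul_left_cancel₀ hα3 (by linear_combination h1)
    refine ⟨e1, mul_left_cancel₀ hα3 ?_⟩
    linear_combination -h2 + α ^ 3 * (a + 1) * e1
  · rintro ⟨h1, rfl⟩
    refine ⟨⟨?_, ?_⟩, ?_, ?_⟩
    · linear_combination (α ^ 3) * h1
    · linear_combination (α ^ 3) * h1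
    · ring
    · ring

lemma stableCard_jordan_of_two_eq_zero [Finite F] {α : F} (hα : α ≠ 0) (h2 : (2 : F) = 0) :
    stableCard !![α, 0; α, α] = Nat.card F * (Nat.card F - 1) := by
  have h3 : (3 : F) ≠ 0 := fun h => one_ne_zero (α := F) (by linear_combination h - h2)
  rw [stableCard, card_cubicPencil_subtype]
  simp only [cubicStable_jordan_quadratic hα, not_cubicStable_jordan_linear hα,
    cubicStable_jordan_constant hα, h2, h3, false_and, and_false, true_and]
  rw [Nat.card_of_isEmpty (α := {_p : F × F × F // False}),
    Nat.card_of_isEmpty (α := {_p : F × F // False}), add_zero, add_zero, ← card_ne (0 : F),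
    ← Nat.card_prod]
  have h (p : {p : F × F × F × F // quadraticRes p ≠ 0 ∧ p.2.2.1 = 1 ∧ p.2.2.2 = p.1 + 1}) :
      p.1.2.1 + (p.1.1 + 1) ≠ 0 := by
    simpa [quadraticRes, p.2.2] using p.2.1
  refine Eq.symm (Nat.card_congr
    { toFun := fun x => ⟨(x.1, x.2 - (x.1 + 1), 1, x.1 + 1),
        by simpa [quadraticRes] using x.2.2, rfl, rfl⟩
      invFun := fun p => (p.1.1, ⟨p.1.2.1 + (p.1.1 + 1), h p⟩)
      left_inv := fun x => by simp
      right_inv := fun p => Subtype.ext (by ext <;> simp [p.2.2]) })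

lemma stableCard_jordan_of_three_eq_zero [Finite F] {α : F} (hα : α ≠ 0) (h3 : (3 : F) = 0) :
    stableCard !![α, 0; α, α] = Nat.card F := by
  have h2 : (2 : F) ≠ 0 := fun h => one_ne_zero (α := F) (by linear_combination h3 - h)
  rw [stableCard, card_cubicPencil_subtype]
  simp only [cubicStable_jordan_quadratic hα, not_cubicStable_jordan_linear hα,
    cubicStable_jordan_constant hα, h2, h3, false_and, and_false, true_and]
  rw [Nat.card_of_isEmpty, Nat.card_of_isEmpty, zero_add, zero_add]
  refine Eq.symm (Nat.card_congr
    { toFun := fun b => ⟨(0, b), rfl⟩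
      invFun := fun p => p.1.2
      left_inv := fun _ => rfl
      right_inv := fun p => Subtype.ext (by ext <;> simp [p.2]) })

lemma stableCard_jordan_of_ne [Finite F] {α : F} (hα : α ≠ 0) (h2 : (2 : F) ≠ 0)
    (h3 : (3 : F) ≠ 0) : stableCard !![α, 0; α, α] = 0 := by
  rw [stableCard, card_cubicPencil_subtype]
  simp only [cubicStable_jordan_quadratic hα, not_cubicStable_jordan_linear hα,
    cubicStable_jordan_constant hα, h2, h3, false_and, and_false]
  rw [Nat.card_of_isEmpty, Nat.card_of_isEmpty, Nat.card_of_isEmpty]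

end StableCountJordan

section StableCountIrreducible

variable {F : Type*} [Field F]

lemma discr_ne_zero_of_irreducible {t n : F} (ht : t ≠ 0) (h : ∀ x : F, x ^ 2 - t * x + n ≠ 0) :
    t ^ 2 - 4 * n ≠ 0 := by
  intro hD
  by_cases h2 : (2 : F) = 0
  · exact ht (pow_eq_zero_iff two_ne_zero |>.1 (by linear_combination hD + 2 * n * h2))
  · refine h (t / 2) ?_
    field_simp
    linear_combination -hD

/-- The two cubic forms `ξ, η` such that `ξ + α η = (x - α y)³` for the roots `α` of
`X² - t X + n`. -/
def cubePencil (t n : F) : Submodule F (Fin 4 → F) :=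
  Submodule.span F {![n * t, -3 * n, 0, 1], ![-(t ^ 2 - n), 3 * t, -3, 0]}

lemma basePointFree_cubePencil {t n : F} (hD : t ^ 2 - 4 * n ≠ 0) :
    BasePointFree (cubePencil t n) := by
  rw [cubePencil, basePointFree_span_pair]
  intro u v h1 h2
  let f := algebraMap F (AlgebraicClosure F)
  obtain ⟨α, hα⟩ := exists_quadratic_root (- f t) (f n)
  have hroot (α : AlgebraicClosure F) (hα : α ^ 2 + - f t * α + f n = 0) : u - α * v = 0 := by
    refine pow_eq_zero_iff three_ne_zero |>.1 ?_
    simp only [cubicEval, Matrix.cons_val, map_mul, map_neg, map_sub, map_pow, map_one, map_zero,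
      map_ofNat] at h1 h2
    linear_combination h1 + α * h2 + (3 * u * v ^ 2 - (α + f t) * v ^ 3) * hα
  have e1 := hroot α hα
  have e2 := hroot (f t - α) (by linear_combination hα)
  have hne : 2 * α - f t ≠ 0 := by
    intro h
    apply hD
    apply f.injective
    simp only [map_sub, map_pow, map_mul, map_ofNat, map_zero]
    linear_combination (2 * α - f t) * h - 4 * hα
  have hv : v = 0 := by
    refine (mul_eq_zero.1 (?_ : (2 * α - f t) * v = 0)).resolve_left hne
    linear_combination e2 - e1
  exact ⟨by linear_combination e1 + α * hv, hv⟩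

lemma mem_cubePencil {t n : F} (hD : t ^ 2 - 4 * n ≠ 0) {w : Fin 4 → F}
    (h1 : w 1 + 3 * n * w 3 + t * w 2 = 0)
    (h0 : (t ^ 2 - 4 * n) * w 2 + 3 * (n * t * w 3 + n * w 2 - w 0) = 0) :
    w ∈ cubePencil t n := by
  rw [cubePencil, Submodule.mem_span_pair]
  obtain ⟨r, hr⟩ : ∃ r, (t ^ 2 - 4 * n) * r = n * t * w 3 + n * w 2 - w 0 :=
    ⟨_, mul_div_cancel₀ _ hD⟩
  refine ⟨w 3, r, ?_⟩
  ext i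
  fin_cases i <;> simp
  · refine mul_left_cancel₀ hD ?_
    linear_combination -(t ^ 2 - n) * hr - n * h0
  · refine mul_left_cancel₀ hD ?_
    linear_combination 3 * t * hr + t * h0 - (t ^ 2 - 4 * n) * h1
  · refine mul_left_cancel₀ hD ?_
    linear_combination -3 * hr - h0

lemma cubicStable_cubePencil (t n : F) : CubicStable !![0, -1; n, t] (cubePencil t n) := by
  rw [cubePencil, cubicStable_span_pair, Submodule.mem_span_pair, Submodule.mem_span_pair]
  refine ⟨⟨- n * t, - (t ^ 2 - n) * n, ?_⟩, t ^ 2 - n, - n * t + (t ^ 2 - n) * t, ?_⟩ <;>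
  · ext i
    fin_cases i <;> simp [cubicAct] <;> ring

lemma CubicStable.pencil_le {t n : F} (ht : t ≠ 0) (h : ∀ x : F, x ^ 2 - t * x + n ≠ 0)
    {W : CubicPencil F} (hW : CubicStable !![0, -1; n, t] W.1) : W.1 ≤ cubePencil t n := by
  have hn : n ≠ 0 := fun hn => h 0 (by simp [hn])
  have hD := discr_ne_zero_of_irreducible ht h
  intro w hw
  obtain ⟨v, hv⟩ : ∃ v, v = cubicAct !![0, -1; n, t] (cubicAct !![0, -1; n, t] w) -
    (t ^ 3 - 3 * n * t) • cubicAct !![0, -1; n, t] w + n ^ 3 • w := ⟨_, rfl⟩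
  have hvW : v ∈ W.1 := hv ▸ add_mem (sub_mem (hW _ (hW _ hw))
    (W.1.smul_mem _ (hW _ hw))) (W.1.smul_mem _ hw)
  have hv3 : v 3 = n * t * ((t ^ 2 - 4 * n) * w 2 + 3 * (n * t * w 3 + n * w 2 - w 0) -
      t * (w 1 + 3 * n * w 3 + t * w 2)) := by
    rw [hv]
    simp [cubicAct]
    ring
  have hv0 : v 0 = n ^ 2 * t * (n * (w 1 + 3 * n * w 3 + t * w 2) - t * ((t ^ 2 - 4 * n) * w 2 +
      3 * (n * t * w 3 + n * w 2 - w 0) - t * (w 1 + 3 * n * w 3 + t * w 2))) := by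
    rw [hv]
    simp [cubicAct]
    ring
  have hv2 : n * v 2 = v 0 - n * t * v 3 := by
    rw [hv]
    simp [cubicAct]
    ring
  have hv1 : n * v 1 = n ^ 2 * v 3 - t * v 0 := by
    rw [hv]
    simp [cubicAct]
    ring
  clear hv
  by_cases hz : v 3 = 0 ∧ v 0 = 0
  · rw [hz.1] at hv3
    rw [hz.2] at hv0
    have e0 := mul_left_cancel₀ (mul_ne_zero hn ht) (hv3.symm.trans (mul_zero (n * t)).symm)
    have e1 : w 1 + 3 * n * w 3 + t * w 2 = 0 := by
      refine mul_left_cancel₀ (mul_ne_zero (pow_ne_zero 3 hn) ht) ?_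
      linear_combination -hv0 + n ^ 2 * t * t * e0
    exact mem_cubePencil hD e1 (by linear_combination e0 + t * e1)
  · exfalso
    have hnorm : v 0 ^ 2 + n * t * v 0 * v 3 + n ^ 3 * v 3 ^ 2 ≠ 0 := by
      intro h0
      by_cases h3 : v 3 = 0
      · refine hz ⟨h3, pow_eq_zero_iff two_ne_zero |>.1 ?_⟩
        rw [h3] at h0
        linear_combination h0
      · refine h (- v 0 / (n * v 3)) ?_
        field_simp
        linear_combination h0
    have hspan := W.eq_span hvW (hW _ hvW) fun s r hsr => by
      have c3 := congrFun hsr 3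
      have c0 := congrFun hsr 0
      simp [cubicAct] at c0 c3
      have hr : r = 0 := by
        refine (mul_eq_zero.1 (?_ : (v 0 ^ 2 + n * t * v 0 * v 3 + n ^ 3 * v 3 ^ 2) * r = 0)
          ).resolve_left hnorm
        linear_combination v 3 * c0 - v 0 * c3 - r * v 3 * (n * t * hv2 + t ^ 2 * hv1)
      have hs : s * v 3 = 0 ∧ s * v 0 = 0 := by
        rw [hr] at c0 c3
        exact ⟨by linear_combination c3, by linear_combination c0⟩
      refine ⟨?_, hr⟩
      by_contra hs0
      exact hz ⟨by simpa [hs0] using hs.1, by simpa [hs0] using hs.2⟩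
    obtain ⟨α, hα⟩ := exists_quadratic_root (- algebraMap F (AlgebraicClosure F) t)
      (algebraMap F (AlgebraicClosure F) n)
    have hdiv (v : Fin 4 → F) (hv2 : n * v 2 = v 0 - n * t * v 3)
        (hv1 : n * v 1 = n ^ 2 * v 3 - t * v 0) : cubicEval v α 1 = 0 := by
      have hn' : algebraMap F (AlgebraicClosure F) n ≠ 0 := by simpa using hn
      refine (mul_eq_zero.1 (?_ : algebraMap F (AlgebraicClosure F) n * _ = 0)).resolve_left hn'
      have hv2' := congrArg (algebraMap F (AlgebraicClosure F)) hv2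
      have hv1' := congrArg (algebraMap F (AlgebraicClosure F)) hv1
      simp only [map_mul, map_sub, map_pow] at hv1' hv2'
      simp only [cubicEval]
      linear_combination α ^ 2 * hv2' + α * hv1' + (algebraMap F (AlgebraicClosure F) n * α *
        algebraMap F (AlgebraicClosure F) (v 3) + algebraMap F (AlgebraicClosure F) (v 0)) * hα
    have hbpf := W.2.2
    rw [hspan, basePointFree_span_pair] at hbpf
    refine one_ne_zero (hbpf α 1 (hdiv v hv2 hv1) (hdiv _ ?_ ?_)).2
    · simp [cubicAct]
      linear_combination n * hv1 - n * t * hv2 - t ^ 2 * hv1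
    · simp [cubicAct]
      linear_combination -n ^ 2 * hv2 - 2 * n * t * hv1 + n * t ^ 2 * hv2 + t ^ 3 * hv1

lemma stableCard_irreducible_of_trace_ne_zero {t n : F} (ht : t ≠ 0)
    (h : ∀ x : F, x ^ 2 - t * x + n ≠ 0) : stableCard !![0, -1; n, t] = 1 := by
  have hD := discr_ne_zero_of_irreducible ht h
  let W₀ : CubicPencil F := ⟨cubePencil t n, ⟨_, _, rfl⟩, basePointFree_cubePencil hD⟩
  have : Unique {W : CubicPencil F // CubicStable !![0, -1; n, t] W.1} :=
    { default := ⟨W₀, cubicStable_cubePencil t n⟩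
      uniq := fun W => Subtype.ext (Subtype.ext (Submodule.eq_of_le_of_finrank_eq
        (W.2.pencil_le ht h) (W.1.finrank_eq.trans W₀.finrank_eq.symm))) }
  exact Nat.card_unique

end StableCountIrreducible

section StableCountTraceless

variable {F : Type*} [Field F]

/-- The pencils stable under `x ↦ n y`, `y ↦ -x`. -/
def tracelessPencil (n : F) (p : F × F) : Submodule F (Fin 4 → F) :=
  Submodule.span F {![0, p.2, p.1, 1], ![n ^ 2, -(n * p.1), p.2, 0]}

lemma basePointFree_tracelessPencil {n : F} (h : ∀ x : F, x ^ 2 + n ≠ 0) (p : F × F) :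
    BasePointFree (tracelessPencil n p) ↔ ¬ (p.2 = -n ∨ p = (0, n)) := by
  have hn : n ≠ 0 := fun hn => h 0 (by simp [hn])
  obtain ⟨a, b⟩ := p
  rw [tracelessPencil, basePointFree_span_pair_of_monic (by simp)]
  let f := algebraMap F (AlgebraicClosure F)
  simp only [cubicEval, Matrix.cons_val, map_mul, map_neg, map_pow, map_one, map_zero]
  constructor
  · rintro hx (hb | hab)
    · subst hb
      obtain ⟨x, hx0⟩ := exists_quadratic_root (f a) (- f n)
      refine hx x ?_ ?_
      · rw [map_neg]
        linear_combination x * hx0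
      · rw [map_neg]
        linear_combination - f n * hx0
    · obtain ⟨rfl, rfl⟩ := Prod.mk.inj hab
      obtain ⟨x, hx0⟩ := exists_quadratic_root 0 (f b)
      refine hx x ?_ ?_
      · rw [map_zero]
        linear_combination x * hx0
      · rw [map_zero]
        linear_combination f b * hx0
  · intro hab x h1 h2
    have hx : x ≠ 0 := by
      rintro rfl
      apply hn
      apply f.injective
      rw [map_zero]
      refine pow_eq_zero_iff two_ne_zero |>.1 ?_
      linear_combination h2
    have h3 : x ^ 2 + f a * x + f b = 0 := mul_left_cancel₀ hx (by linear_combination h1)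
    have h4 : (f b + f n) * (f a * x + f b - f n) = 0 := by
      linear_combination f b * h3 - h2
    have hbn : f b + f n ≠ 0 := by
      rw [← map_add, ← map_zero f, f.injective.ne_iff]
      exact fun h => hab (Or.inl (eq_neg_of_add_eq_zero_left h))
    have h5 := (mul_eq_zero.1 h4).resolve_left hbn
    have h6 : (n - b) ^ 2 + a ^ 2 * n = 0 := by
      apply f.injective
      simp only [map_sub, map_pow, map_mul, map_add, map_zero]
      linear_combination (f a) ^ 2 * h3 - (f a * x + (f n - f b) + f a ^ 2) * h5
    by_cases ha : a = 0
    · subst ha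
      refine hab (Or.inr (Prod.ext rfl ?_))
      refine (sub_eq_zero.1 (pow_eq_zero_iff two_ne_zero |>.1 (?_ : (n - b) ^ 2 = 0))).symm
      linear_combination h6
    · refine h ((n - b) / a) ?_
      field_simp
      linear_combination h6

lemma cubicStable_tracelessPencil (n : F) (p : F × F) :
    CubicStable !![0, -1; n, 0] (tracelessPencil n p) := by
  rw [tracelessPencil, cubicStable_span_pair, Submodule.mem_span_pair, Submodule.mem_span_pair]
  refine ⟨⟨0, n, ?_⟩, - n ^ 2, 0, ?_⟩ <;>
  · ext i
    fin_cases i <;> simp [cubicAct] <;> ring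

lemma tracelessPencil_injective {n : F} (hn : n ≠ 0) :
    Function.Injective (tracelessPencil n) := by
  rintro ⟨a, b⟩ p h
  have h1 : ![0, b, a, 1] ∈ tracelessPencil n p := h ▸ Submodule.subset_span (by simp)
  rw [tracelessPencil, Submodule.mem_span_pair] at h1
  obtain ⟨s, r, h1⟩ := h1
  have c0 := congrFun h1 0
  have c1 := congrFun h1 1
  have c2 := congrFun h1 2
  have c3 := congrFun h1 3
  simp [hn] at c0 c1 c2 c3
  subst c0 c3
  ext
  · simpa using c2.symm
  · simpa using c1.symm

lemma CubicStable.exists_eq_tracelessPencil {n : F} (h : ∀ x : F, x ^ 2 + n ≠ 0)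
    {W : CubicPencil F} (hW : CubicStable !![0, -1; n, 0] W.1) :
    ∃ p, W.1 = tracelessPencil n p := by
  have hn : n ≠ 0 := fun hn => h 0 (by simp [hn])
  have hker : ∀ w ∈ W.1, w 3 = 0 → w 0 = 0 → w = 0 := by
    intro w hw h3 h0
    by_contra hne
    have hnorm : n * w 2 ^ 2 + w 1 ^ 2 ≠ 0 := by
      intro hz
      by_cases h2 : w 2 = 0
      · have h1 : w 1 = 0 := by simpa [h2] using hz
        refine hne ?_
        ext i
        fin_cases i <;> assumption
      · refine h (w 1 / w 2) ?_
        field_simp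
        linear_combination hz
    have hspan := W.eq_span hw (hW _ hw) fun s r hsr => by
      have c1 := congrFun hsr 1
      have c2 := congrFun hsr 2
      simp [cubicAct, h3, h0] at c1 c2
      constructor
      · refine (mul_eq_zero.1 (?_ : (n * w 2 ^ 2 + w 1 ^ 2) * s = 0)).resolve_left hnorm
        linear_combination w 1 * c1 + n * w 2 * c2
      · refine (mul_eq_zero.1 (?_ : n * (n * w 2 ^ 2 + w 1 ^ 2) * r = 0)).resolve_left
          (mul_ne_zero hn hnorm)
        linear_combination w 1 * c2 - w 2 * c1
    have hbpf := W.2.2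
    rw [hspan, basePointFree_span_pair] at hbpf
    refine one_ne_zero (hbpf 1 0 ?_ ?_).1
    · simp [cubicEval, h3]
    · simp [cubicEval, cubicAct, h0]
  let π : (Fin 4 → F) →ₗ[F] (Fin 2 → F) :=
    LinearMap.pi ![LinearMap.proj 3, LinearMap.proj 0]
  have hinj : Function.Injective (π.comp W.1.subtype) := by
    rw [← LinearMap.ker_eq_bot, LinearMap.ker_eq_bot']
    rintro ⟨w, hw⟩ hz
    exact Subtype.ext (hker w hw (congrFun hz 0) (congrFun hz 1))
  have hsurj : Function.Surjective (π.comp W.1.subtype) := by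
    refine (LinearMap.injective_iff_surjective_of_finrank_eq_finrank ?_).1 hinj
    rw [W.finrank_eq, Module.finrank_fin_fun]
  obtain ⟨⟨P, hP⟩, hPπ⟩ := hsurj ![1, 0]
  have hP3 : P 3 = 1 := congrFun hPπ 0
  have hP0 : P 0 = 0 := congrFun hPπ 1
  refine ⟨(P 2, P 1), ?_⟩
  have hPv : P = ![0, P 1, P 2, 1] := by
    ext i
    fin_cases i <;> simp [hP0, hP3]
  have hQ : ![n ^ 2, -(n * P 2), P 1, 0] ∈ W.1 := by
    have := W.1.smul_mem n⁻¹ (hW _ hP)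
    convert this using 1
    ext i
    fin_cases i <;> simp [cubicAct, hP0, hP3] <;> field_simp
  refine W.eq_span (hPv ▸ hP) hQ fun s r hsr => ?_
  have c0 := congrFun hsr 0
  have c3 := congrFun hsr 3
  simp [hn] at c0 c3
  exact ⟨c3, c0⟩

lemma card_eq_neg_or_eq [Finite F] (h2 : (2 : F) ≠ 0) {n : F} (hn : n ≠ 0) :
    Nat.card {p : F × F // p.2 = -n ∨ p = (0, n)} = Nat.card F + 1 := by
  have hnn : n ≠ -n := fun h => mul_ne_zero h2 hn (by linear_combination h)
  rw [← Finite.card_option]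
  refine (Nat.card_eq_of_bijective
    (fun o : Option F => o.elim ⟨(0, n), Or.inr rfl⟩ fun a => ⟨(a, -n), Or.inl rfl⟩) ⟨?_, ?_⟩).symm
  · rintro (_ | a) (_ | b) h
    · rfl
    · exact absurd (congrArg (fun p => p.1.2) h) hnn
    · exact absurd (congrArg (fun p => p.1.2) h).symm hnn
    · exact congrArg (fun p => some p.1.1) h
  · rintro ⟨⟨a, b⟩, h | h⟩
    · exact ⟨some a, Subtype.ext (Prod.ext rfl h.symm)⟩
    · exact ⟨none, Subtype.ext h.symm⟩

lemma stableCard_irreducible_of_trace_eq_zero [Finite F] (h2 : (2 : F) ≠ 0) {n : F}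
    (h : ∀ x : F, x ^ 2 + n ≠ 0) :
    stableCard !![0, -1; n, 0] + Nat.card F + 1 = Nat.card F ^ 2 := by
  have hn : n ≠ 0 := fun hn => h 0 (by simp [hn])
  have hcard : Nat.card {p : F × F // ¬ (p.2 = -n ∨ p = (0, n))} = stableCard !![0, -1; n, 0] :=
    Nat.card_eq_of_bijective
      (fun p => ⟨⟨tracelessPencil n p, ⟨_, _, rfl⟩, (basePointFree_tracelessPencil h p).2 p.2⟩,
        cubicStable_tracelessPencil n p⟩)
      ⟨fun p r hpr => Subtype.ext (tracelessPencil_injective hn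
          (congrArg (fun W => W.1.1) hpr)), by
        rintro ⟨W, hW⟩
        obtain ⟨p, hp⟩ := hW.exists_eq_tracelessPencil h
        exact ⟨⟨p, (basePointFree_tracelessPencil h p).1 (hp ▸ W.2.2)⟩,
          Subtype.ext (Subtype.ext hp.symm)⟩⟩
  have := card_subtype_add_card_not fun p : F × F => p.2 = -n ∨ p = (0, n)
  rw [card_eq_neg_or_eq h2 hn, hcard, Nat.card_prod] at this
  rw [sq]
  omega

end StableCountTraceless

section StableCountFormula

variable {F : Type*} [Field F]

lemma cubicStable_iff_of_mul_eq {M C : Matrix (Fin 2) (Fin 2) F} {h : GL (Fin 2) F}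
    (hM : M * h.1 = h.1 * C) (W : CubicPencil F) :
    CubicStable C W.1 ↔ CubicStable M (h • W).1 := by
  have key (u : Fin 4 → F) : cubicAct M (cubicAct h.1 u) = cubicAct h.1 (cubicAct C u) := by
    rw [← cubicAct_mul, hM, cubicAct_mul]
  rw [CubicPencil.coe_smul]
  constructor
  · rintro hW _ ⟨u, hu, rfl⟩
    rw [key]
    exact ⟨_, hW u hu, rfl⟩
  · intro hW u hu
    obtain ⟨u', hu', he⟩ := hW _ ⟨u, hu, rfl⟩
    rw [key] at he
    have := congrArg (cubicAct (h⁻¹ : GL (Fin 2) F).1) he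
    rw [← cubicAct_mul, ← cubicAct_mul, ← Units.val_mul, inv_mul_cancel, Units.val_one,
      cubicAct_one, cubicAct_one] at this
    rwa [← this]

lemma stableCard_eq_of_mul_eq {M C h : Matrix (Fin 2) (Fin 2) F} (hdet : h.det ≠ 0)
    (hM : M * h = h * C) : stableCard M = stableCard C :=
  (Nat.card_congr (Equiv.subtypeEquiv
    (MulAction.toPerm (Matrix.GeneralLinearGroup.mkOfDetNeZero h hdet))
    (cubicStable_iff_of_mul_eq (h := Matrix.GeneralLinearGroup.mkOfDetNeZero h hdet) hM))).symm

lemma stableCard_scalar [Finite F] (a : F) : stableCard !![a, 0; 0, a] = Nat.card F ^ 4 := by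
  rw [← card_cubicPencil]
  refine Nat.card_congr (Equiv.subtypeUnivEquiv fun W w hw => ?_)
  convert W.1.smul_mem (a ^ 3) hw using 1
  ext i
  fin_cases i <;> simp [cubicAct] <;> ring

lemma stableCard_of_no_root {a b c d : F}
    (h : ∀ x : F, x ^ 2 - (a + d) * x + (a * d - b * c) ≠ 0) :
    stableCard !![a, b; c, d] = stableCard !![0, -1; a * d - b * c, a + d] := by
  have hb : b ≠ 0 := by
    rintro rfl
    exact h a (by ring)
  refine stableCard_eq_of_mul_eq (h := !![-b, 0; a, 1]) (by simpa [Matrix.det_fin_two] using hb) ?_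
  ext i j
  fin_cases i <;> fin_cases j <;> simp [Matrix.mul_apply, Fin.sum_univ_two] <;> ring

lemma stableCard_of_double_root {a b c d α : F} (hα : α ≠ 0) (ht : a + d = α + α)
    (hn : a * d - b * c = α * α) (hs : ¬ (b = 0 ∧ c = 0 ∧ a = d)) :
    stableCard !![a, b; c, d] = stableCard !![α, 0; α, α] := by
  by_cases hb : b = 0
  · subst hb
    have ha : a = α := sub_eq_zero.1 (pow_eq_zero_iff two_ne_zero |>.1
      (by linear_combination a * ht - hn : (a - α) ^ 2 = 0))
    have hd : d = α := by linear_combination ht - ha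
    subst ha hd
    have hc : c ≠ 0 := fun hc => hs ⟨rfl, hc, rfl⟩
    refine stableCard_eq_of_mul_eq (h := !![1, 0; 0, c / d])
      (by simpa [Matrix.det_fin_two] using ⟨hc, hα⟩) ?_
    ext i j
    fin_cases i <;> fin_cases j <;> simp [Matrix.mul_apply, Fin.sum_univ_two] <;> field_simp
  · refine stableCard_eq_of_mul_eq (h := !![0, b / α; 1, (d - α) / α])
      (by simpa [Matrix.det_fin_two] using ⟨hb, hα⟩) ?_
    ext i j
    fin_cases i <;> fin_cases j <;> simp [Matrix.mul_apply, Fin.sum_univ_two] <;> field_simp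
    · linear_combination ht
    · ring
    · linear_combination d * ht - hn

lemma stableCard_of_distinct_roots {a b c d α β : F} (hαβ : α ≠ β) (ht : a + d = α + β)
    (hn : a * d - b * c = α * β) : stableCard !![a, b; c, d] = stableCard !![α, 0; 0, β] := by
  have hβα : β - α ≠ 0 := sub_ne_zero.2 hαβ.symm
  by_cases hb : b = 0
  · subst hb
    have hroot : (a - α) * (a - β) = 0 := by linear_combination a * ht - hn
    rcases mul_eq_zero.1 hroot with ha | ha
    · obtain rfl : a = α := sub_eq_zero.1 ha
      obtain rfl : d = β := by linear_combination ht
      refine stableCard_eq_of_mul_eq (h := !![a - d, 0; c, 1])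
        (by simpa [Matrix.det_fin_two] using sub_ne_zero.2 hαβ) ?_
      ext i j
      fin_cases i <;> fin_cases j <;> simp [Matrix.mul_apply, Fin.sum_univ_two] <;> ring
    · obtain rfl : a = β := sub_eq_zero.1 ha
      obtain rfl : d = α := by linear_combination ht
      refine stableCard_eq_of_mul_eq (h := !![0, a - d; 1, c])
        (by simpa [Matrix.det_fin_two] using sub_ne_zero.2 hαβ) ?_
      ext i j
      fin_cases i <;> fin_cases j <;> simp [Matrix.mul_apply, Fin.sum_univ_two] <;> ring
  · refine stableCard_eq_of_mul_eq (h := !![b, b; α - a, β - a]) ?_ ?_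
    · simp only [Matrix.det_fin_two_of]
      exact fun h => mul_ne_zero hb hβα (by linear_combination h)
    · ext i j
      fin_cases i <;> fin_cases j <;> simp [Matrix.mul_apply, Fin.sum_univ_two]
      · ring
      · ring
      · linear_combination α * ht - hn
      · linear_combination β * ht - hn

end StableCountFormula

section StableCountEigenvalues

variable {F : Type*} [Field F]

variable (F) in
/-- The number of base-point-free pencils of binary cubics stable under `x ↦ x + y`. -/
noncomputable def jordanCard : ℕ := stableCard !![(1 : F), 0; 1, 1]

lemma stableCard_jordan [Finite F] {α : F} (hα : α ≠ 0) :
    stableCard !![α, 0; α, α] = jordanCard F := by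
  rw [jordanCard]
  by_cases h2 : (2 : F) = 0
  · rw [stableCard_jordan_of_two_eq_zero hα h2, stableCard_jordan_of_two_eq_zero one_ne_zero h2]
  by_cases h3 : (3 : F) = 0
  · rw [stableCard_jordan_of_three_eq_zero hα h3, stableCard_jordan_of_three_eq_zero one_ne_zero h3]
  · rw [stableCard_jordan_of_ne hα h2 h3, stableCard_jordan_of_ne one_ne_zero h2 h3]

lemma two_ne_zero_of_irreducible [Finite F] {n : F} (h : ∀ x : F, x ^ 2 + n ≠ 0) : (2 : F) ≠ 0 := by
  intro h2
  have : CharP F 2 := CharTwo.of_one_ne_zero_of_two_eq_zero one_ne_zero h2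
  obtain ⟨r, hr⟩ := isSquare_of_charTwo' n
  exact h r (by linear_combination r * r * h2 - (-1) * hr)

variable [Fintype F] [DecidableEq F]

/-- The contribution of an eigenvalue `α` of a matrix with other eigenvalue `β` to the number of
stable pencils. -/
noncomputable def eigenContribution (α β : F) : ℤ :=
  if α = β then
    (jordanCard F : ℤ) - 1 - if α + β = 0 then (Fintype.card F : ℤ) ^ 2 - Fintype.card F - 2 else 0
  else
    (if α ^ 2 + α * β + β ^ 2 = 0 then (Fintype.card F : ℤ) - 1 else 0) +
      if α + β = 0 then 1 else 0

lemma stableCard_diagonal {α β : F} (hα : α ≠ 0) (hβ : β ≠ 0) (hαβ : α ≠ β) :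
    (stableCard !![α, 0; 0, β] : ℤ) =
      1 + (if α + β = 0 then (Fintype.card F : ℤ) ^ 2 - Fintype.card F - 2 else 0) +
        (eigenContribution α β + eigenContribution β α) := by
  have hsub : α - β ≠ 0 := sub_ne_zero.2 hαβ
  have hsymm : β ^ 2 + β * α + α ^ 2 = α ^ 2 + α * β + β ^ 2 := by ring
  have hq : 1 ≤ Fintype.card F := Fintype.card_pos
  simp only [eigenContribution, hαβ, hαβ.symm, if_false, hsymm, add_comm β α]
  by_cases h2 : α + β = 0
  · have h3 : α ^ 2 + α * β + β ^ 2 ≠ 0 := fun h => hβ (pow_eq_zero_iff two_ne_zero |>.1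
      (by linear_combination h - α * h2))
    rw [stableCard_diagonal_of_add_eq_zero hα hβ hsub h2, Nat.card_eq_fintype_card]
    simp only [h2, h3, if_true, if_false]
    push_cast [hq]
    ring
  by_cases h3 : α ^ 2 + α * β + β ^ 2 = 0
  · rw [stableCard_diagonal_of_sq_add_mul_add_sq_eq_zero hα hβ hsub h3, Nat.card_eq_fintype_card]
    simp only [h2, h3, if_true, if_false]
    push_cast [hq]
    ring
  · rw [stableCard_diagonal_of_ne hα hβ hsub h2 h3]
    simp [h2, h3]

/-- The number of stable pencils of an invertible matrix, in terms of its eigenvalues. -/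
lemma stableCard_eq_sum {a b c d : F} (hdet : a * d - b * c ≠ 0) :
    (stableCard !![a, b; c, d] : ℤ) =
      1 + (if a + d = 0 then (Fintype.card F : ℤ) ^ 2 - Fintype.card F - 2 else 0) +
        (∑ α, if α ^ 2 - (a + d) * α + (a * d - b * c) = 0 then
          eigenContribution α (a + d - α) else 0) +
        if b = 0 ∧ c = 0 ∧ a = d then (Fintype.card F : ℤ) ^ 4 - jordanCard F else 0 := by
  by_cases hroot : ∃ α, α ^ 2 - (a + d) * α + (a * d - b * c) = 0
  · obtain ⟨α, hα⟩ := hroot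
    obtain ⟨β, ht⟩ : ∃ β, a + d = α + β := ⟨a + d - α, by ring⟩
    have hn : a * d - b * c = α * β := by linear_combination hα + α * ht
    have hα0 : α ≠ 0 := by
      rintro rfl
      exact hdet (by linear_combination hn)
    have hβ0 : β ≠ 0 := by
      rintro rfl
      exact hdet (by linear_combination hn)
    have hiff (x : F) : x ^ 2 - (α + β) * x + α * β = 0 ↔ x = α ∨ x = β := by
      rw [← sub_eq_zero (a := x), ← sub_eq_zero (a := x) (b := β), ← mul_eq_zero]
      ring_nf
    simp only [hn, ht, hiff]
    by_cases hαβ : α = β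
    · subst hαβ
      have hsum : (∑ x, if x = α ∨ x = α then eigenContribution x (α + α - x) else 0) =
          eigenContribution α α := by
        simp
      rw [hsum, eigenContribution, if_pos rfl]
      by_cases hs : b = 0 ∧ c = 0 ∧ a = d
      · obtain ⟨rfl, rfl, rfl⟩ := hs
        rw [stableCard_scalar, Nat.card_eq_fintype_card]
        simp
      · rw [if_neg hs, stableCard_of_double_root hα0 ht hn hs, stableCard_jordan hα0]
        ring
    · have hs : ¬ (b = 0 ∧ c = 0 ∧ a = d) := by
        rintro ⟨rfl, rfl, rfl⟩
        have h1 := (hiff a).1 (by linear_combination a * ht - hn)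
        rcases h1 with rfl | rfl
        · exact hαβ (by linear_combination ht)
        · exact hαβ (by linear_combination -ht)
      have hsum : (∑ x, if x = α ∨ x = β then eigenContribution x (α + β - x) else 0) =
          eigenContribution α β + eigenContribution β α := by
        rw [← Finset.sum_filter]
        have : Finset.univ.filter (fun x => x = α ∨ x = β) = {α, β} := by
          ext x
          simp
        rw [this, Finset.sum_pair hαβ]
        simp
      rw [hsum, if_neg hs, stableCard_of_distinct_roots hαβ ht hn, stableCard_diagonal hα0 hβ0 hαβ]
      ring
  · push Not at hroot
    have hs : ¬ (b = 0 ∧ c = 0 ∧ a = d) := by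
      rintro ⟨rfl, rfl, rfl⟩
      exact hroot a (by ring)
    simp only [hroot, if_false, hs, Finset.sum_const_zero, add_zero]
    rw [stableCard_of_no_root hroot]
    by_cases ht : a + d = 0
    · have hroot' (x : F) : x ^ 2 + (a * d - b * c) ≠ 0 := by
        simpa [ht] using hroot x
      have h := stableCard_irreducible_of_trace_eq_zero (two_ne_zero_of_irreducible hroot') hroot'
      rw [Nat.card_eq_fintype_card] at h
      zify at h
      rw [ht, if_pos rfl]
      linear_combination h
    · rw [stableCard_irreducible_of_trace_ne_zero ht hroot, if_neg ht]
      simp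

end StableCountEigenvalues

section Burnside

variable {F : Type*} [Field F] [Fintype F] [DecidableEq F]

lemma sum_GL_fin_two (f : F → F → F → F → ℤ) :
    ∑ g : GL (Fin 2) F, f (g.1 0 0) (g.1 0 1) (g.1 1 0) (g.1 1 1) =
      ∑ a, ∑ b, ∑ c, ∑ d, if a * d - b * c ≠ 0 then f a b c d else 0 := by
  have hsum : (∑ a, ∑ b, ∑ c, ∑ d, if a * d - b * c ≠ 0 then f a b c d else 0) =
      ∑ p : F × F × F × F, if p.1 * p.2.2.2 - p.2.1 * p.2.2.1 ≠ 0 then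
        f p.1 p.2.1 p.2.2.1 p.2.2.2 else 0 := by
    simp only [Fintype.sum_prod_type]
  rw [hsum, ← Finset.sum_filter]
  refine Finset.sum_bij (fun g _ => (g.1 0 0, g.1 0 1, g.1 1 0, g.1 1 1)) ?_ ?_ ?_ ?_
  · intro g _
    have h := (Matrix.isUnit_iff_isUnit_det g.1).1 g.isUnit
    rw [Matrix.det_fin_two, isUnit_iff_ne_zero] at h
    simpa using h
  · intro g _ h _ hgh
    simp only [Prod.mk.injEq] at hgh
    obtain ⟨h1, h2, h3, h4⟩ := hgh
    refine Units.ext (Matrix.ext fun i j => ?_)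
    fin_cases i <;> fin_cases j <;> assumption
  · rintro ⟨a, b, c, d⟩ h
    have h' : a * d - b * c ≠ 0 := by simpa using h
    refine ⟨Matrix.GeneralLinearGroup.mkOfDetNeZero !![a, b; c, d] ?_, Finset.mem_univ _, ?_⟩
    · rwa [Matrix.det_fin_two_of]
    · simp [Matrix.GeneralLinearGroup.mkOfDetNeZero]
  · intro g _
    rfl

lemma sum_ite_mul_eq (m : F) :
    (∑ b : F, ∑ c : F, if b * c = m then (1 : ℤ) else 0) =
      Fintype.card F - 1 + if m = 0 then (Fintype.card F : ℤ) else 0 := by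
  have h (b : F) : (∑ c : F, if b * c = m then (1 : ℤ) else 0) =
      if b = 0 then (if m = 0 then (Fintype.card F : ℤ) else 0) else 1 := by
    by_cases hb : b = 0
    · subst hb
      by_cases hm : m = 0
      · simp [hm]
      · simp [hm, Ne.symm hm]
    · rw [if_neg hb]
      have (c : F) : b * c = m ↔ c = m / b := by rw [eq_div_iff hb, mul_comm]
      simp [this]
  simp only [h]
  rw [← Finset.add_sum_erase _ _ (Finset.mem_univ 0), if_pos rfl,
    Finset.sum_congr rfl fun b hb => if_neg (Finset.ne_of_mem_erase hb)]
  have : 1 ≤ Fintype.card F := Fintype.card_pos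
  simp [Finset.card_erase_of_mem, this]
  ring

lemma card_GL_fin_two : (Fintype.card (GL (Fin 2) F) : ℤ) =
    ((Fintype.card F : ℤ) ^ 2 - 1) * ((Fintype.card F : ℤ) ^ 2 - Fintype.card F) := by
  have h := Matrix.card_GL_field (𝔽 := F) 2
  have hq : 1 ≤ Fintype.card F := Fintype.card_pos
  rw [Nat.card_eq_fintype_card] at h
  have h1 : 1 ≤ Fintype.card F ^ 2 := Nat.one_le_pow _ _ hq
  have h2 : Fintype.card F ≤ Fintype.card F ^ 2 := Nat.le_self_pow two_ne_zero _
  simp only [Fin.prod_univ_two, Fin.val_zero, Fin.val_one, pow_zero, pow_one] at h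
  rw [h]
  push_cast [h1, h2]
  ring

/-- The sum over invertible matrices of a function of the trace. -/
lemma sum_trace_eq_zero (k : ℤ) :
    (∑ a : F, ∑ b : F, ∑ c : F, ∑ d : F,
      if a * d - b * c ≠ 0 then (if a + d = 0 then k else 0) else 0) =
      k * ((Fintype.card F : ℤ) ^ 3 - (Fintype.card F : ℤ) ^ 2) := by
  have h (a b c : F) : (∑ d : F, if a * d - b * c ≠ 0 then (if a + d = 0 then k else 0) else 0) =
      k * (1 - if b * c = -(a * a) then 1 else 0) := by
    rw [Finset.sum_eq_single (-a)]
    · have : a * -a - b * c = 0 ↔ b * c = -(a * a) :=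
        ⟨fun h => by linear_combination -h, fun h => by linear_combination -h⟩
      by_cases hb : b * c = -(a * a)
      · simp [hb]
      · simp only [this, hb, ne_eq, not_false_eq_true, if_true, if_false, sub_zero, mul_one,
          add_neg_cancel]
    · intro d _ hd
      have : a + d ≠ 0 := fun h => hd (by linear_combination h)
      simp [this]
    · simp
  simp only [h, ← Finset.mul_sum, Finset.sum_sub_distrib, sum_ite_mul_eq]
  simp only [Finset.sum_add_distrib, Finset.sum_const, Finset.card_univ, nsmul_eq_mul, neg_eq_zero,
    mul_self_eq_zero, Finset.sum_ite_eq', Finset.mem_univ, if_true]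
  ring

lemma sum_scalar (k : ℤ) :
    (∑ a : F, ∑ b : F, ∑ c : F, ∑ d : F,
      if a * d - b * c ≠ 0 then (if b = 0 ∧ c = 0 ∧ a = d then k else 0) else 0) =
      k * (Fintype.card F - 1) := by
  have h (a b c d : F) : (if a * d - b * c ≠ 0 then
      (if b = 0 ∧ c = 0 ∧ a = d then k else 0) else 0) =
      if d = a then (if c = 0 then if b = 0 then if a = 0 then 0 else k else 0 else 0) else 0 := by
    by_cases hd : d = a
    · subst hd
      by_cases hb : b = 0 <;> by_cases hc : c = 0 <;> by_cases hd : d = 0 <;> simp [hb, hc, hd]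
    · simp [hd, Ne.symm hd]
  simp only [h, Finset.sum_ite_eq', Finset.mem_univ, if_true]
  rw [← Finset.add_sum_erase _ _ (Finset.mem_univ 0), if_pos rfl,
    Finset.sum_congr rfl fun b hb => if_neg (Finset.ne_of_mem_erase hb)]
  have : 1 ≤ Fintype.card F := Fintype.card_pos
  simp [Finset.card_erase_of_mem, this]
  ring

lemma sum_ite_mul_eq_sub_mul_sub (α β : F) :
    (∑ a : F, ∑ b : F, ∑ c : F, if b * c = (a - α) * (β - a) then (1 : ℤ) else 0) =
      Fintype.card F * (Fintype.card F - 1) +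
        Fintype.card F * if α = β then 1 else 2 := by
  simp only [sum_ite_mul_eq, Finset.sum_add_distrib, mul_eq_zero, sub_eq_zero, eq_comm (a := β)]
  rw [← Finset.sum_filter]
  by_cases h : α = β
  · subst h
    simp [Finset.filter_eq']
    ring
  · have : Finset.univ.filter (fun a => a = α ∨ a = β) = {α, β} := by
      ext x
      simp
    rw [this]
    simp [h]
    ring

/-- A sum over matrices and their eigenvalues, rearranged as a sum over pairs of eigenvalues. -/
lemma sum_eigenvalues (f : F → F → ℤ) :
    (∑ a : F, ∑ b : F, ∑ c : F, ∑ d : F, if a * d - b * c ≠ 0 then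
      ∑ α, (if α ^ 2 - (a + d) * α + (a * d - b * c) = 0 then f α (a + d - α) else 0) else 0) =
    ∑ α, ∑ β, if α * β ≠ 0 then f α β * (Fintype.card F * (Fintype.card F - 1) +
        Fintype.card F * if α = β then 1 else 2) else 0 := by
  have h1 (a b c : F) : (∑ d : F, if a * d - b * c ≠ 0 then
      ∑ α, (if α ^ 2 - (a + d) * α + (a * d - b * c) = 0 then f α (a + d - α) else 0) else 0) =
      ∑ α, ∑ β, (if α * β ≠ 0 then f α β else 0) *
        (if b * c = (a - α) * (β - a) then 1 else 0) := by
    have h2 (d : F) : (if a * d - b * c ≠ 0 then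
        ∑ α, (if α ^ 2 - (a + d) * α + (a * d - b * c) = 0 then f α (a + d - α) else 0) else 0) =
        ∑ α, if a * d - b * c ≠ 0 then
          (if α ^ 2 - (a + d) * α + (a * d - b * c) = 0 then f α (a + d - α) else 0) else 0 := by
      split_ifs <;> simp
    simp only [h2]
    rw [Finset.sum_comm]
    refine Finset.sum_congr rfl fun α _ => ?_
    refine Fintype.sum_equiv (Equiv.addRight (a - α)) _ _ fun d => ?_
    have hβ : d + (a - α) = a + d - α := by ring
    simp only [Equiv.coe_addRight, hβ]
    have hiff : α ^ 2 - (a + d) * α + (a * d - b * c) = 0 ↔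
        b * c = (a - α) * (a + d - α - a) :=
      ⟨fun h => by linear_combination -h, fun h => by linear_combination -h⟩
    by_cases h : b * c = (a - α) * (a + d - α - a)
    · have hdet : a * d - b * c = α * (a + d - α) := by rw [h]; ring
      rw [if_pos (hiff.2 h), if_pos h, hdet, mul_one]
    · rw [if_neg (mt hiff.1 h), if_neg h, mul_zero, ite_self]
  simp only [h1]
  have h2 (g : F → F → F → ℤ) : (∑ c, ∑ α, ∑ β, g c α β) = ∑ α, ∑ β, ∑ c, g c α β := by
    rw [Finset.sum_comm]
    exact Finset.sum_congr rfl fun α _ => Finset.sum_comm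
  have h3 (g : F → F → F → F → F → ℤ) : (∑ a, ∑ b, ∑ c, ∑ α, ∑ β, g a b c α β) =
      ∑ α, ∑ β, ∑ a, ∑ b, ∑ c, g a b c α β := by
    calc _ = ∑ a, ∑ b, ∑ α, ∑ β, ∑ c, g a b c α β :=
          Finset.sum_congr rfl fun a _ => Finset.sum_congr rfl fun b _ => h2 (g a b)
      _ = ∑ a, ∑ α, ∑ β, ∑ b, ∑ c, g a b c α β :=
          Finset.sum_congr rfl fun a _ => h2 fun b α β => ∑ c, g a b c α β
      _ = _ := h2 fun a α β => ∑ b, ∑ c, g a b c α β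
  rw [h3]
  refine Finset.sum_congr rfl fun α _ => Finset.sum_congr rfl fun β _ => ?_
  simp only [← Finset.mul_sum, sum_ite_mul_eq_sub_mul_sub]
  split_ifs <;> simp

variable (F) in
/-- The number of primitive cube roots of unity. -/
def cubeRootCard : ℕ := (Finset.univ.filter fun t : F => t ≠ 1 ∧ t ^ 2 + t + 1 = 0).card

lemma eigenContribution_mul {γ : F} (hγ : γ ≠ 0) (α β : F) :
    eigenContribution (γ * α) (γ * β) = eigenContribution α β := by
  have h1 : γ * α + γ * β = 0 ↔ α + β = 0 := by simp [← mul_add, hγ]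
  have h2 : (γ * α) ^ 2 + γ * α * (γ * β) + (γ * β) ^ 2 = 0 ↔ α ^ 2 + α * β + β ^ 2 = 0 := by
    rw [show (γ * α) ^ 2 + γ * α * (γ * β) + (γ * β) ^ 2 =
      γ ^ 2 * (α ^ 2 + α * β + β ^ 2) by ring]
    simp [hγ]
  simp only [eigenContribution, mul_right_inj' hγ, h1, h2]

lemma sum_eigenContribution :
    (∑ α : F, ∑ β : F, if α * β ≠ 0 then eigenContribution α β *
      (Fintype.card F * (Fintype.card F - 1) + Fintype.card F * if α = β then 1 else 2) else 0) =
    (Fintype.card F - 1) *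
      (((Fintype.card F : ℤ) ^ 2 * (jordanCard F - 1 -
          if (2 : F) = 0 then (Fintype.card F : ℤ) ^ 2 - Fintype.card F - 2 else 0)) +
        ((Fintype.card F : ℤ) ^ 2 + Fintype.card F) *
          ((Fintype.card F - 1) * cubeRootCard F + if (2 : F) = 0 then 0 else 1)) := by
  set q : ℤ := (Fintype.card F : ℤ) with hq
  have h1 (α : F) (hα : α ≠ 0) : (∑ β : F, if α * β ≠ 0 then eigenContribution α β *
      (q * (q - 1) + q * if α = β then 1 else 2) else 0) =
      ∑ t : F, if t ≠ 0 then eigenContribution 1 t *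
        (q * (q - 1) + q * if 1 = t then 1 else 2) else 0 := by
    symm
    refine Fintype.sum_equiv (Equiv.mulLeft₀ α hα) _ _ fun t => ?_
    have h := eigenContribution_mul hα 1 t
    rw [mul_one] at h
    simp [h, hα, eq_comm (a := (1 : F))]
  rw [← Finset.add_sum_erase _ _ (Finset.mem_univ 0),
    Finset.sum_congr rfl fun α hα => h1 α (Finset.ne_of_mem_erase hα)]
  have hcard : ((Finset.univ.erase (0 : F)).card : ℤ) = q - 1 := by
    have : 1 ≤ Fintype.card F := Fintype.card_pos
    simp [Finset.card_erase_of_mem, this, hq]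
  simp only [Finset.sum_const, nsmul_eq_mul, hcard, zero_mul, ne_eq, not_true, if_false,
    zero_add, smul_zero]
  congr 1
  have h2 (t : F) : (if ¬ t = 0 then eigenContribution 1 t *
        (q * (q - 1) + q * if 1 = t then 1 else 2) else 0) =
      (if t = 1 then q ^ 2 * (jordanCard F - 1 - if (2 : F) = 0 then q ^ 2 - q - 2 else 0) else 0) +
      ((q ^ 2 + q) * (q - 1) * (if t ≠ 1 ∧ t ^ 2 + t + 1 = 0 then 1 else 0) +
      (q ^ 2 + q) * if t = -1 then (if (2 : F) = 0 then 0 else 1) else 0) := by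
    by_cases ht1 : t = 1
    · subst ht1
      have h3 : (1 : F) = -1 ↔ (2 : F) = 0 :=
        ⟨fun h => by linear_combination h, fun h => by linear_combination h⟩
      simp only [eigenContribution, one_add_one_eq_two, h3]
      by_cases h2 : (2 : F) = 0 <;> simp [h2, ← hq] <;> ring
    · have hm : 1 + t = 0 ↔ t = -1 :=
        ⟨fun h => by linear_combination h, fun h => by linear_combination h⟩
      have hs : 1 ^ 2 + 1 * t + t ^ 2 = 0 ↔ t ^ 2 + t + 1 = 0 := by ring_nf
      simp only [eigenContribution, Ne.symm ht1, ht1, if_false, hm, hs, ne_eq, not_false_eq_true,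
        true_and, zero_add, ← hq]
      by_cases ht0 : t = 0
      · subst ht0
        simp
      by_cases htm : t = -1
      · subst htm
        have h2 : (2 : F) ≠ 0 := fun h => ht1 (by linear_combination -h)
        simp [h2]
        ring
      · by_cases hc : t ^ 2 + t + 1 = 0 <;> simp [ht0, htm, hc]
        ring
  simp only [h2, Finset.sum_add_distrib, ← Finset.mul_sum, Finset.sum_ite_eq', Finset.mem_univ,
    if_true, Finset.sum_boole]
  rw [cubeRootCard]
  simp only [ne_eq]
  ring

end Burnside

section OrbitCount

variable {F : Type*} [Field F] [Fintype F]

lemma natCast_prime_eq_zero_iff {p : ℕ} (hp : p.Prime) :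
    (p : F) = 0 ↔ p ∣ Fintype.card F := by
  have := Fact.mk hp
  rw [← prime_dvd_char_iff_dvd_card, ringChar.spec,
    Nat.prime_dvd_prime_iff_eq (CharP.char_is_prime F (ringChar F)) hp,
    Nat.prime_dvd_prime_iff_eq hp (CharP.char_is_prime F (ringChar F)), eq_comm]

variable [DecidableEq F]

lemma ratEquivCount_three_mul_card_GL :
    (ratEquivCount F 3 : ℤ) * Fintype.card (GL (Fin 2) F) =
      ∑ g : GL (Fin 2) F, (stableCard g.1 : ℤ) := by
  classical
  have := Fintype.ofFinite (CubicPencil F)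
  have := Fintype.ofFinite (Quotient (MulAction.orbitRel (GL (Fin 2) F) (CubicPencil F)))
  have := fun g : GL (Fin 2) F => Fintype.ofFinite (MulAction.fixedBy (CubicPencil F) g)
  rw [ratEquivCount_three, Nat.card_eq_fintype_card, ← Nat.cast_mul,
    ← MulAction.sum_card_fixedBy_eq_card_orbits_mul_card_group]
  simp only [← Nat.card_eq_fintype_card, card_fixedBy, Nat.cast_sum]

lemma sum_stableCard :
    ∑ g : GL (Fin 2) F, (stableCard g.1 : ℤ) =
      Fintype.card (GL (Fin 2) F) +
      ((Fintype.card F : ℤ) ^ 2 - Fintype.card F - 2) *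
        ((Fintype.card F : ℤ) ^ 3 - (Fintype.card F : ℤ) ^ 2) +
      (Fintype.card F - 1) *
        (((Fintype.card F : ℤ) ^ 2 * (jordanCard F - 1 -
            if (2 : F) = 0 then (Fintype.card F : ℤ) ^ 2 - Fintype.card F - 2 else 0)) +
          ((Fintype.card F : ℤ) ^ 2 + Fintype.card F) *
            ((Fintype.card F - 1) * cubeRootCard F + if (2 : F) = 0 then 0 else 1)) +
      ((Fintype.card F : ℤ) ^ 4 - jordanCard F) * (Fintype.card F - 1) := by
  have h1 : (Fintype.card (GL (Fin 2) F) : ℤ) =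
      ∑ a : F, ∑ b : F, ∑ c : F, ∑ d : F, if a * d - b * c ≠ 0 then 1 else 0 := by
    rw [← sum_GL_fin_two fun _ _ _ _ => 1]
    simp
  rw [h1, ← sum_trace_eq_zero, ← sum_eigenContribution, ← sum_eigenvalues, ← sum_scalar]
  simp only [← Finset.sum_add_distrib]
  have h2 (g : GL (Fin 2) F) : (stableCard g.1 : ℤ) =
      stableCard !![g.1 0 0, g.1 0 1; g.1 1 0, g.1 1 1] := by
    rw [← Matrix.eta_fin_two]
  simp only [h2]
  rw [sum_GL_fin_two fun a b c d => (stableCard !![a, b; c, d] : ℤ)]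
  refine Finset.sum_congr rfl fun a _ => Finset.sum_congr rfl fun b _ =>
    Finset.sum_congr rfl fun c _ => Finset.sum_congr rfl fun d _ => ?_
  by_cases h : a * d - b * c = 0
  · simp [h]
  · simp only [ne_eq, h, not_false_eq_true, if_true]
    exact stableCard_eq_sum h

lemma cubeRootCard_eq_zero (h : ∀ t : F, t ^ 2 + t + 1 = 0 → t = 1) : cubeRootCard F = 0 := by
  rw [cubeRootCard, Finset.card_eq_zero, Finset.filter_eq_empty_iff]
  exact fun t _ ht => ht.1 (h t ht.2)

lemma cubeRootCard_of_mod_eq_zero (hq : Fintype.card F % 3 = 0) : cubeRootCard F = 0 := by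
  refine cubeRootCard_eq_zero fun t ht => ?_
  have h3 : (3 : F) = 0 :=
    mod_cast (natCast_prime_eq_zero_iff Nat.prime_three).2 (Nat.dvd_of_mod_eq_zero hq)
  exact sub_eq_zero.1 (pow_eq_zero_iff two_ne_zero |>.1 (by linear_combination ht - t * h3))

lemma cubeRootCard_of_mod_eq_two (hq : Fintype.card F % 3 = 2) : cubeRootCard F = 0 := by
  refine cubeRootCard_eq_zero fun t ht => ?_
  by_contra h1
  have h3 : t ^ 3 = 1 := by linear_combination (t - 1) * ht
  have hdvd := orderOf_dvd_of_pow_eq_one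
    (FiniteField.pow_card_sub_one_eq_one t fun h0 => by simp [h0] at h3)
  have := Fact.mk Nat.prime_three
  rw [orderOf_eq_prime h3 h1] at hdvd
  omega

lemma cubeRootCard_of_mod_eq_one (hq : Fintype.card F % 3 = 1) : cubeRootCard F = 2 := by
  have := Fact.mk Nat.prime_three
  obtain ⟨u, hu⟩ := exists_prime_orderOf_dvd_card (G := Fˣ) 3
    (by rw [Fintype.card_units]; omega)
  obtain ⟨hu3, hu1⟩ := orderOf_eq_prime_iff.1 hu
  have hω3 : (u : F) ^ 3 = 1 := by rw [← Units.val_pow_eq_pow_val, hu3, Units.val_one]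
  have hω1 : (u : F) ≠ 1 := by simpa using hu1
  have hω : (u : F) ^ 2 + u + 1 = 0 :=
    (mul_eq_zero.1 (by linear_combination hω3 : ((u : F) - 1) * (u ^ 2 + u + 1) = 0)).resolve_left
      (sub_ne_zero.2 hω1)
  have hne : (u : F) ≠ u ^ 2 := fun h => hω1 (mul_left_cancel₀ u.ne_zero
    (by linear_combination -h))
  rw [cubeRootCard]
  refine (congrArg Finset.card ?_).trans (Finset.card_pair hne)
  ext t
  simp only [Finset.mem_filter, Finset.mem_univ, true_and, Finset.mem_insert,
    Finset.mem_singleton]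
  constructor
  · rintro ⟨-, ht⟩
    have : (t - u) * (t - u ^ 2) = 0 := by linear_combination ht - t * hω + hω3
    simpa [sub_eq_zero] using this
  · rintro (rfl | rfl)
    · exact ⟨hω1, hω⟩
    · exact ⟨fun h => hω1 (by linear_combination hω3 - u * h), by
        linear_combination hω + u * hω3⟩

lemma ratEquivCount_three_eq {n : ℤ}
    (h : n * (((Fintype.card F : ℤ) ^ 2 - 1) * ((Fintype.card F : ℤ) ^ 2 - Fintype.card F)) =
      ∑ g : GL (Fin 2) F, (stableCard g.1 : ℤ)) : (ratEquivCount F 3 : ℤ) = n := by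
  have hG : (Fintype.card (GL (Fin 2) F) : ℤ) ≠ 0 := mod_cast Fintype.card_ne_zero
  rw [← card_GL_fin_two, ← ratEquivCount_three_mul_card_GL] at h
  exact (mul_right_cancel₀ hG h).symm

end OrbitCount

/-- The number of equivalence classes of rational functions of degree 3 over `F_q`. -/
theorem count_deg_three (q : ℕ) (hq : IsPrimePow q)
    (F : Type*) [Field F] [Fintype F] (hF : Fintype.card F = q) :
    (q % 6 = 1 ∨ q % 6 = 4 → ratEquivCount F 3 = 2 * (q + 1)) ∧
    (q % 6 = 2 ∨ q % 6 = 5 → ratEquivCount F 3 = 2 * q) ∧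
    (q % 6 = 3 → ratEquivCount F 3 = 2 * q + 1) := by
  classical
  subst hF
  have h2iff := natCast_prime_eq_zero_iff (F := F) Nat.prime_two
  have h3iff := natCast_prime_eq_zero_iff (F := F) Nat.prime_three
  rw [Nat.cast_ofNat] at h2iff h3iff
  have hq1 : 1 ≤ Fintype.card F := Fintype.card_pos
  have hu2 (h2 : (2 : F) = 0) : (jordanCard F : ℤ) = Fintype.card F * (Fintype.card F - 1) := by
    rw [jordanCard, stableCard_jordan_of_two_eq_zero one_ne_zero h2, Nat.card_eq_fintype_card]
    push_cast [hq1]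
    ring
  have hu3 (h3 : (3 : F) = 0) : (jordanCard F : ℤ) = Fintype.card F := by
    rw [jordanCard, stableCard_jordan_of_three_eq_zero one_ne_zero h3, Nat.card_eq_fintype_card]
  have hu (h2 : (2 : F) ≠ 0) (h3 : (3 : F) ≠ 0) : (jordanCard F : ℤ) = 0 := by
    rw [jordanCard, stableCard_jordan_of_ne one_ne_zero h2 h3, Nat.cast_zero]
  refine ⟨fun h => ?_, fun h => ?_, fun h => ?_⟩ <;>
    refine Int.ofNat_inj.1 (ratEquivCount_three_eq ?_) <;>
    rw [sum_stableCard, card_GL_fin_two] <;>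
    push_cast
  · rw [cubeRootCard_of_mod_eq_one (by omega)]
    rcases h with h | h
    · have h2 : (2 : F) ≠ 0 := mt h2iff.1 (by omega)
      rw [if_neg h2, if_neg h2, hu h2 (mt h3iff.1 (by omega))]
      push_cast
      ring
    · have h2 : (2 : F) = 0 := h2iff.2 (by omega)
      rw [if_pos h2, if_pos h2, hu2 h2]
      push_cast
      ring
  · rw [cubeRootCard_of_mod_eq_two (by omega)]
    rcases h with h | h
    · have h2 : (2 : F) = 0 := h2iff.2 (by omega)
      rw [if_pos h2, if_pos h2, hu2 h2]
      push_cast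
      ring
    · have h2 : (2 : F) ≠ 0 := mt h2iff.1 (by omega)
      rw [if_neg h2, if_neg h2, hu h2 (mt h3iff.1 (by omega))]
      push_cast
      ring
  · have h2 : (2 : F) ≠ 0 := mt h2iff.1 (by omega)
    rw [cubeRootCard_of_mod_eq_zero (by omega), if_neg h2, if_neg h2, hu3 (h3iff.2 (by omega))]
    push_cast
    ring
end

section
/- Let q be a prime power, f ∈ F_q(X) with deg f = n > 0, and c ∈ F_q^* with c ≠ 1; let d be the multiplicative order of c. Write f = P/Q with P, Q ∈ F_q[X] coprime and let 𝓢(f) be the F_q-linear span of {P, Q} in F_q[X]. Then F_q(f(X)) = F_q(f(cX)) if and only if there exist monic polynomials P_1, Q_1 ∈ F_q[X] and integers r_1, r_2 with 0 ≤ r_1, r_2 < d such that 𝓢(f) equals the F_q-linear span of {X^{r_1}·P_1(X^d), X^{r_2}·Q_1(X^d)}, where deg(X^{r_2}·Q_1(X^d)) < deg(X^{r_1}·P_1(X^d)) = n and gcd(X^{r_1}·P_1(X), X^{r_2}·Q_1(X)) = 1. -/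
open Polynomial

section Span

variable {F : Type*} [Field F]

/-- Two polynomials whose span contains a coprime pair are coprime. -/
theorem isCoprime_of_span_pair_le {P Q A B : F[X]} (h : IsCoprime P Q)
    (hle : Submodule.span F {P, Q} ≤ Submodule.span F {A, B}) : IsCoprime A B := by
  obtain ⟨a, b, hP⟩ := Submodule.mem_span_pair.1 (hle (Submodule.subset_span (by simp : P ∈ _)))
  obtain ⟨a', b', hQ⟩ := Submodule.mem_span_pair.1 (hle (Submodule.subset_span (by simp : Q ∈ _)))
  obtain ⟨u, v, huv⟩ := h
  refine ⟨u * C a + v * C a', u * C b + v * C b', ?_⟩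
  rw [← huv, ← hP, ← hQ]
  simp only [smul_eq_C_mul]
  ring

theorem natDegree_max_le_of_span_pair_le {P Q A B : F[X]}
    (hle : Submodule.span F {P, Q} ≤ Submodule.span F {A, B}) :
    max P.natDegree Q.natDegree ≤ max A.natDegree B.natDegree := by
  have key : ∀ p ∈ Submodule.span F {A, B}, p.natDegree ≤ max A.natDegree B.natDegree := by
    intro p hp
    obtain ⟨a, b, rfl⟩ := Submodule.mem_span_pair.1 hp
    exact (natDegree_add_le _ _).trans
      (max_le_max (natDegree_smul_le a A) (natDegree_smul_le b B))
  exact max_le (key P (hle (Submodule.subset_span (by simp))))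
    (key Q (hle (Submodule.subset_span (by simp))))

theorem span_pair_smul_add {V : Type*} [AddCommGroup V] [Module F V] {a b : F}
    (ha : a ≠ 0) (v w : V) :
    Submodule.span F {a • v + b • w, w} = Submodule.span F {v, w} := by
  apply le_antisymm <;> rw [Submodule.span_le, Set.pair_subset_iff] <;>
    simp only [SetLike.mem_coe, Submodule.mem_span_pair]
  · exact ⟨⟨a, b, rfl⟩, 0, 1, by simp⟩
  · exact ⟨⟨a⁻¹, -(a⁻¹ * b), by simp [smul_smul, ha]⟩, 0, 1, by simp⟩

theorem span_pair_smul_smul {V : Type*} [AddCommGroup V] [Module F V] {a b : F}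
    (ha : a ≠ 0) (hb : b ≠ 0) (v w : V) :
    Submodule.span F {a • v, b • w} = Submodule.span F {v, w} := by
  have h1 := span_pair_smul_add (b := 0) ha v (b • w)
  have h2 := span_pair_smul_add (b := 0) hb w v
  rw [zero_smul, add_zero] at h1 h2
  rw [h1, Set.pair_comm, h2, Set.pair_comm]

/-- The span of two coprime polynomials, not both constant, has a basis of polynomials of different
degrees. -/
theorem exists_span_pair_eq_natDegree_lt {P Q : F[X]} (h : IsCoprime P Q)
    (hn : 0 < max P.natDegree Q.natDegree) :
    ∃ A B : F[X], B ≠ 0 ∧ B.natDegree < A.natDegree ∧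
      Submodule.span F {P, Q} = Submodule.span F {A, B} := by
  wlog hle : Q.natDegree ≤ P.natDegree generalizing P Q
  · obtain ⟨A, B, h1, h2, h3⟩ := this h.symm (by rwa [max_comm]) (le_of_not_ge hle)
    exact ⟨A, B, h1, h2, by rw [Set.pair_comm, h3]⟩
  rw [max_eq_left hle] at hn
  have hP : P ≠ 0 := by rintro rfl; simp at hn
  have ne_zero : ∀ {R : F[X]}, IsCoprime P R → R ≠ 0 := by
    rintro R hR rfl
    exact hn.ne' (natDegree_eq_zero_of_isUnit (isCoprime_zero_right.1 hR))
  have hQ := ne_zero h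
  rcases hle.lt_or_eq with hlt | heq
  · exact ⟨P, Q, hQ, hlt, rfl⟩
  set R : F[X] := P.leadingCoeff • Q + (-Q.leadingCoeff) • P with hR
  have hspan : Submodule.span F {P, Q} = Submodule.span F {P, R} := by
    rw [Set.pair_comm P R, hR, span_pair_smul_add (leadingCoeff_ne_zero.2 hP), Set.pair_comm]
  have hR0 : R ≠ 0 := ne_zero (isCoprime_of_span_pair_le h hspan.le)
  refine ⟨P, R, hR0, ?_, hspan⟩
  apply lt_of_le_of_ne
  · refine (natDegree_add_le _ _).trans (max_le ?_ (natDegree_smul_le _ _))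
    exact (natDegree_smul_le _ _).trans hle
  · intro hd
    apply leadingCoeff_ne_zero.2 hR0
    rw [leadingCoeff, hd, hR, coeff_add, coeff_smul, coeff_smul, smul_eq_mul, smul_eq_mul,
      ← heq]
    nth_rw 2 [heq]
    simp only [coeff_natDegree]
    ring

/-- A reduced echelon basis of the span of two coprime polynomials, not both constant. -/
theorem exists_span_pair_eq_monic {P Q : F[X]} (h : IsCoprime P Q)
    (hn : 0 < max P.natDegree Q.natDegree) :
    ∃ A B : F[X], A.Monic ∧ B.Monic ∧ B.natDegree < A.natDegree ∧ A.coeff B.natDegree = 0 ∧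
      Submodule.span F {P, Q} = Submodule.span F {A, B} := by
  obtain ⟨A, B, hB, hlt, hspan⟩ := exists_span_pair_eq_natDegree_lt h hn
  have hA : A ≠ 0 := by rintro rfl; simp at hlt
  have hA' := inv_ne_zero (leadingCoeff_ne_zero.2 hA)
  have hB' := inv_ne_zero (leadingCoeff_ne_zero.2 hB)
  set B₁ : F[X] := B.leadingCoeff⁻¹ • B
  set A₁ : F[X] := A.leadingCoeff⁻¹ • A
  have monic : ∀ {p : F[X]}, p ≠ 0 → (p.leadingCoeff⁻¹ • p).Monic := fun hp ↦ by
    rw [smul_eq_C_mul, mul_comm]; exact monic_mul_leadingCoeff_inv hp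
  have hdB : B₁.natDegree = B.natDegree := natDegree_smul _ hB'
  have hdA : A₁.natDegree = A.natDegree := natDegree_smul _ hA'
  have hlt' : ((-(A₁.coeff B.natDegree)) • B₁).natDegree < A₁.natDegree :=
    (natDegree_smul_le _ _).trans_lt (by omega)
  have hd : (A₁ + (-(A₁.coeff B.natDegree)) • B₁).natDegree = A₁.natDegree :=
    natDegree_add_eq_left_of_natDegree_lt hlt'
  have hBc : B₁.coeff B.natDegree = 1 := by
    rw [← hdB]; exact monic hB
  refine ⟨A₁ + (-(A₁.coeff B.natDegree)) • B₁, B₁, ?_, monic hB, by omega, ?_, ?_⟩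
  · exact (monic hA).add_of_left (degree_lt_degree hlt')
  · rw [hdB, coeff_add, coeff_smul _ B₁, hBc, smul_eq_mul, mul_one, add_neg_cancel]
  · have := span_pair_smul_add (b := -(A₁.coeff B.natDegree)) one_ne_zero A₁ B₁
    rw [one_smul] at this
    rw [this, span_pair_smul_smul hA' hB', hspan]

end Span

section Scaling

variable {F : Type*} [Field F]

/-- An echelon basis of a space stable under `X ↦ cX` consists of eigenvectors. -/
theorem comp_C_mul_X_eq_of_span_pair_stable {A B : F[X]} {c : F} (hA : A.Monic) (hB : B.Monic)
    (hlt : B.natDegree < A.natDegree) (hcoeff : A.coeff B.natDegree = 0)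
    (hAV : A.comp (C c * X) ∈ Submodule.span F {A, B})
    (hBV : B.comp (C c * X) ∈ Submodule.span F {A, B}) :
    A.comp (C c * X) = c ^ A.natDegree • A ∧ B.comp (C c * X) = c ^ B.natDegree • B := by
  have key : ∀ p : F[X], p.comp (C c * X) ∈ Submodule.span F {A, B} →
      p.comp (C c * X) = (p.coeff A.natDegree * c ^ A.natDegree) • A +
        (p.coeff B.natDegree * c ^ B.natDegree) • B := by
    intro p hp
    obtain ⟨a, b, hab⟩ := Submodule.mem_span_pair.1 hp
    have h1 := congrArg (coeff · A.natDegree) hab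
    have h2 := congrArg (coeff · B.natDegree) hab
    simp only [comp_C_mul_X_coeff, coeff_add, coeff_smul] at h1 h2
    rw [coeff_eq_zero_of_natDegree_lt hlt, hA.coeff_natDegree] at h1
    rw [hcoeff, hB.coeff_natDegree] at h2
    simp only [smul_eq_mul, mul_one, mul_zero, add_zero, zero_add] at h1 h2
    rw [← hab, h1, h2]
  constructor
  · rw [key A hAV, hA.coeff_natDegree, hcoeff]
    simp
  · rw [key B hBV, hB.coeff_natDegree, coeff_eq_zero_of_natDegree_lt hlt]
    simp

/-- A monic eigenvector of `X ↦ cX` has the form `X ^ r * p(X ^ d)`, with `d` the order of `c`. -/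
theorem exists_eq_X_pow_mul_comp_X_pow {A : F[X]} {c : F} (hA : A.Monic) (hc : c ≠ 0)
    (hd : 0 < orderOf c) (h : A.comp (C c * X) = c ^ A.natDegree • A) :
    ∃ p : F[X], p.Monic ∧ A = X ^ (A.natDegree % orderOf c) * p.comp (X ^ orderOf c) := by
  have hmod : ∀ i, A.coeff i ≠ 0 → i % orderOf c = A.natDegree % orderOf c := by
    intro i hi
    have := congrArg (coeff · i) h
    simp only [comp_C_mul_X_coeff, coeff_smul, smul_eq_mul] at this
    rw [mul_comm] at this
    rw [← Units.val_mk0 hc, orderOf_units]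
    refine pow_inj_mod.1 (Units.ext ?_)
    simpa using mul_right_cancel₀ hi this
  obtain ⟨q, hq⟩ : X ^ (A.natDegree % orderOf c) ∣ A := by
    refine X_pow_dvd_iff.2 fun i hi ↦ ?_
    by_contra h0
    have := hmod i h0
    rw [Nat.mod_eq_of_lt (hi.trans (Nat.mod_lt _ hd))] at this
    omega
  set r := A.natDegree % orderOf c with hr
  have hqe : q = expand F (orderOf c) (contract (orderOf c) q) := by
    ext i
    rw [coeff_expand hd]
    split_ifs with hi
    · rw [coeff_contract hd.ne', Nat.div_mul_cancel hi]
    · by_contra h0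
      have h1 : A.coeff (i + r) ≠ 0 := by rwa [hq, coeff_X_pow_mul]
      have h2 : i + r ≡ 0 + r [MOD orderOf c] := by
        rw [Nat.ModEq, hmod _ h1, hr, zero_add, Nat.mod_mod]
      exact hi ((Nat.modEq_zero_iff_dvd).1 (Nat.ModEq.add_right_cancel' r h2))
  have hqm : q.Monic := (monic_X_pow r).of_mul_monic_left (hq ▸ hA)
  refine ⟨contract (orderOf c) q, (monic_expand_iff hd).1 (hqe ▸ hqm), ?_⟩
  rw [← expand_eq_comp_X_pow, ← hqe, ← hq]

theorem X_pow_mul_comp_comp_C_mul_X (p : F[X]) (c : F) (r : ℕ) :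
    (X ^ r * p.comp (X ^ orderOf c)).comp (C c * X) =
      c ^ r • (X ^ r * p.comp (X ^ orderOf c)) := by
  rw [mul_comp, comp_assoc, X_pow_comp, X_pow_comp, mul_pow, mul_pow, ← C_pow, ← C_pow,
    pow_orderOf_eq_one, C_1, one_mul, smul_eq_C_mul, mul_assoc]

theorem isCoprime_X_pow_mul_of_comp {p q : F[X]} {d r s : ℕ} (hd : d ≠ 0)
    (h : IsCoprime (X ^ r * p.comp (X ^ d)) (X ^ s * q.comp (X ^ d))) :
    IsCoprime (X ^ r * p) (X ^ s * q) := by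
  have key : ∀ (p : F[X]) (r : ℕ), expand F d (X ^ r * p) ∣ (X ^ r * p.comp (X ^ d)) ^ d := by
    intro p r
    rw [map_mul, map_pow, expand_X, expand_eq_comp_X_pow, mul_pow, ← pow_mul, ← pow_mul, mul_comm d]
    exact mul_dvd_mul_left _ (dvd_pow_self _ hd)
  rw [← isCoprime_expand hd]
  exact (h.pow.of_isCoprime_of_dvd_left (key p r)).of_isCoprime_of_dvd_right (key q s)

end Scaling

section RatFunc

variable {F : Type*} [Field F]

open IntermediateField.algebraAdjoinAdjoin

theorem span_pair_num_denom_div {P Q : F[X]} (h : IsCoprime P Q) (hQ : Q ≠ 0) :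
    Submodule.span F {(algebraMap F[X] (RatFunc F) P / algebraMap F[X] (RatFunc F) Q).num,
      (algebraMap F[X] (RatFunc F) P / algebraMap F[X] (RatFunc F) Q).denom} =
      Submodule.span F {P, Q} := by
  classical
  have hg : gcd P Q = 1 := by
    rw [← normalize_gcd]
    exact normalize_eq_one.2 ((gcd_isUnit_iff P Q).2 h)
  have hlc := inv_ne_zero (leadingCoeff_ne_zero.2 hQ)
  rw [RatFunc.num_div, RatFunc.denom_div _ hQ, hg, EuclideanDomain.div_one, EuclideanDomain.div_one,
    ← smul_eq_C_mul, ← smul_eq_C_mul, span_pair_smul_smul hlc hlc]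

theorem div_mem_adjoin_of_span_pair_le {P Q R S : F[X]} (hQ : Q ≠ 0)
    (hle : Submodule.span F {R, S} ≤ Submodule.span F {P, Q}) :
    algebraMap F[X] (RatFunc F) R / algebraMap F[X] (RatFunc F) S ∈
      IntermediateField.adjoin F
        {algebraMap F[X] (RatFunc F) P / algebraMap F[X] (RatFunc F) Q} := by
  set f := algebraMap F[X] (RatFunc F) P / algebraMap F[X] (RatFunc F) Q with hf
  have hQ' : algebraMap F[X] (RatFunc F) Q ≠ 0 := RatFunc.algebraMap_ne_zero hQ
  have key : ∀ p ∈ Submodule.span F {P, Q},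
      algebraMap F[X] (RatFunc F) p / algebraMap F[X] (RatFunc F) Q ∈
        IntermediateField.adjoin F {f} := by
    intro p hp
    obtain ⟨a, b, rfl⟩ := Submodule.mem_span_pair.1 hp
    have : algebraMap F[X] (RatFunc F) (a • P + b • Q) / algebraMap F[X] (RatFunc F) Q =
        a • f + algebraMap F (RatFunc F) b := by
      rw [hf, Algebra.smul_def a (_ / _), smul_eq_C_mul, smul_eq_C_mul, map_add, map_mul, map_mul,
        RatFunc.algebraMap_C, RatFunc.algebraMap_C, RatFunc.algebraMap_eq_C]
      field_simp
    rw [this]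
    exact add_mem (IntermediateField.smul_mem _
      (IntermediateField.mem_adjoin_simple_self F f)) (algebraMap_mem _ b)
  rw [← div_div_div_cancel_right₀ hQ']
  exact div_mem (key R (hle (Submodule.subset_span (by simp))))
    (key S (hle (Submodule.subset_span (by simp))))

theorem exists_num_sub_mul_denom_eq_mul_minpoly {f : RatFunc F} (hf : ¬∃ a, f = RatFunc.C a) :
    ∃ l : RatFunc F, l ≠ 0 ∧ ∀ i,
      RatFunc.C (f.num.coeff i) - f * RatFunc.C (f.denom.coeff i) =
        l * ((minpoly (IntermediateField.adjoin F {f}) (RatFunc.X : RatFunc F)).coeff i :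
          IntermediateField.adjoin F {f}) := by
  have hne : f.minpolyX (IntermediateField.adjoin F {f}) ≠ 0 :=
    fun h ↦ hf (f.minpolyX_eq_zero_iff.1 h)
  have hmin := minpoly.eq_of_irreducible (f.irreducible_minpolyX hf) f.minpolyX_aeval_X
  have hlc := leadingCoeff_ne_zero.2 hne
  refine ⟨((f.minpolyX (IntermediateField.adjoin F {f})).leadingCoeff :
    IntermediateField.adjoin F {f}), by simpa using hlc, fun i ↦ ?_⟩
  rw [← hmin, coeff_mul_C, ← MulMemClass.coe_mul, mul_left_comm, mul_inv_cancel₀ hlc, mul_one]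
  simp [RatFunc.minpolyX]

theorem span_num_denom_le_of_adjoin_eq {f g : RatFunc F} (hf : ¬∃ a, f = RatFunc.C a)
    (hg : ¬∃ a, g = RatFunc.C a)
    (h : IntermediateField.adjoin F {f} = IntermediateField.adjoin F {g}) :
    Submodule.span F {g.num, g.denom} ≤ Submodule.span F {f.num, f.denom} := by
  obtain ⟨l, hl, hlf⟩ := exists_num_sub_mul_denom_eq_mul_minpoly hf
  obtain ⟨m, hm, hmg⟩ := exists_num_sub_mul_denom_eq_mul_minpoly hg
  have hminpoly : ∀ {E E' : IntermediateField F (RatFunc F)}, E = E' → ∀ i,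
      ((minpoly E (RatFunc.X : RatFunc F)).coeff i : RatFunc F) =
        (minpoly E' (RatFunc.X : RatFunc F)).coeff i := by
    rintro E _ rfl i
    rfl
  have key : ∀ i, g.num.coeff i • (1 : RatFunc F) - g.denom.coeff i • g =
      f.num.coeff i • (m / l) - f.denom.coeff i • (m / l * f) := by
    intro i
    have h1 := hlf i
    rw [hminpoly h] at h1
    have h2 := hmg i
    simp only [Algebra.smul_def, RatFunc.algebraMap_eq_C, mul_one]
    rw [mul_comm _ g, h2]
    linear_combination (-(m / l)) * h1 + (-((minpoly (IntermediateField.adjoin F {g})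
      (RatFunc.X : RatFunc F)).coeff i : RatFunc F)) * div_mul_cancel₀ m hl
  have mem : ∀ φ : RatFunc F →ₗ[F] F,
      φ 1 • g.num - φ g • g.denom ∈ Submodule.span F {f.num, f.denom} := by
    intro φ
    refine Submodule.mem_span_pair.2 ⟨φ (m / l), -φ (m / l * f), ?_⟩
    ext i
    have := congrArg φ (key i)
    simp only [map_sub, map_smul, smul_eq_mul] at this
    simp only [coeff_add, coeff_sub, coeff_smul, smul_eq_mul]
    linear_combination -this
  have h1 : (1 : RatFunc F) ∉ Submodule.span F {g} := by
    rw [Submodule.mem_span_singleton]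
    rintro ⟨a, ha⟩
    have ha0 : a ≠ 0 := by rintro rfl; simp at ha
    refine hg ⟨a⁻¹, ?_⟩
    rw [← inv_smul_smul₀ ha0 g, ha, Algebra.smul_def, mul_one, RatFunc.algebraMap_eq_C]
  have h2 : g ∉ Submodule.span F {(1 : RatFunc F)} := by
    rw [Submodule.mem_span_singleton]
    rintro ⟨a, ha⟩
    exact hg ⟨a, by rw [← ha, Algebra.smul_def, mul_one, RatFunc.algebraMap_eq_C]⟩
  obtain ⟨φ, hφ, hφg⟩ := Submodule.exists_le_ker_of_notMem h1
  obtain ⟨ψ, hψ, hψ1⟩ := Submodule.exists_le_ker_of_notMem h2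
  have hφg' : φ g = 0 := hφg (Submodule.mem_span_singleton_self g)
  have hψ1' : ψ 1 = 0 := hψ1 (Submodule.mem_span_singleton_self 1)
  rw [Submodule.span_le, Set.pair_subset_iff]
  constructor
  · have := mem φ
    rw [hφg', zero_smul, sub_zero] at this
    exact (Submodule.smul_mem_iff _ hφ).1 this
  · have := mem ψ
    rw [hψ1', zero_smul, zero_sub, ← neg_smul] at this
    exact (Submodule.smul_mem_iff _ (neg_ne_zero.2 hψ)).1 this

/-- Nonconstant generators of the same subfield have numerators and denominators spanning the same
space of polynomials. -/
theorem span_num_denom_eq_of_adjoin_eq {f g : RatFunc F} (hf : 0 < ratDeg f)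
    (h : IntermediateField.adjoin F {f} = IntermediateField.adjoin F {g}) :
    Submodule.span F {f.num, f.denom} = Submodule.span F {g.num, g.denom} := by
  have hdeg : ratDeg f = ratDeg g := by
    rw [ratDeg, ratDeg, ← RatFunc.finrank_eq_max_natDegree, ← RatFunc.finrank_eq_max_natDegree, h]
  have hne : ∀ {k : RatFunc F}, 0 < ratDeg k → ¬∃ a, k = RatFunc.C a := by
    rintro k hk ⟨a, rfl⟩
    simp [ratDeg] at hk
  have hf' := hne hf
  have hg' := hne (hdeg ▸ hf)
  exact le_antisymm (span_num_denom_le_of_adjoin_eq hg' hf' h.symm)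
    (span_num_denom_le_of_adjoin_eq hf' hg' h)

theorem rcomp_C_mul_X (f : RatFunc F) (c : F) :
    rcomp f (RatFunc.C c * RatFunc.X) =
      algebraMap F[X] (RatFunc F) (f.num.comp (C c * X)) /
        algebraMap F[X] (RatFunc F) (f.denom.comp (C c * X)) := by
  have : ∀ p : F[X], aeval (RatFunc.C c * RatFunc.X) p =
      algebraMap F[X] (RatFunc F) (p.comp (C c * X)) := by
    intro p
    rw [← RatFunc.algebraMap_C, ← RatFunc.algebraMap_X, ← map_mul, aeval_algebraMap_apply,
      comp_eq_aeval]
  rw [rcomp, this, this]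

theorem map_aeval_span_pair (P Q : F[X]) (t : F[X]) :
    (Submodule.span F {P, Q}).map (aeval t : F[X] →ₐ[F] F[X]).toLinearMap =
      Submodule.span F {P.comp t, Q.comp t} := by
  rw [Submodule.map_span, Set.image_pair]
  rfl

end RatFunc

/-- Lemma 3.1: for `f ∈ F_q(X)` of degree `n > 0` and `c ∈ F_q^*` of multiplicative
order `d`, `F_q(f(X)) = F_q(f(cX))` iff the span of `{num f, denom f}` has the
indicated special form. -/
theorem span_characterization (q n : ℕ) (hq : IsPrimePow q)
    (F : Type*) [Field F] [Fintype F] (hF : Fintype.card F = q)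
    (f : RatFunc F) (hf : ratDeg f = n) (hn : 0 < n)
    (c : F) (hc0 : c ≠ 0) (hc1 : c ≠ 1) (d : ℕ) (hd : d = orderOf c) :
    IntermediateField.adjoin F {f} =
        IntermediateField.adjoin F {rcomp f (RatFunc.C c * RatFunc.X)} ↔
      ∃ (P₁ Q₁ : Polynomial F) (r₁ r₂ : ℕ), P₁.Monic ∧ Q₁.Monic ∧
        r₁ < d ∧ r₂ < d ∧
        Submodule.span F {f.num, f.denom} =
          Submodule.span F {Polynomial.X ^ r₁ * P₁.comp (Polynomial.X ^ d),
            Polynomial.X ^ r₂ * Q₁.comp (Polynomial.X ^ d)} ∧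
        (Polynomial.X ^ r₂ * Q₁.comp (Polynomial.X ^ d)).natDegree <
          (Polynomial.X ^ r₁ * P₁.comp (Polynomial.X ^ d)).natDegree ∧
        (Polynomial.X ^ r₁ * P₁.comp (Polynomial.X ^ d)).natDegree = n ∧
        IsCoprime (Polynomial.X ^ r₁ * P₁) (Polynomial.X ^ r₂ * Q₁) := by
  have hd0 : 0 < orderOf c :=
    orderOf_pos_iff.2 (isOfFinOrder_iff_pow_eq_one.2
      ⟨Fintype.card F - 1, by have := Fintype.one_lt_card (α := F); omega,
        FiniteField.pow_card_sub_one_eq_one c hc0⟩)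
  have hcop := f.isCoprime_num_denom
  have hden := f.denom_ne_zero
  have hden' : f.denom.comp (C c * X) ≠ 0 := fun h ↦
    hden ((comp_C_mul_X_eq_zero_iff (mem_nonZeroDivisors_of_ne_zero hc0)).1 h)
  have hmap := map_aeval_span_pair f.num f.denom (C c * X)
  subst hd
  constructor
  · intro h
    have hspan := span_num_denom_eq_of_adjoin_eq (hf ▸ hn) h
    have hcop' : IsCoprime (f.num.comp (C c * X)) (f.denom.comp (C c * X)) :=
      hcop.map (compRingHom (C c * X))
    rw [rcomp_C_mul_X, span_pair_num_denom_div hcop' hden',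
      ← hmap] at hspan
    obtain ⟨A, B, hA, hB, hlt, hcoeff, hAB⟩ :=
      exists_span_pair_eq_monic hcop (show 0 < ratDeg f from hf ▸ hn)
    rw [hAB, map_aeval_span_pair] at hspan
    obtain ⟨hAc, hBc⟩ := comp_C_mul_X_eq_of_span_pair_stable (c := c) hA hB hlt hcoeff
      (hspan.ge (Submodule.subset_span (by simp))) (hspan.ge (Submodule.subset_span (by simp)))
    obtain ⟨P₁, hP₁, hAP⟩ := exists_eq_X_pow_mul_comp_X_pow hA hc0 hd0 hAc
    obtain ⟨Q₁, hQ₁, hBQ⟩ := exists_eq_X_pow_mul_comp_X_pow hB hc0 hd0 hBc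
    refine ⟨P₁, Q₁, A.natDegree % orderOf c, B.natDegree % orderOf c, hP₁, hQ₁,
      Nat.mod_lt _ hd0, Nat.mod_lt _ hd0, ?_⟩
    have hABcop := isCoprime_of_span_pair_le hcop hAB.le
    rw [hAP, hBQ] at hABcop
    refine ⟨?_, ?_, ?_, isCoprime_X_pow_mul_of_comp hd0.ne' hABcop⟩ <;> rw [← hAP]
    · rw [← hBQ, hAB]
    · rwa [← hBQ]
    · rw [← hf, ← max_eq_left hlt.le]
      exact le_antisymm (natDegree_max_le_of_span_pair_le hAB.ge)
        (natDegree_max_le_of_span_pair_le hAB.le)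
  · rintro ⟨P₁, Q₁, r₁, r₂, -, -, -, -, hspan, -⟩
    have hstable : Submodule.span F {f.num.comp (C c * X), f.denom.comp (C c * X)} =
        Submodule.span F {f.num, f.denom} := by
      rw [← hmap, hspan, map_aeval_span_pair, X_pow_mul_comp_comp_C_mul_X,
        X_pow_mul_comp_comp_C_mul_X, span_pair_smul_smul (pow_ne_zero _ hc0) (pow_ne_zero _ hc0)]
    have h1 := div_mem_adjoin_of_span_pair_le hden hstable.le
    have h2 := div_mem_adjoin_of_span_pair_le hden' hstable.ge
    rw [← rcomp_C_mul_X, RatFunc.num_div_denom] at h1 h2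
    exact le_antisymm (IntermediateField.adjoin_simple_le_iff.2 h2)
      (IntermediateField.adjoin_simple_le_iff.2 h1)
end

section
/- Let q be a prime power and let f, g ∈ F_q[X] be nonconstant polynomials. Then there exist degree-one rational functions φ, ψ ∈ F_q(X) with g = φ ∘ f ∘ ψ if and only if there exist degree-one polynomials α, β ∈ F_q[X] with g = α ∘ f ∘ β. -/
open Polynomial

/-- A rational function of degree one is a Möbius transformation. -/
theorem exists_moebius_of_ratDeg_eq_one {F : Type*} [Field F] {φ : RatFunc F}
    (h : ratDeg φ = 1) :
    ∃ a b c d : F, a * d - b * c ≠ 0 ∧ φ.num = C a * X + C b ∧ φ.denom = C c * X + C d := by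
  unfold ratDeg at h
  obtain ⟨a, b, hnum⟩ := exists_eq_X_add_C_of_natDegree_le_one
    (show φ.num.natDegree ≤ 1 by omega)
  obtain ⟨c, d, hden⟩ := exists_eq_X_add_C_of_natDegree_le_one
    (show φ.denom.natDegree ≤ 1 by omega)
  refine ⟨a, b, c, d, fun hdet => ?_, hnum, hden⟩
  have hcop := φ.isCoprime_num_denom
  have hprop : C c * φ.num = C a * φ.denom := by
    have hC : (C a * C d - C b * C c : F[X]) = 0 := by
      rw [← C_mul, ← C_mul, ← C_sub, hdet, C_0]
    rw [hnum, hden]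
    linear_combination -hC
  have hc : φ.denom ∣ C c := hcop.symm.dvd_of_dvd_mul_right ⟨C a, by rw [hprop, mul_comm]⟩
  have ha : φ.num ∣ C a := hcop.dvd_of_dvd_mul_right ⟨C c, by rw [← hprop, mul_comm]⟩
  have hc0 : φ.denom.natDegree = 0 := by
    rcases eq_or_ne c 0 with rfl | hc'
    · simp [hden]
    · simpa using natDegree_le_of_dvd hc (by simpa using hc')
  have ha0 : φ.num.natDegree = 0 := by
    rcases eq_or_ne a 0 with rfl | ha'
    · simp [hnum]
    · simpa using natDegree_le_of_dvd ha (by simpa using ha')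
  omega

/-- Substitution of `f` in a polynomial, as a composition of rational functions. -/
theorem rcomp_algebraMap_left {F : Type*} [Field F] (f : F[X]) (ψ : RatFunc F) :
    rcomp (algebraMap F[X] (RatFunc F) f) ψ = aeval ψ f := by
  simp [rcomp, RatFunc.num_algebraMap, RatFunc.denom_algebraMap]

theorem aeval_algebraMap_ratFunc {F : Type*} [Field F] (f p : F[X]) :
    aeval (algebraMap F[X] (RatFunc F) p) f = algebraMap F[X] (RatFunc F) (f.comp p) := by
  rw [aeval_algebraMap_apply]
  rfl

/-- If a Möbius transformation of `f` at `1 / X` is a polynomial `g`, then `g` is an affine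
transformation of `f`. The hypothesis is the equation `g (c f + d) = a f + b` at `1 / X`,
with denominators cleared. -/
theorem exists_eq_comp_of_mul_reflect_eq {F : Type*} [Field F] {f g : F[X]}
    (hf : 0 < f.natDegree) {a b c d : F} (hdet : a * d - b * c ≠ 0)
    (h : g * reflect f.natDegree (C c * f + C d) = reflect f.natDegree (C a * f + C b)) :
    ∃ α : F[X], α.natDegree = 1 ∧ g = α.comp f := by
  set n := f.natDegree with hn
  set r := reflect n f with hr
  have hB : reflect n (C c * f + C d) = C c * r + C d * X ^ n := by
    rw [reflect_add, reflect_C_mul, reflect_C]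
  have hA : reflect n (C a * f + C b) = C a * r + C b * X ^ n := by
    rw [reflect_add, reflect_C_mul, reflect_C]
  have hdetC : (C (a * d - b * c)⁻¹ : F[X]) * (C a * C d - C b * C c) = 1 := by
    rw [← C_mul, ← C_mul, ← C_sub, ← C_mul, inv_mul_cancel₀ hdet, C_1]
  have hX : reflect n (C c * f + C d) ∣ X ^ n := by
    refine ⟨C (a * d - b * c)⁻¹ * (C a - C c * g), ?_⟩
    rw [hA, hB] at h
    rw [hB]
    linear_combination (-X ^ n) * hdetC + C (a * d - b * c)⁻¹ * C c * h
  have hR : reflect n (C c * f + C d) ∣ r := by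
    refine ⟨C (a * d - b * c)⁻¹ * (C d * g - C b), ?_⟩
    rw [hA, hB] at h
    rw [hB]
    linear_combination (-r) * hdetC - C (a * d - b * c)⁻¹ * C d * h
  have hcop : IsCoprime (X ^ n : F[X]) r := by
    refine IsCoprime.pow_left ((irreducible_X.coprime_iff_not_dvd).2 fun hdvd => ?_)
    rw [X_dvd_iff, hr, coeff_reflect, revAt_zero, hn, coeff_natDegree,
      leadingCoeff_eq_zero] at hdvd
    exact absurd hf (by simp [hn, hdvd])
  obtain ⟨k, hk, hkC⟩ := isUnit_iff.1 (hcop.isUnit_of_dvd' hX hR)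
  have hk0 : k ≠ 0 := hk.ne_zero
  have hfX : C c * f + C d = C k * X ^ n := by
    rw [← reflect_C, hkC, reflect_reflect]
  have hc : c ≠ 0 := by
    rintro rfl
    have := congrArg natDegree hfX
    rw [natDegree_C_mul_X_pow n k hk0] at this
    simp at this
    omega
  refine ⟨C ((b * c - a * d) * k⁻¹ * k⁻¹) * X
    + C (a * c⁻¹ + (b * c - a * d) * d * c⁻¹ * k⁻¹ * k⁻¹), ?_, ?_⟩
  · refine natDegree_linear (mul_ne_zero (mul_ne_zero ?_ (inv_ne_zero hk0)) (inv_ne_zero hk0))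
    exact fun h0 => hdet (by linear_combination -h0)
  · have hne : (C c * C k * C k : F[X]) ≠ 0 := by simp [hc, hk0]
    refine mul_left_cancel₀ hne ?_
    rw [← hkC, hA] at h
    rw [hB] at hkC
    have h1 : C c * C k * C k * g =
        C k * C k * C a + (C b * C c - C a * C d) * (C c * f + C d) := by
      linear_combination C c * C k * h - C a * C k * hkC - (C b * C c - C a * C d) * hfX
    rw [h1]
    have h2 : c * k * k * ((b * c - a * d) * k⁻¹ * k⁻¹) = (b * c - a * d) * c := by
      field_simp
    have h3 : c * k * k * (a * c⁻¹ + (b * c - a * d) * d * c⁻¹ * k⁻¹ * k⁻¹) =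
        k * k * a + (b * c - a * d) * d := by
      field_simp
    have h2' := congrArg (C : F → F[X]) h2
    have h3' := congrArg (C : F → F[X]) h3
    rw [add_comp, mul_comp, C_comp, C_comp, X_comp]
    simp only [C_mul, C_add, C_sub] at h2' h3' ⊢
    linear_combination -f * h2' - h3'

/-- If a Möbius transformation of a nonconstant polynomial `f` is a polynomial `g`, then it is
affine. -/
theorem exists_eq_comp_of_mul_eq {F : Type*} [Field F] {f g : F[X]}
    (hf : 0 < f.natDegree) {a b c d : F} (hdet : a * d - b * c ≠ 0)
    (h : g * (C c * f + C d) = C a * f + C b) :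
    ∃ α : F[X], α.natDegree = 1 ∧ g = α.comp f := by
  have hdvd : C c * f + C d ∣ C (a * d - b * c) := by
    refine ⟨C a - C c * g, ?_⟩
    simp only [C_sub, C_mul]
    linear_combination C c * h
  have hdeg : (C c * f + C d).natDegree = 0 := by
    have hle := natDegree_le_of_dvd hdvd (C_ne_zero.2 hdet)
    rwa [natDegree_C, Nat.le_zero] at hle
  obtain rfl : c = 0 := by
    by_contra hc
    rw [natDegree_add_C, natDegree_C_mul hc] at hdeg
    omega
  have had : a ≠ 0 ∧ d ≠ 0 := by
    constructor <;> rintro rfl <;> simp at hdet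
  refine ⟨C (a * d⁻¹) * X + C (b * d⁻¹),
    natDegree_linear (mul_ne_zero had.1 (inv_ne_zero had.2)), ?_⟩
  have hd : (C d * C d⁻¹ : F[X]) = 1 := by
    rw [← C_mul, mul_inv_cancel₀ had.2, C_1]
  simp only [add_comp, mul_comp, C_comp, X_comp, C_mul, C_0] at h ⊢
  linear_combination C d⁻¹ * h - g * hd

/-- A polynomial `f` at `y⁻¹` is the reflected polynomial at `y` up to a power of `y`. -/
theorem aeval_reflect_eq_pow_mul_aeval_inv {F K : Type*} [Field F] [Field K] [Algebra F K]
    {y : K} (hy : y ≠ 0) {n : ℕ} {f : F[X]} (hf : f.natDegree ≤ n) :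
    aeval y (reflect n f) = y ^ n * aeval y⁻¹ f := by
  let _ : Invertible y⁻¹ := invertibleOfNonzero (inv_ne_zero hy)
  have h := eval₂_reflect_mul_pow (algebraMap F K) y⁻¹ n f hf
  rw [invOf_eq_inv, inv_inv] at h
  rw [aeval_def, aeval_def, ← h, inv_pow]
  field_simp

/-- A Möbius transformation that is not affine is, up to a translation, the inverse of an
affine polynomial. -/
theorem moebius_eq_add_inv {K : Type*} [Field K] {r s t u x : K} (ht : t ≠ 0)
    (hdet : r * u - s * t ≠ 0) (hx : t * x + u ≠ 0) :
    (r * x + s) / (t * x + u) =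
      r / t + (t ^ 2 / (s * t - r * u) * x + t * u / (s * t - r * u))⁻¹ := by
  have hdet' : s * t - r * u ≠ 0 := fun h => hdet (by linear_combination -h)
  have : t ^ 2 / (s * t - r * u) * x + t * u / (s * t - r * u) =
      t * (t * x + u) / (s * t - r * u) := by
    field_simp
  rw [this, inv_div, div_add_div _ _ ht (mul_ne_zero ht hx), div_eq_div_iff hx (by positivity)]
  ring

/-- Lemma 8.1: two nonconstant polynomials over `F_q` are equivalent under
degree-one rational functions iff they are equivalent under degree-one
polynomials. -/
theorem poly_equiv_iff (q : ℕ) (hq : IsPrimePow q)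
    (F : Type*) [Field F] [Fintype F] (hF : Fintype.card F = q)
    (f g : Polynomial F) (hf : 0 < f.natDegree) (hg : 0 < g.natDegree) :
    (∃ φ ψ : RatFunc F, ratDeg φ = 1 ∧ ratDeg ψ = 1 ∧
        algebraMap (Polynomial F) (RatFunc F) g =
          rcomp φ (rcomp (algebraMap (Polynomial F) (RatFunc F) f) ψ)) ↔
      (∃ α β : Polynomial F, α.natDegree = 1 ∧ β.natDegree = 1 ∧
        g = α.comp (f.comp β)) := by
  constructor
  · rintro ⟨φ, ψ, hφ, hψ, h⟩
    obtain ⟨a, b, c, d, hdet, hnum, hden⟩ := exists_moebius_of_ratDeg_eq_one hφ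
    obtain ⟨r, s, t, u, hdet', hnum', hden'⟩ := exists_moebius_of_ratDeg_eq_one hψ
    have hinj := RatFunc.algebraMap_injective F
    have hg0 : algebraMap F[X] (RatFunc F) g ≠ 0 := by
      intro h0
      rw [map_eq_zero_iff _ hinj] at h0
      simp [h0] at hg
    rw [rcomp_algebraMap_left, rcomp, hnum, hden] at h
    have hB0 : aeval (aeval ψ f) (C c * X + C d) ≠ 0 := by
      intro h0
      rw [h0, div_zero] at h
      exact hg0 h
    rw [eq_div_iff hB0, ← aeval_comp, ← aeval_comp] at h
    simp only [add_comp, mul_comp, C_comp, X_comp] at h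
    have hψ' := ψ.num_div_denom
    rw [hnum', hden'] at hψ'
    rcases eq_or_ne t 0 with rfl | ht
    · have hru : r ≠ 0 ∧ u ≠ 0 := by
        constructor <;> rintro rfl <;> simp at hdet'
      set β : F[X] := C (r * u⁻¹) * X + C (s * u⁻¹) with hβ
      have hβdeg : β.natDegree = 1 :=
        natDegree_linear (mul_ne_zero hru.1 (inv_ne_zero hru.2))
      have hψβ : ψ = algebraMap F[X] _ β := by
        have hu : (C u : F[X]) ≠ 0 := by simpa using hru.2
        rw [← hψ', C_0, zero_mul, zero_add,
          div_eq_iff ((map_ne_zero_iff _ hinj).2 hu), ← map_mul]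
        congr 1
        have huC : (C u⁻¹ * C u : F[X]) = 1 := by
          rw [← C_mul, inv_mul_cancel₀ hru.2, C_1]
        simp only [hβ, C_mul]
        linear_combination (-(C r * X + C s)) * huC
      rw [hψβ, aeval_algebraMap_ratFunc, aeval_algebraMap_ratFunc, ← map_mul] at h
      have h' := hinj h
      simp only [add_comp, mul_comp, C_comp] at h'
      obtain ⟨α, hα, hgα⟩ := exists_eq_comp_of_mul_eq
        (by rw [natDegree_comp, hβdeg, mul_one]; exact hf) hdet h'
      exact ⟨α, β, hα, hβdeg, hgα⟩
    · set l : F := t ^ 2 / (s * t - r * u) with hl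
      set m : F := t * u / (s * t - r * u) with hm
      have hl0 : l ≠ 0 := div_ne_zero (pow_ne_zero 2 ht)
        fun h0 => hdet' (by linear_combination -h0)
      set L : F[X] := C l * X + C m with hL
      have hLdeg : L.natDegree = 1 := natDegree_linear hl0
      have hL0 : algebraMap F[X] (RatFunc F) L ≠ 0 := by
        rw [map_ne_zero_iff _ hinj]
        intro h0
        simp [h0] at hLdeg
      have hψL : ψ = (algebraMap F[X] (RatFunc F) L)⁻¹ + algebraMap F (RatFunc F) (r / t) := by
        have hCinj := (algebraMap F (RatFunc F)).injective
        have hx : algebraMap F (RatFunc F) t * RatFunc.X + algebraMap F (RatFunc F) u ≠ 0 := by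
          have := ψ.denom_ne_zero
          rw [hden', ← map_ne_zero_iff _ hinj] at this
          simpa using this
        have key := moebius_eq_add_inv (r := algebraMap F (RatFunc F) r)
          (s := algebraMap F (RatFunc F) s) ((map_ne_zero_iff _ hCinj).2 ht)
          (by rw [← map_mul, ← map_mul, ← map_sub]; exact (map_ne_zero_iff _ hCinj).2 hdet') hx
        rw [← hψ', hL, hl, hm, add_comm _⁻¹]
        simpa using key
      set f₁ : F[X] := f.comp (X + C (r / t)) with hf₁
      have hdeg : f₁.natDegree = f.natDegree := by
        rw [hf₁, natDegree_comp, natDegree_X_add_C, mul_one]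
      have hsub : ∀ p : F[X], aeval ψ p =
          aeval (algebraMap F[X] (RatFunc F) L)⁻¹ (p.comp (X + C (r / t))) := by
        intro p
        rw [aeval_comp, hψL]
        simp
      have hrefl : ∀ x y : F, algebraMap F[X] (RatFunc F)
          ((reflect f₁.natDegree (C x * f₁ + C y)).comp L) =
          algebraMap F[X] (RatFunc F) L ^ f₁.natDegree * aeval ψ (C x * f + C y) := by
        intro x y
        rw [← aeval_algebraMap_ratFunc, aeval_reflect_eq_pow_mul_aeval_inv hL0, hsub]
        · simp [hf₁]
        · rw [natDegree_add_C]
          exact natDegree_C_mul_le _ _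
      set M : F[X] := C l⁻¹ * (X - C m) with hM
      have hll : (C l * C l⁻¹ : F[X]) = 1 := by
        rw [← C_mul, mul_inv_cancel₀ hl0, C_1]
      have hLM : L.comp M = X := by
        simp only [hL, hM, add_comp, mul_comp, C_comp, X_comp]
        linear_combination (X - C m) * hll
      have hML : M.comp L = X := by
        simp only [hL, hM, sub_comp, mul_comp, C_comp, X_comp]
        linear_combination X * hll
      have h₁ : g * (reflect f₁.natDegree (C c * f₁ + C d)).comp L =
          (reflect f₁.natDegree (C a * f₁ + C b)).comp L := by
        apply hinj
        rw [map_mul, hrefl, hrefl, ← h]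
        ring
      have h₂ := congrArg (fun p => p.comp M) h₁
      simp only [mul_comp, comp_assoc, hLM, comp_X] at h₂
      obtain ⟨α, hα, hgα⟩ := exists_eq_comp_of_mul_reflect_eq (hdeg ▸ hf) hdet h₂
      refine ⟨α, (X + C (r / t)).comp L, hα, ?_, ?_⟩
      · rw [natDegree_comp, natDegree_X_add_C, hLdeg]
      · rw [← comp_assoc f, ← hf₁, ← comp_assoc, ← hgα, comp_assoc, hML, comp_X]
  · rintro ⟨α, β, hα, hβ, rfl⟩
    refine ⟨algebraMap F[X] _ α, algebraMap F[X] _ β, ?_, ?_, ?_⟩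
    · simp [ratDeg, RatFunc.num_algebraMap, RatFunc.denom_algebraMap, hα]
    · simp [ratDeg, RatFunc.num_algebraMap, RatFunc.denom_algebraMap, hβ]
    · simp only [rcomp_algebraMap_left, aeval_algebraMap_ratFunc]
end

section
/- Let q be a prime power with characteristic p and let n ≥ 1. Then 𝔐(q,n) = q^{n-2}/(q-1) + (1/(q-1))·Σ_{d | q-1, d > 1} φ(d)·q^{⌈n/d⌉-1} + E, where E = q^{n/p - 1} if p divides n, E = q^{-1} if n = 1, and E = 0 if p does not divide n and n > 1 (φ denotes Euler's totient function). -/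
open Polynomial

/-- The number of equivalence classes of polynomials of degree `n` over `F`, where
`f ~ g` iff `g = α ∘ f ∘ β` for degree-one polynomials `α, β`. -/
noncomputable def polyEquivCount (F : Type*) [Field F] (n : ℕ) : ℕ :=
  Nat.card (Quot (fun f g : {f : Polynomial F // f.natDegree = n} =>
    ∃ α β : Polynomial F, α.natDegree = 1 ∧ β.natDegree = 1 ∧
      (g : Polynomial F) = α.comp ((f : Polynomial F).comp β)))

namespace PolyCount

variable {F : Type*} [Field F]

/-- The invertible substitution `X ↦ scale * X + shift`. -/
@[ext]
structure AffineSubst (F : Type*) [Field F] where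
  scale : Fˣ
  shift : F

namespace AffineSubst

/-- The linear polynomial that is substituted for `X`. -/
noncomputable def toPoly (g : AffineSubst F) : F[X] := C (g.scale : F) * X + C g.shift

/-- Multiplication is chosen so that substitution becomes a left action. -/
instance : Mul (AffineSubst F) := ⟨fun g h => ⟨g.scale * h.scale, h.scale * g.shift + h.shift⟩⟩

instance : One (AffineSubst F) := ⟨⟨1, 0⟩⟩

instance : Inv (AffineSubst F) := ⟨fun g => ⟨g.scale⁻¹, -(g.scale⁻¹ * g.shift : F)⟩⟩

@[simp] theorem mul_scale (g h : AffineSubst F) : (g * h).scale = g.scale * h.scale := rfl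
@[simp] theorem mul_shift (g h : AffineSubst F) :
    (g * h).shift = h.scale * g.shift + h.shift := rfl
@[simp] theorem one_scale : (1 : AffineSubst F).scale = 1 := rfl
@[simp] theorem one_shift : (1 : AffineSubst F).shift = 0 := rfl
@[simp] theorem inv_scale (g : AffineSubst F) : g⁻¹.scale = g.scale⁻¹ := rfl
@[simp] theorem inv_shift (g : AffineSubst F) :
    g⁻¹.shift = -((g.scale⁻¹ : Fˣ) * g.shift : F) := rfl

instance : Group (AffineSubst F) :=
  Group.ofLeftAxioms
    (fun g h k => by ext <;> simp <;> ring)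
    (fun g => by ext <;> simp)
    (fun g => by ext <;> simp)

theorem toPoly_mul (g h : AffineSubst F) : (g * h).toPoly = h.toPoly.comp g.toPoly := by
  simp [toPoly, mul_add, ← mul_assoc]
  ring

@[simp] theorem toPoly_one : (1 : AffineSubst F).toPoly = X := by simp [toPoly]

@[simp] theorem natDegree_toPoly (g : AffineSubst F) : g.toPoly.natDegree = 1 :=
  natDegree_linear g.scale.ne_zero

@[simp] theorem leadingCoeff_toPoly (g : AffineSubst F) : g.toPoly.leadingCoeff = g.scale :=
  leadingCoeff_linear g.scale.ne_zero

theorem exists_toPoly_eq {β : F[X]} (h : β.natDegree = 1) :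
    ∃ g : AffineSubst F, g.toPoly = β := by
  obtain ⟨a, b, rfl⟩ := exists_eq_X_add_C_of_natDegree_le_one h.le
  have ha : a ≠ 0 := by rintro rfl; simp at h
  exact ⟨⟨Units.mk0 a ha, b⟩, rfl⟩

/-- An invertible substitution is a pair of a unit and a scalar. -/
def equivProd : AffineSubst F ≃ Fˣ × F where
  toFun g := (g.scale, g.shift)
  invFun x := ⟨x.1, x.2⟩

theorem conj_shift_eq_zero (a : Fˣ) (b : F) (ha : a ≠ 1) :
    ∃ h : AffineSubst F, h * ⟨a, 0⟩ * h⁻¹ = ⟨a, b⟩ := by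
  have h1 : (a : F) - 1 ≠ 0 := sub_ne_zero.mpr (by simpa using ha)
  refine ⟨⟨1, b / (a - 1)⟩, ?_⟩
  ext
  · simp
  · simp
    field_simp
    ring

theorem conj_translation (b : F) (hb : b ≠ 0) :
    ∃ h : AffineSubst F, h * ⟨1, 1⟩ * h⁻¹ = ⟨1, b⟩ := by
  refine ⟨⟨(Units.mk0 b hb)⁻¹, 0⟩, ?_⟩
  ext <;> simp

end AffineSubst

/-- The monic polynomial without constant term that is an affine function of `f`. -/
noncomputable def normalForm (f : F[X]) : F[X] := C f.leadingCoeff⁻¹ * (f - C (f.coeff 0))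

theorem leadingCoeff_C_mul_add_C {u : F} (hu : u ≠ 0) (v : F) {f : F[X]}
    (hf : f.natDegree ≠ 0) : (C u * f + C v).leadingCoeff = u * f.leadingCoeff := by
  rw [leadingCoeff_add_of_degree_lt', leadingCoeff_mul, leadingCoeff_C]
  rw [degree_C_mul hu]
  exact degree_C_le.trans_lt (natDegree_pos_iff_degree_pos.mp (Nat.pos_of_ne_zero hf))

theorem normalForm_C_mul_add_C {u : F} (hu : u ≠ 0) (v : F) {f : F[X]} (hf : f.natDegree ≠ 0) :
    normalForm (C u * f + C v) = normalForm f := by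
  have h0 : f.leadingCoeff ≠ 0 := by rintro h; simp_all
  rw [normalForm, leadingCoeff_C_mul_add_C hu v hf, normalForm]
  have : C u * f + C v - C ((C u * f + C v).coeff 0) = C u * (f - C (f.coeff 0)) := by
    simp; ring
  rw [this, ← mul_assoc, ← C_mul]
  congr 2
  field_simp

theorem exists_normalForm_eq {f : F[X]} (hf : f ≠ 0) :
    ∃ u v : F, u ≠ 0 ∧ normalForm f = C u * f + C v :=
  ⟨f.leadingCoeff⁻¹, -(f.leadingCoeff⁻¹ * f.coeff 0), by simpa using hf, by
    simp [normalForm]; ring⟩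

theorem eq_C_mul_normalForm_add_C (f : F[X]) (hf : f ≠ 0) :
    f = C f.leadingCoeff * normalForm f + C (f.coeff 0) := by
  have : f.leadingCoeff ≠ 0 := by simpa using hf
  rw [normalForm, ← mul_assoc, ← C_mul, mul_inv_cancel₀ this]
  simp

theorem normalForm_comp {f : F[X]} (hf : f.natDegree ≠ 0) (g : AffineSubst F) :
    normalForm ((normalForm f).comp g.toPoly) = normalForm (f.comp g.toPoly) := by
  obtain ⟨u, v, hu, h⟩ := exists_normalForm_eq (f := f) (by rintro rfl; simp at hf)
  rw [h]
  simp only [add_comp, mul_comp, C_comp]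
  exact normalForm_C_mul_add_C hu v (by simpa [natDegree_comp])

theorem natDegree_normalForm (f : F[X]) : (normalForm f).natDegree = f.natDegree := by
  rcases eq_or_ne f 0 with rfl | hf
  · simp [normalForm]
  · rw [normalForm, natDegree_C_mul (by simpa using hf), natDegree_sub_C]

theorem monic_normalForm {f : F[X]} (hf : f.natDegree ≠ 0) : (normalForm f).Monic := by
  have h0 : f ≠ 0 := by rintro rfl; simp at hf
  rw [Monic, normalForm, sub_eq_add_neg, mul_add, ← C_neg, ← C_mul,
    leadingCoeff_C_mul_add_C (by simpa using h0) _ hf]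
  exact inv_mul_cancel₀ (by simpa using h0)

theorem coeff_zero_normalForm (f : F[X]) : (normalForm f).coeff 0 = 0 := by
  simp [normalForm]

theorem normalForm_eq_self {f : F[X]} (hf : f.Monic) (h0 : f.coeff 0 = 0) : normalForm f = f := by
  simp [normalForm, hf.leadingCoeff, h0]

/-- Monic polynomials of degree `n` without constant term. -/
abbrev NormalPoly (F : Type*) [Field F] (n : ℕ) : Type _ :=
  {f : F[X] // f.Monic ∧ f.natDegree = n ∧ f.coeff 0 = 0}

namespace NormalPoly

variable {n : ℕ}

theorem pos (f : NormalPoly F n) : n ≠ 0 := by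
  obtain ⟨f, hm, rfl, h0⟩ := f
  intro h
  rw [hm.natDegree_eq_zero.mp h] at h0
  simp at h0

theorem natDegree_ne_zero (f : NormalPoly F n) : f.1.natDegree ≠ 0 := by
  rw [f.2.2.1]; exact f.pos

/-- Normalize a polynomial of positive degree. -/
noncomputable def ofPoly (hn : n ≠ 0) (f : F[X]) (hf : f.natDegree = n) : NormalPoly F n :=
  ⟨normalForm f, monic_normalForm (hf ▸ hn), (natDegree_normalForm f).trans hf,
    coeff_zero_normalForm f⟩

noncomputable instance : MulAction (AffineSubst F) (NormalPoly F n) where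
  smul g f := ofPoly f.pos (f.1.comp g.toPoly) (by simp [natDegree_comp, f.2.2.1])
  one_smul f := Subtype.ext <| by
    change normalForm (f.1.comp (1 : AffineSubst F).toPoly) = f.1
    simpa using normalForm_eq_self f.2.1 f.2.2.2
  mul_smul g h f := Subtype.ext <| by
    change normalForm (f.1.comp (g * h).toPoly) =
      normalForm ((normalForm (f.1.comp h.toPoly)).comp g.toPoly)
    rw [normalForm_comp, AffineSubst.toPoly_mul, comp_assoc]
    simpa [natDegree_comp] using f.natDegree_ne_zero

theorem coe_smul (g : AffineSubst F) (f : NormalPoly F n) :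
    (g • f).1 = normalForm (f.1.comp g.toPoly) := rfl

theorem mem_fixedBy_iff (g : AffineSubst F) (f : NormalPoly F n) :
    f ∈ MulAction.fixedBy (NormalPoly F n) g ↔
      f.1.comp g.toPoly = C ((g.scale : F) ^ n) * f.1 + C (f.1.eval g.shift) := by
  have hlc : (f.1.comp g.toPoly).leadingCoeff = (g.scale : F) ^ n := by
    rw [leadingCoeff_comp (by simp), f.2.1.leadingCoeff, f.2.2.1]; simp
  have hc : (f.1.comp g.toPoly).coeff 0 = f.1.eval g.shift := by
    simp [coeff_zero_eq_eval_zero, eval_comp, AffineSubst.toPoly]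
  rw [MulAction.mem_fixedBy, Subtype.ext_iff, coe_smul]
  constructor
  · intro h
    have h0 : f.1.comp g.toPoly ≠ 0 := by rw [← leadingCoeff_ne_zero, hlc]; simp
    have := eq_C_mul_normalForm_add_C _ h0
    rwa [h, hlc, hc] at this
  · intro h
    rw [h, normalForm_C_mul_add_C (by simp) _ f.natDegree_ne_zero,
      normalForm_eq_self f.2.1 f.2.2.2]

end NormalPoly

theorem polyEquivCount_eq_card_orbits {n : ℕ} (hn : n ≠ 0) : 
    Nat.card (Quot (fun f g : {f : Polynomial F // f.natDegree = n} =>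
    ∃ α β : Polynomial F, α.natDegree = 1 ∧ β.natDegree = 1 ∧
      (g : Polynomial F) = α.comp ((f : Polynomial F).comp β))) =
      Nat.card (Quotient (MulAction.orbitRel (AffineSubst F) (NormalPoly F n))) := by
  have hne {f : F[X]} (hf : f.natDegree = n) : f ≠ 0 := by rintro rfl; simp_all
  refine Nat.card_congr
    { toFun := Quot.lift (fun f => Quotient.mk _ (NormalPoly.ofPoly hn f.1 f.2)) ?_
      invFun := Quotient.lift (fun f => Quot.mk _ ⟨f.1, f.2.2.1⟩) ?_
      left_inv := ?_
      right_inv := ?_ }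
  · rintro ⟨f, hf⟩ ⟨g, hg⟩ ⟨α, β, hα, hβ, h⟩
    obtain ⟨a, rfl⟩ := AffineSubst.exists_toPoly_eq hα
    obtain ⟨b, rfl⟩ := AffineSubst.exists_toPoly_eq hβ
    refine Quotient.sound' ?_
    refine Setoid.symm' _ ((MulAction.orbitRel_apply ..).mpr ⟨b, Subtype.ext ?_⟩)
    change normalForm ((normalForm f).comp b.toPoly) = normalForm g
    simp only at h
    rw [normalForm_comp (hf ▸ hn), h]
    simp only [AffineSubst.toPoly, add_comp, mul_comp, C_comp, X_comp]
    rw [normalForm_C_mul_add_C a.scale.ne_zero]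
    change (f.comp b.toPoly).natDegree ≠ 0
    simpa [natDegree_comp, hf]
  · intro s t h
    obtain ⟨g, rfl⟩ := (MulAction.orbitRel_apply ..).mp h
    refine (Quot.sound ?_).symm
    have ht : (t.1.comp g.toPoly).natDegree = n := by simp [natDegree_comp, t.2.2.1]
    obtain ⟨u, v, hu, h⟩ := exists_normalForm_eq (hne ht)
    refine ⟨C u * X + C v, g.toPoly, natDegree_linear hu, by simp, ?_⟩
    simpa using! h
  · rintro ⟨f, hf⟩
    refine (Quot.sound ?_).symm
    obtain ⟨u, v, hu, h⟩ := exists_normalForm_eq (hne hf)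
    refine ⟨C u * X + C v, X, natDegree_linear hu, by simp, ?_⟩
    simpa using! h
  · rintro ⟨f⟩
    exact congrArg _ (Subtype.ext (normalForm_eq_self f.2.1 f.2.2.2))

/-- A monic polynomial whose lower-order coefficients vanish outside `T` is determined by its
coefficients in `T`, which are arbitrary. -/
theorem nonempty_equiv_supported (n : ℕ) (T : Finset ℕ) (hT : ∀ i ∈ T, i < n) :
    Nonempty ({f : F[X] // f.Monic ∧ f.natDegree = n ∧ ∀ i < n, i ∉ T → f.coeff i = 0} ≃
      (T → F)) := by
  refine ⟨Equiv.ofBijective (fun f i => f.1.coeff i) ⟨?_, ?_⟩⟩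
  · rintro ⟨f, hf, hfn, hfT⟩ ⟨g, hg, hgn, hgT⟩ h
    refine Subtype.ext (Polynomial.ext fun i => ?_)
    rcases lt_trichotomy i n with hi | hi | hi
    · by_cases hiT : i ∈ T
      · exact congrFun h ⟨i, hiT⟩
      · simp only [hfT i hi hiT, hgT i hi hiT]
    · rw [← hi] at hfn hgn
      exact (hfn ▸ hf.coeff_natDegree : f.coeff i = 1).trans
        (hgn ▸ hg.coeff_natDegree : g.coeff i = 1).symm
    · simp only [coeff_eq_zero_of_natDegree_lt (hfn ▸ hi), coeff_eq_zero_of_natDegree_lt (hgn ▸ hi)]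
  · intro c
    have hcoeff (i : ℕ) : (∑ j : T, C (c j) * X ^ (j : ℕ)).coeff i =
        if h : i ∈ T then c ⟨i, h⟩ else 0 := by
      simp only [finsetSum_coeff, coeff_C_mul, coeff_X_pow]
      split_ifs with h
      · rw [Finset.sum_eq_single ⟨i, h⟩] <;> simp
        grind
      · refine Finset.sum_eq_zero fun j _ => ?_
        rw [if_neg, mul_zero]
        rintro rfl
        exact h j.2
    have hdeg : (∑ j : T, C (c j) * X ^ (j : ℕ)).degree < (n : WithBot ℕ) :=
      (degree_lt_iff_coeff_zero _ _).mpr fun i hi => by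
        rw [hcoeff, dif_neg fun h => absurd (hT i h) (by lia)]
    refine ⟨⟨X ^ n + ∑ j : T, C (c j) * X ^ (j : ℕ), monic_X_pow_add hdeg, ?_, ?_⟩, ?_⟩
    · rw [natDegree_add_eq_left_of_degree_lt (by simpa using hdeg), natDegree_X_pow]
    · intro i hi hiT
      rw [coeff_add, hcoeff, dif_neg hiT, coeff_X_pow, if_neg hi.ne, add_zero]
    · funext i
      simp only [coeff_add, hcoeff, coeff_X_pow, if_neg (hT i i.2).ne, dif_pos i.2, zero_add]

theorem card_supported [Finite F] (n : ℕ) (T : Finset ℕ) (hT : ∀ i ∈ T, i < n) :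
    Nat.card {f : F[X] // f.Monic ∧ f.natDegree = n ∧ ∀ i < n, i ∉ T → f.coeff i = 0} =
      Nat.card F ^ T.card := by
  rw [Nat.card_congr (nonempty_equiv_supported n T hT).some, Nat.card_fun]
  simp

theorem normal_iff_supported {n : ℕ} (hn : n ≠ 0) (f : F[X]) :
    (f.Monic ∧ f.natDegree = n ∧ ∀ i < n, i ∉ Finset.Ioo 0 n → f.coeff i = 0) ↔
      f.Monic ∧ f.natDegree = n ∧ f.coeff 0 = 0 := by
  refine and_congr_right fun _ => and_congr_right fun _ => ⟨fun h => h 0 (by lia) (by simp), ?_⟩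
  intro h i hi hi'
  obtain rfl : i = 0 := by simp at hi'; lia
  exact h

namespace NormalPoly

variable {n : ℕ}

theorem finite_of_ne_zero [Finite F] (hn : n ≠ 0) : Finite (NormalPoly F n) :=
  ((Equiv.subtypeEquivRight (normal_iff_supported hn)).symm.trans
    (nonempty_equiv_supported n (Finset.Ioo 0 n) (by simp)).some).finite_iff.mpr inferInstance

theorem card_eq [Finite F] (hn : n ≠ 0) : Nat.card (NormalPoly F n) = Nat.card F ^ (n - 1) := by
  rw [← Nat.card_congr (Equiv.subtypeEquivRight (normal_iff_supported hn)),
    card_supported _ _ (by simp)]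
  simp

theorem card_fixedBy_conj (g h : AffineSubst F) :
    Nat.card (MulAction.fixedBy (NormalPoly F n) (h * g * h⁻¹)) =
      Nat.card (MulAction.fixedBy (NormalPoly F n) g) := by
  rw [← MulAction.smul_fixedBy]
  exact Set.ncard_image_of_injective _ (MulAction.injective h)

theorem card_fixedBy_one [Finite F] (hn : n ≠ 0) :
    Nat.card (MulAction.fixedBy (NormalPoly F n) (1 : AffineSubst F)) = Nat.card F ^ (n - 1) := by
  rw [MulAction.fixedBy_one_eq_univ, Nat.card_univ, card_eq hn]

theorem mem_fixedBy_homothety_iff (a : Fˣ) (f : NormalPoly F n) :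
    f ∈ MulAction.fixedBy (NormalPoly F n) (⟨a, 0⟩ : AffineSubst F) ↔
      ∀ i < n, a ^ i ≠ a ^ n → f.1.coeff i = 0 := by
  rw [mem_fixedBy_iff, Polynomial.ext_iff]
  simp only [AffineSubst.toPoly, C_0, add_zero, comp_C_mul_X_coeff, ← coeff_zero_eq_eval_zero,
    f.2.2.2, coeff_C_mul]
  constructor
  · intro h i _ hi
    by_contra h0
    exact hi (Units.ext (by simpa [h0, mul_comm] using h i))
  · intro h i
    rcases lt_trichotomy i n with hi | rfl | hi
    · by_cases hi' : a ^ i = a ^ n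
      · rw [mul_comm, ← Units.val_pow_eq_pow_val, hi', Units.val_pow_eq_pow_val]
      · simp [h i hi hi']
    · exact mul_comm _ _
    · simp [coeff_eq_zero_of_natDegree_lt (f.2.2.1.trans_lt hi)]

theorem card_modEq_Ioo (hn : n ≠ 0) {d : ℕ} (hd : 0 < d) :
    ((Finset.Ioo 0 n).filter fun i => i ≡ n [MOD d]).card = (n + d - 1) / d - 1 := by
  have h : (n + d - 1) / d - 1 = (n - 1) / d := by
    rw [show n + d - 1 = n - 1 + d by lia, Nat.add_div_right _ hd, Nat.add_sub_cancel]
  rw [h, ← Nat.Ioc_filter_dvd_card_eq_div]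
  refine Finset.card_nbij' (n - ·) (n - ·) ?_ ?_ ?_ ?_
  · intro i
    simp only [Finset.coe_filter, Finset.mem_Ioo, Finset.mem_Ioc, Set.mem_ofPred_eq]
    rintro ⟨hi, hm⟩
    exact ⟨by lia, (Nat.modEq_iff_dvd' hi.2.le).mp hm⟩
  · intro i
    simp only [Finset.coe_filter, Finset.mem_Ioo, Finset.mem_Ioc, Set.mem_ofPred_eq]
    rintro ⟨hi, hm⟩
    refine ⟨by lia, (Nat.modEq_iff_dvd' (by lia)).mpr ?_⟩
    rwa [Nat.sub_sub_self (by lia)]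
  · intro i
    simp only [Finset.coe_filter, Finset.mem_Ioo, Set.mem_ofPred_eq]
    lia
  · intro i
    simp only [Finset.coe_filter, Finset.mem_Ioc, Set.mem_ofPred_eq]
    lia

theorem card_fixedBy_of_scale_ne_one [Finite F] (hn : n ≠ 0) {a : Fˣ} (ha : a ≠ 1) (b : F) :
    Nat.card (MulAction.fixedBy (NormalPoly F n) (⟨a, b⟩ : AffineSubst F)) =
      Nat.card F ^ ((n + orderOf a - 1) / orderOf a - 1) := by
  obtain ⟨h, hh⟩ := AffineSubst.conj_shift_eq_zero a b ha
  rw [← hh, card_fixedBy_conj, ← card_modEq_Ioo hn (orderOf_pos a), 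
    ← card_supported n _ fun i hi => (Finset.mem_Ioo.mp (Finset.mem_filter.mp hi).1).2]
  refine Nat.card_congr ((Equiv.subtypeEquivRight (mem_fixedBy_homothety_iff a)).trans
    ((Equiv.subtypeSubtypeEquivSubtypeInter _ fun f : F[X] =>
      ∀ i < n, a ^ i ≠ a ^ n → f.coeff i = 0).trans (Equiv.subtypeEquivRight fun f => ?_)))
  rw [and_assoc, and_assoc]
  refine and_congr_right fun _ => and_congr_right fun _ => ?_
  simp only [ne_eq, pow_eq_pow_iff_modEq, Finset.mem_filter, Finset.mem_Ioo]
  constructor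
  · rintro ⟨h0, h⟩ i hi hi'
    rcases Nat.eq_zero_or_pos i with rfl | hpos
    · exact h0
    · exact h i hi fun hm => hi' ⟨⟨hpos, hi⟩, hm⟩
  · exact fun h => ⟨h 0 (by lia) (by simp), fun i hi hm => h i hi fun h' => hm h'.2⟩

end NormalPoly

section Translation

variable {p : ℕ}

theorem eq_C_of_comp_X_add_one [CharP F p] {f : F[X]} (hf : f.comp (X + 1) = f)
    (hd : f.natDegree < p) :
    f = C (f.eval 0) := by
  refine eq_of_natDegree_lt_card_of_eval_eq f _ (ι := Fin p) (f := fun i => ((i : ℕ) : F)) ?_ ?_ ?_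
  · intro i j hij
    exact Fin.ext (CharP.natCast_injOn_Iio F p i.2 j.2 hij)
  · rintro ⟨i, -⟩
    simp only [eval_C]
    induction i with
    | zero => simp
    | succ i ih =>
      rw [← ih (by lia)]
      conv_rhs => rw [← hf]
      simp [eval_comp]
  · simpa using hd

variable [hp : Fact p.Prime]

theorem natDegree_X_pow_sub_X : (X ^ p - X : F[X]).natDegree = p :=
  FiniteField.X_pow_card_sub_X_natDegree_eq F hp.out.one_lt

theorem monic_X_pow_sub_X : (X ^ p - X : F[X]).Monic :=
  monic_X_pow_sub (by rw [degree_X]; exact_mod_cast hp.out.one_lt)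

theorem coeff_zero_comp_X_pow_sub_X_add (g : F[X]) (c : F) :
    (g.comp (X ^ p - X) + C c * X).coeff 0 = g.coeff 0 := by
  simp [coeff_zero_eq_eval_zero, eval_comp, hp.out.ne_zero]

theorem natDegree_comp_X_pow_sub_X_add (g : F[X]) (c : F)
    (h : 1 < (g.comp (X ^ p - X) + C c * X).natDegree) :
    (g.comp (X ^ p - X) + C c * X).natDegree = g.natDegree * p ∧
      (g.comp (X ^ p - X) + C c * X).leadingCoeff = g.leadingCoeff := by
  have hX : (C c * X).natDegree ≤ 1 := natDegree_C_mul_le c X |>.trans natDegree_X_le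
  have h1 : (C c * X).natDegree < (g.comp (X ^ p - X)).natDegree := by
    have := natDegree_add_le (g.comp (X ^ p - X)) (C c * X)
    lia
  rw [natDegree_add_eq_left_of_natDegree_lt h1,
    leadingCoeff_add_of_degree_lt' (degree_lt_degree h1), natDegree_comp, leadingCoeff_comp,
    natDegree_X_pow_sub_X, monic_X_pow_sub_X.leadingCoeff]
  · simp
  · rw [natDegree_X_pow_sub_X]; exact hp.out.ne_zero

theorem comp_X_pow_sub_X_add_injective {g g' : F[X]} {c c' : F}
    (h : g.comp (X ^ p - X) + C c * X = g'.comp (X ^ p - X) + C c' * X) : g = g' ∧ c = c' := by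
  have h' : (g - g').comp (X ^ p - X) = C (c' - c) * X := by
    rw [sub_comp, C_sub]
    linear_combination h
  have hc : c' - c = 0 := by
    by_contra hne
    have := congrArg natDegree h'
    rw [natDegree_comp, natDegree_X_pow_sub_X, natDegree_C_mul_X _ hne] at this
    exact hp.out.one_lt.ne' (Nat.eq_one_of_mul_eq_one_left this)
  rw [hc, C_0, zero_mul, comp_eq_zero_iff] at h'
  refine ⟨?_, (sub_eq_zero.mp hc).symm⟩
  rcases h' with h' | ⟨-, h'⟩
  · exact sub_eq_zero.mp h'
  · have := congrArg natDegree h'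
    rw [natDegree_X_pow_sub_X, natDegree_C] at this
    exact absurd this hp.out.ne_zero

variable [CharP F p]

theorem X_pow_sub_X_comp_X_add_one : (X ^ p - X : F[X]).comp (X + 1) = X ^ p - X := by
  simp [add_pow_char]

theorem exists_eq_comp_of_comp_X_add_one {f : F[X]} (hf : f.comp (X + 1) = f) :
    ∃ g : F[X], f = g.comp (X ^ p - X) := by
  induction hd : f.natDegree using Nat.strong_induction_on generalizing f with
  | _ d ih =>
    rcases lt_or_ge d p with h | h
    · exact ⟨C (f.eval 0), by rw [C_comp]; exact eq_C_of_comp_X_add_one hf (hd ▸ h)⟩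
    have hdiv := modByMonic_add_div f (X ^ p - X : F[X])
    have hX : (X + 1 : F[X]) = X + C 1 := by simp
    have hdeg := degree_modByMonic_lt f (monic_X_pow_sub_X (F := F) (p := p))
    obtain ⟨hq, hr⟩ := div_modByMonic_unique ((f /ₘ (X ^ p - X)).comp (X + 1))
      ((f %ₘ (X ^ p - X)).comp (X + 1)) (monic_X_pow_sub_X (F := F) (p := p))
      ⟨by
        have := congrArg (fun f : F[X] => f.comp (X + 1)) hdiv
        simpa only [add_comp, mul_comp, X_pow_sub_X_comp_X_add_one, hf] using this, by
        rwa [hX, ← taylor_apply, degree_taylor]⟩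
    obtain ⟨g, hg⟩ := ih _ (by
      rw [natDegree_divByMonic _ monic_X_pow_sub_X, natDegree_X_pow_sub_X]
      have := hp.out.pos
      lia) hq.symm rfl
    have hc := eq_C_of_comp_X_add_one (p := p) hr.symm (by
      have := natDegree_modByMonic_lt f (monic_X_pow_sub_X (F := F) (p := p))
        (fun h => by
          have := congrArg natDegree h
          rw [natDegree_X_pow_sub_X, natDegree_one] at this
          exact hp.out.ne_zero this)
      rwa [natDegree_X_pow_sub_X] at this)
    refine ⟨C ((f %ₘ (X ^ p - X)).eval 0) + X * g, ?_⟩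
    rw [add_comp, C_comp, mul_comp, X_comp, ← hc, ← hg, hdiv]

namespace NormalPoly

variable {n : ℕ}

theorem mem_fixedBy_translation_iff (f : NormalPoly F n) :
    f ∈ MulAction.fixedBy (NormalPoly F n) (⟨1, 1⟩ : AffineSubst F) ↔
      f.1.comp (X + 1) = f.1 + C (f.1.eval 1) := by
  rw [mem_fixedBy_iff]
  simp [AffineSubst.toPoly]

theorem exists_comp_add_of_mem_fixedBy_translation {f : NormalPoly F n}
    (hf : f ∈ MulAction.fixedBy (NormalPoly F n) (⟨1, 1⟩ : AffineSubst F)) :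
    ∃ (g : F[X]) (c : F), f.1 = g.comp (X ^ p - X) + C c * X := by
  rw [mem_fixedBy_translation_iff] at hf
  obtain ⟨g, hg⟩ := exists_eq_comp_of_comp_X_add_one (p := p)
    (f := f.1 - C (f.1.eval 1) * X) (by
      simp only [sub_comp, mul_comp, C_comp, X_comp, hf]
      ring)
  exact ⟨g, f.1.eval 1, by rw [← hg]; ring⟩

theorem dvd_of_mem_fixedBy_translation (hn : 1 < n) {f : NormalPoly F n}
    (hf : f ∈ MulAction.fixedBy (NormalPoly F n) (⟨1, 1⟩ : AffineSubst F)) : p ∣ n := by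
  obtain ⟨g, c, h⟩ := exists_comp_add_of_mem_fixedBy_translation (p := p) hf
  have hd := f.2.2.1
  rw [h] at hd
  have := (natDegree_comp_X_pow_sub_X_add g c (hd.symm ▸ hn)).1
  exact ⟨g.natDegree, by rw [← hd, this, _root_.mul_comm]⟩

theorem nonempty_equiv_fixedBy_translation {m : ℕ} (hm : m ≠ 0) :
    Nonempty (NormalPoly F m × F ≃
      MulAction.fixedBy (NormalPoly F (m * p)) (⟨1, 1⟩ : AffineSubst F)) := by
  have hmp : 1 < m * p := lt_of_lt_of_le hp.out.one_lt (Nat.le_mul_of_pos_left _ (by lia))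
  have hdeg (x : NormalPoly F m × F) :
      (x.1.1.comp (X ^ p - X) + C x.2 * X).natDegree = m * p := by
    have h1 : (x.1.1.comp (X ^ p - X)).natDegree = m * p := by
      rw [natDegree_comp, natDegree_X_pow_sub_X, x.1.2.2.1]
    rw [natDegree_add_eq_left_of_natDegree_lt, h1]
    rw [h1]
    exact ((natDegree_C_mul_le x.2 X).trans natDegree_X_le).trans_lt hmp
  refine ⟨Equiv.ofBijective (fun x => ⟨⟨x.1.1.comp (X ^ p - X) + C x.2 * X, ?_, hdeg x, ?_⟩, ?_⟩)
    ⟨?_, ?_⟩⟩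
  · rw [Monic, (natDegree_comp_X_pow_sub_X_add x.1.1 x.2 (by rwa [hdeg])).2, x.1.2.1.leadingCoeff]
  · rw [coeff_zero_comp_X_pow_sub_X_add, x.1.2.2.2]
  · rw [mem_fixedBy_translation_iff]
    have h0 := x.1.2.2.2
    rw [coeff_zero_eq_eval_zero] at h0
    simp only [add_comp, comp_assoc, X_pow_sub_X_comp_X_add_one, mul_comp, C_comp, X_comp]
    simp [eval_comp, h0]
    ring
  · intro x y h
    obtain ⟨h1, h2⟩ := comp_X_pow_sub_X_add_injective
      (congrArg (fun f => f.1.1) h)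
    exact Prod.ext (Subtype.ext h1) h2
  · rintro ⟨f, hf⟩
    obtain ⟨g, c, h⟩ := exists_comp_add_of_mem_fixedBy_translation (p := p) hf
    have hd := f.2.2.1
    have hl := f.2.1
    have h0 := f.2.2.2
    rw [h] at hd
    obtain ⟨hd', hl'⟩ := natDegree_comp_X_pow_sub_X_add g c (by rwa [hd])
    refine ⟨(⟨g, ?_, ?_, ?_⟩, c), Subtype.ext (Subtype.ext h.symm)⟩
    · rwa [Monic, ← hl', ← h]
    · exact Nat.eq_of_mul_eq_mul_right hp.out.pos (hd'.symm.trans hd)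
    · rwa [h, coeff_zero_comp_X_pow_sub_X_add] at h0

theorem card_fixedBy_translation [Finite F] (hn : n ≠ 0) {b : F} (hb : b ≠ 0) :
    Nat.card (MulAction.fixedBy (NormalPoly F n) (⟨1, b⟩ : AffineSubst F)) =
      if p ∣ n then Nat.card F ^ (n / p) else if n = 1 then 1 else 0 := by
  obtain ⟨h, hh⟩ := AffineSubst.conj_translation b hb
  rw [← hh, card_fixedBy_conj]
  split_ifs with hdvd h1
  · obtain ⟨m, rfl⟩ := hdvd
    rw [_root_.mul_comm p m] at hn ⊢
    have hm : m ≠ 0 := left_ne_zero_of_mul hn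
    rw [Nat.mul_div_cancel _ hp.out.pos,
      ← Nat.card_congr (nonempty_equiv_fixedBy_translation (F := F) (p := p) hm).some,
      Nat.card_prod, card_eq hm, pow_sub_one_mul hm]
  · subst h1
    have : MulAction.fixedBy (NormalPoly F 1) (⟨1, 1⟩ : AffineSubst F) = Set.univ := by
      refine Set.eq_univ_of_forall fun f => ?_
      have hX := f.2.1.eq_X_add_C f.2.2.1
      rw [f.2.2.2, C_0, add_zero] at hX
      rw [mem_fixedBy_translation_iff, hX]
      simp
    rw [this, Nat.card_univ, card_eq one_ne_zero]
    simp
  · rw [Nat.card_eq_zero]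
    refine Or.inl ⟨fun f => hdvd ?_⟩
    exact dvd_of_mem_fixedBy_translation (by lia) f.2

end NormalPoly

end Translation

theorem sum_units_orderOf [Fintype F] [DecidableEq F] {M : Type*} [AddCommMonoid M] (w : ℕ → M) :
    ∑ a ∈ Finset.univ.erase (1 : Fˣ), w (orderOf a) =
      ∑ d ∈ (Fintype.card F - 1).divisors.filter (fun d => 1 < d), Nat.totient d • w d := by
  have hmaps : ∀ a ∈ Finset.univ.erase (1 : Fˣ),
      orderOf a ∈ (Fintype.card F - 1).divisors.filter (fun d => 1 < d) := by
    intro a ha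
    have h1 : orderOf a ≠ 1 := by simpa using ha
    have := orderOf_pos a
    rw [← Fintype.card_units]
    simp only [Finset.mem_filter, Nat.mem_divisors]
    exact ⟨⟨orderOf_dvd_card, Fintype.card_ne_zero⟩, by lia⟩
  rw [← Finset.sum_fiberwise_of_maps_to hmaps]
  refine Finset.sum_congr rfl fun d hd => ?_
  simp only [Finset.mem_filter, Nat.mem_divisors] at hd
  rw [← IsCyclic.card_orderOf_eq_totient (α := Fˣ) (by rw [Fintype.card_units]; exact hd.1.1),
    ← Finset.sum_const]
  refine Finset.sum_congr ?_ ?_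
  · ext a
    simp only [Finset.mem_filter, Finset.mem_erase, Finset.mem_univ, and_true, true_and,
      and_iff_right_iff_imp]
    rintro rfl rfl
    simp at hd
  · intro a ha
    rw [(Finset.mem_filter.mp ha).2]

theorem polyEquivCount_mul_card [Fintype F] {n : ℕ} (hn : n ≠ 0) (p : ℕ) [Fact p.Prime]
    [CharP F p] :
    polyEquivCount F n * ((Fintype.card F - 1) * Fintype.card F) =
      Fintype.card F ^ (n - 1) +
      (Fintype.card F - 1) * (if p ∣ n then Fintype.card F ^ (n / p) else if n = 1 then 1 else 0) +
      ∑ d ∈ (Fintype.card F - 1).divisors.filter (fun d => 1 < d),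
        Nat.totient d * (Fintype.card F * Fintype.card F ^ ((n + d - 1) / d - 1)) := by
  classical
  have := NormalPoly.finite_of_ne_zero (F := F) hn
  let := Fintype.ofFinite (NormalPoly F n)
  let : Fintype (AffineSubst F) := Fintype.ofEquiv _ AffineSubst.equivProd.symm
  have hcard : Fintype.card (AffineSubst F) = (Fintype.card F - 1) * Fintype.card F := by
    rw [Fintype.card_congr AffineSubst.equivProd, Fintype.card_prod, Fintype.card_units]
  rw [← hcard, polyEquivCount, polyEquivCount_eq_card_orbits hn, Nat.card_eq_fintype_card,
    ← MulAction.sum_card_fixedBy_eq_card_orbits_mul_card_group]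
  simp only [← Nat.card_eq_fintype_card (α := MulAction.fixedBy _ _)]
  rw [← AffineSubst.equivProd.symm.sum_comp, Fintype.sum_prod_type,
    ← Finset.add_sum_erase _ _ (Finset.mem_univ 1)]
  congr 1
  · rw [← Finset.add_sum_erase _ _ (Finset.mem_univ 0)]
    congr 1
    · rw [← Nat.card_eq_fintype_card (α := F)]
      exact NormalPoly.card_fixedBy_one hn
    · refine (Finset.sum_congr rfl fun b hb => NormalPoly.card_fixedBy_translation (p := p) hn
        (Finset.ne_of_mem_erase hb)).trans ?_
      simp [Nat.card_eq_fintype_card]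
  · simp only [← smul_eq_mul (a := Nat.totient _)]
    rw [← sum_units_orderOf (F := F)
      fun d => Fintype.card F * Fintype.card F ^ ((n + d - 1) / d - 1)]
    refine Finset.sum_congr rfl fun a ha => ?_
    refine (Finset.sum_congr rfl fun b _ => NormalPoly.card_fixedBy_of_scale_ne_one hn
        (Finset.ne_of_mem_erase ha) b).trans ?_
    simp [Nat.card_eq_fintype_card]

end PolyCount

/-- Theorem 8.2: the number `𝔐(q,n)` of equivalence classes of polynomials of
degree `n` over `F_q`, where `p` is the characteristic of `F_q`. -/
theorem poly_count (q n p : ℕ) (hq : IsPrimePow q) (hn : 1 ≤ n)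
    (F : Type*) [Field F] [Fintype F] (hF : Fintype.card F = q) [CharP F p] :
    (polyEquivCount F n : ℚ) =
      (q : ℚ) ^ ((n : ℤ) - 2) / ((q : ℚ) - 1)
        + (1 / ((q : ℚ) - 1)) *
            ∑ d ∈ (q - 1).divisors.filter (fun d => 1 < d),
              (Nat.totient d : ℚ) * (q : ℚ) ^ ((n + d - 1) / d - 1)
        + (if p ∣ n then (q : ℚ) ^ (n / p - 1)
           else if n = 1 then (q : ℚ)⁻¹
           else 0) := by
  have hp : p.Prime := CharP.char_is_prime F p
  have : Fact p.Prime := ⟨hp⟩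
  have hn0 : n ≠ 0 := by lia
  have hq1 : 1 < q := hq.one_lt
  have key := congrArg (Nat.cast : ℕ → ℚ) (PolyCount.polyEquivCount_mul_card (F := F) hn0 p)
  rw [hF] at key
  push_cast [Nat.cast_sub hq1.le] at key
  have hq0 : (q : ℚ) ≠ 0 := by positivity
  have hq1' : (q : ℚ) - 1 ≠ 0 := sub_ne_zero.mpr (by exact_mod_cast hq1.ne')
  have hpow : (q : ℚ) ^ (n - 1) = (q : ℚ) ^ ((n : ℤ) - 2) * q := by
    rw [← zpow_natCast, ← zpow_add_one₀ hq0]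
    congr 1
    lia
  have hE : (if p ∣ n then (q : ℚ) ^ (n / p) else if n = 1 then 1 else 0) =
      (if p ∣ n then (q : ℚ) ^ (n / p - 1) else if n = 1 then (q : ℚ)⁻¹ else 0) * q := by
    split_ifs with h
    · rw [pow_sub_one_mul]
      exact (Nat.div_pos (Nat.le_of_dvd hn h) hp.pos).ne'
    · exact (inv_mul_cancel₀ hq0).symm
    · simp
  have hsum : ∑ d ∈ (q - 1).divisors.filter (fun d => 1 < d),
        (Nat.totient d : ℚ) * (q * (q : ℚ) ^ ((n + d - 1) / d - 1)) =
      (∑ d ∈ (q - 1).divisors.filter (fun d => 1 < d),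
        (Nat.totient d : ℚ) * (q : ℚ) ^ ((n + d - 1) / d - 1)) * q := by
    rw [Finset.sum_mul]
    exact Finset.sum_congr rfl fun d _ => by ring
  rw [hpow, hE, hsum] at key
  refine mul_right_cancel₀ (mul_ne_zero hq1' hq0) (key.trans ?_)
  generalize (if p ∣ n then (q : ℚ) ^ (n / p - 1) else if n = 1 then (q : ℚ)⁻¹ else 0) = E
  field_simp
  ring
end
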